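/- Let d ≥ 2 and let t be an integer with 1 ≤ t ≤ d−1. Let P ∈ ℝ[x_1,…,x_d] be a polynomial of degree δ that depends non-trivially on each of the variables x_1,…,x_d. Suppose that P is NOT of either of the following forms: (i) P(x_1,…,x_d) = f(u_1(x_1)+⋯+u_d(x_d)) for some nonconstant univariate real polynomials f, u_1,…,u_d such that there exists an index set I ⊆ {1,…,d} with |I| = d − ⌊(t−1)/2⌋ and u_i ≡_a u_j for all i, j ∈ I; (ii) P(x_1,…,x_d) = f(u_1(x_1)·…·u_d(x_d)) for some nonconstant univariate real polynomials f, u_1,…,u_d such that there exists an index set I ⊆ {1,…,d} with |I| = d − ⌊(t−1)/2⌋ and u_i ≡_m u_j for all i, j ∈ I. Then there exists a constant c > 0, depending only on δ, d and t, such that for every finite set A ⊂ ℝ with |A| = n, we have |P(A,…,A)| ≥ c · n^{3/2 − 1/2^{t+1}}. -/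

import Mathlib

open Polynomial Pointwise
noncomputable section

/-- `p ≡_a q` : there is a nonzero real `λ` with `p(x) = λ q(x)` for all real `x`. -/
def EquivA (p q : Polynomial ℝ) : Prop :=
  ∃ l : ℝ, l ≠ 0 ∧ ∀ x : ℝ, p.eval x = l * q.eval x

/-- `p ≡_m q` : there is a positive rational `κ` with `|p(x)| = |q(x)|^κ` for all real `x`. -/
def EquivM (p q : Polynomial ℝ) : Prop :=
  ∃ k : ℚ, 0 < k ∧ ∀ x : ℝ, |p.eval x| = |q.eval x| ^ (k : ℝ)

section

/-- number of elements of `S` between `x` and `y` -/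
def gap (S : Finset ℝ) (x y : ℝ) : ℕ := (S.filter fun s => x ⊓ y ≤ s ∧ s ≤ x ⊔ y).card

/-- pairs of `S` that are close in rank -/
def closePairs (S : Finset ℝ) (L : ℕ) : Finset (ℝ × ℝ) :=
  (S ×ˢ S).filter fun p => gap S p.1 p.2 ≤ L

lemma card_up (S : Finset ℝ) (L : ℕ) (s : ℝ) :
    (S.filter fun s' => s ≤ s' ∧ (S.filter fun q => s ≤ q ∧ q ≤ s').card ≤ L).card ≤ L := by
  classical
  set T := S.filter fun s' => s ≤ s' ∧ (S.filter fun q => s ≤ q ∧ q ≤ s').card ≤ L with hT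
  rcases T.eq_empty_or_nonempty with h | h
  · simp [h]
  · have hm := T.max'_mem h
    have hm2 := (Finset.mem_filter.1 hm).2.2
    refine le_trans (Finset.card_le_card ?_) hm2
    intro q hq
    have hq' := Finset.mem_filter.1 hq
    exact Finset.mem_filter.2 ⟨hq'.1, hq'.2.1, T.le_max' q hq⟩

lemma card_down (S : Finset ℝ) (L : ℕ) (s : ℝ) :
    (S.filter fun s' => s' ≤ s ∧ (S.filter fun q => s' ≤ q ∧ q ≤ s).card ≤ L).card ≤ L := by
  classical
  set T := S.filter fun s' => s' ≤ s ∧ (S.filter fun q => s' ≤ q ∧ q ≤ s).card ≤ L with hT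
  rcases T.eq_empty_or_nonempty with h | h
  · simp [h]
  · have hm := T.min'_mem h
    have hm2 := (Finset.mem_filter.1 hm).2.2
    refine le_trans (Finset.card_le_card ?_) hm2
    intro q hq
    have hq' := Finset.mem_filter.1 hq
    exact Finset.mem_filter.2 ⟨hq'.1, T.min'_le q hq, hq'.2.1⟩

lemma card_closePairs (S : Finset ℝ) (L : ℕ) : (closePairs S L).card ≤ S.card * (2 * L) := by
  classical
  have h1 : closePairs S L ⊆ S.biUnion fun s =>
      (((S.filter fun s' => s ≤ s' ∧ (S.filter fun q => s ≤ q ∧ q ≤ s').card ≤ L) ∪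
       (S.filter fun s' => s' ≤ s ∧ (S.filter fun q => s' ≤ q ∧ q ≤ s).card ≤ L)).image
        fun s' => (s, s')) := by
    rintro ⟨s, s'⟩ h
    obtain ⟨h1, h2⟩ := Finset.mem_filter.1 h
    obtain ⟨h3, h4⟩ := Finset.mem_product.1 h1
    simp only at h2 h3 h4
    refine Finset.mem_biUnion.2 ⟨s, h3, Finset.mem_image.2 ⟨s', ?_, rfl⟩⟩
    rcases le_total s s' with hs | hs
    · simp only [gap, inf_eq_left.2 hs, sup_eq_right.2 hs] at h2
      exact Finset.mem_union_left _ (Finset.mem_filter.2 ⟨h4, hs, h2⟩)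
    · simp only [gap, inf_eq_right.2 hs, sup_eq_left.2 hs] at h2
      exact Finset.mem_union_right _ (Finset.mem_filter.2 ⟨h4, hs, h2⟩)
  refine (Finset.card_le_card h1).trans (Finset.card_biUnion_le_card_mul _ _ _ ?_)
  intro s _
  refine Finset.card_image_le.trans ((Finset.card_union_le _ _).trans ?_)
  have := card_up S L s
  have := card_down S L s
  omega

/-- enumeration of a finite set of reals -/
lemma exists_enum (A : Finset ℝ) : ∃ a : ℕ → ℝ, (∀ i < A.card, a i ∈ A) ∧
    (∀ i j, i < j → j < A.card → a i < a j) := by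
  classical
  refine ⟨fun i => if h : i < A.card then A.orderEmbOfFin rfl ⟨i, h⟩ else 0, ?_, ?_⟩
  · intro i hi
    simp [hi]
  · intro i j hij hj
    simp [hj, hij.trans hj, hij]

lemma window (n r : ℕ) (a : ℕ → ℝ) (ha : ∀ i j, i < j → j < n → a i < a j) (ρ : ℝ) :
    ((Finset.range (n - r)).filter fun i => a i ≤ ρ ∧ ρ ≤ a (i + r)).card ≤ r + 1 := by
  classical
  set T := (Finset.range (n - r)).filter fun i => a i ≤ ρ ∧ ρ ≤ a (i + r) with hT
  rcases T.eq_empty_or_nonempty with h | h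
  · simp [h]
  · have hm := T.min'_mem h
    obtain ⟨hm1, hm2, hm3⟩ := Finset.mem_filter.1 hm
    have : T ⊆ Finset.Icc (T.min' h) (T.min' h + r) := by
      intro q hq
      obtain ⟨hq1, hq2, hq3⟩ := Finset.mem_filter.1 hq
      refine Finset.mem_Icc.2 ⟨T.min'_le q hq, ?_⟩
      by_contra hlt
      have := ha (T.min' h + r) q (by omega) (by have := Finset.mem_range.1 hq1; omega)
      linarith
    refine (Finset.card_le_card this).trans ?_
    simp; omega

/-- squeeze: sum of gaps -/
lemma squeeze_sum (n r D : ℕ) (a : ℕ → ℝ) (ha : ∀ i j, i < j → j < n → a i < a j)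
    (T : Set ℝ) (hT : T.OrdConnected) (haT : ∀ i < n, a i ∈ T)
    (g : ℝ → ℝ) (hg : ContinuousOn g T)
    (hfib : ∀ s, ∃ Z : Finset ℝ, Z.card ≤ D ∧ ∀ ρ ∈ T, g ρ = s → ρ ∈ Z) (S : Finset ℝ) :
    ∑ i ∈ Finset.range (n - r), gap S (g (a i)) (g (a (i + r)))
      ≤ S.card * (D * (r + 1)) := by
  classical
  simp_rw [gap, Finset.card_filter]
  rw [Finset.sum_comm]
  rw [← smul_eq_mul]
  refine Finset.sum_le_card_nsmul _ _ _ ?_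
  intro s _
  rw [← Finset.card_filter]
  obtain ⟨Z, hZ, hZ2⟩ := hfib s
  have hsub : ((Finset.range (n - r)).filter fun i => g (a i) ⊓ g (a (i + r)) ≤ s ∧ s ≤ g (a i) ⊔ g (a (i + r))) ⊆
      Z.biUnion fun ρ => (Finset.range (n - r)).filter fun i => a i ≤ ρ ∧ ρ ≤ a (i + r) := by
    intro i hi
    obtain ⟨hi1, hi2⟩ := Finset.mem_filter.1 hi
    have hir := Finset.mem_range.1 hi1
    have hle : a i ≤ a (i + r) := by
      rcases Nat.eq_zero_or_pos r with h0 | h0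
      · simp [h0]
      · exact (ha _ _ (by omega) (by omega)).le
    have hsubT : Set.uIcc (a i) (a (i + r)) ⊆ T :=
      hT.uIcc_subset (haT _ (by omega)) (haT _ (by omega))
    obtain ⟨ρ, hρ, hρs⟩ := intermediate_value_uIcc (hg.mono hsubT) hi2
    refine Finset.mem_biUnion.2 ⟨ρ, hZ2 ρ (hsubT hρ) hρs, Finset.mem_filter.2 ⟨hi1, ?_⟩⟩
    rw [Set.uIcc_of_le hle] at hρ
    exact hρ
  refine (Finset.card_le_card hsub).trans
    ((Finset.card_biUnion_le_card_mul _ _ _ fun ρ _ => window n r a ha ρ).trans ?_)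
  exact Nat.mul_le_mul_right _ hZ

lemma squeeze (n r D : ℕ) (a : ℕ → ℝ) (ha : ∀ i j, i < j → j < n → a i < a j)
    (T : Set ℝ) (hT : T.OrdConnected) (haT : ∀ i < n, a i ∈ T)
    (g : ℝ → ℝ) (hg : ContinuousOn g T)
    (hfib : ∀ s, ∃ Z : Finset ℝ, Z.card ≤ D ∧ ∀ ρ ∈ T, g ρ = s → ρ ∈ Z) (S : Finset ℝ) (L : ℕ) :
    ((Finset.range (n - r)).filter fun i =>
      ¬ gap S (g (a i)) (g (a (i + r))) ≤ L).card * (L + 1)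
      ≤ S.card * (D * (r + 1)) := by
  classical
  refine le_trans ?_ (squeeze_sum n r D a ha T hT haT g hg hfib S)
  rw [← smul_eq_mul]
  refine le_trans (Finset.card_nsmul_le_sum _ (fun i => gap S (g (a i)) (g (a (i + r)))) _ ?_)
    (Finset.sum_le_sum_of_subset (Finset.filter_subset _ _))
  intro i hi
  have := (Finset.mem_filter.1 hi).2
  omega

/-- ENR-type inequality -/
lemma enr (A B C : Finset ℝ) (hA : 4 ≤ A.card) (T : Set ℝ) (hT : T.OrdConnected)
    (hAT : ∀ x ∈ A, x ∈ T) (U V : ℝ → ℝ) (hU : ContinuousOn U T) (hV : ContinuousOn V T)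
    (hUi : Set.InjOn U T) (hVi : Set.InjOn V T)
    (hUV : ∀ x ∈ T, ∀ x' ∈ T, ∀ y ∈ T, ∀ y' ∈ T, x < x' → x' ≤ y → y < y' →
      U x' - U x = U y' - U y → V x' - V x = V y' - V y → False) :
    (A.card : ℝ) ^ 3 * B.card * C.card ≤
      1024 * ((A.image U + B).card : ℝ) ^ 2 * ((A.image V + C).card : ℝ) ^ 2 := by
  classical
  obtain ⟨a, haA, ha⟩ := exists_enum A
  set n := A.card with hn
  have haT : ∀ i < n, a i ∈ T := fun i hi => hAT _ (haA i hi)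
  set S1 := A.image U + B with hS1
  set S2 := A.image V + C with hS2
  set L1 := 8 * S1.card / n with hL1
  set L2 := 8 * S2.card / n with hL2
  have key : ∀ (W : ℝ → ℝ), ContinuousOn W T → Set.InjOn W T → ∀ (S : Finset ℝ) (b : ℝ),
      4 * ((Finset.range (n - 1)).filter fun i =>
      ¬ gap S (W (a i) + b) (W (a (i + 1)) + b) ≤ 8 * S.card / n).card
      ≤ n := by
    intro W hW hWi S b
    have := squeeze n 1 1 a ha T hT haT (fun x => W x + b) (hW.add continuousOn_const) ?_ S
      (8 * S.card / n)
    · have h2 : 8 * S.card < n * (8 * S.card / n + 1) := by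
        have := Nat.lt_mul_div_succ (8 * S.card) (show 0 < n by omega)
        simpa using this
      by_contra hlt
      rw [not_le] at hlt
      set q := ((Finset.range (n - 1)).filter fun i =>
      ¬ gap S (W (a i) + b) (W (a (i + 1)) + b) ≤ 8 * S.card / n).card
      set l := 8 * S.card / n + 1
      have h3 : q * l ≤ S.card * 2 := by simpa using this
      have h4 : n * l ≤ (4 * q) * l := Nat.mul_le_mul_right _ hlt.le
      nlinarith
    · intro s
      by_cases hs : ∃ ρ ∈ T, W ρ + b = s
      · obtain ⟨ρ, hρ, h⟩ := hs
        refine ⟨{ρ}, by simp, fun ρ' hρ' h' => ?_⟩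
        rw [Finset.mem_singleton]
        exact hWi hρ' hρ (by linarith)
      · refine ⟨∅, by simp, fun ρ' hρ' h' => ?_⟩
        exact absurd ⟨ρ', hρ', h'⟩ hs
  let G1 : ℝ → ℕ → Prop := fun b i =>
    gap S1 (U (a i) + b) (U (a (i + 1)) + b) ≤ L1
  let G2 : ℝ → ℕ → Prop := fun b i =>
    gap S2 (V (a i) + b) (V (a (i + 1)) + b) ≤ L2
  let good : Finset ((ℝ × ℝ) × ℕ) := ((B ×ˢ C) ×ˢ Finset.range (n - 1)).filter
    fun p => G1 p.1.1 p.2 ∧ G2 p.1.2 p.2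
  have hgood : B.card * C.card * n ≤ 4 * good.card := by
    have h1 : good.card = ∑ bc ∈ B ×ˢ C,
        ((Finset.range (n - 1)).filter fun i => G1 bc.1 i ∧ G2 bc.2 i).card := by
      simp only [good]
      rw [Finset.card_filter, Finset.sum_product]
      refine Finset.sum_congr rfl fun bc _ => ?_
      rw [Finset.card_filter]
    rw [h1, ← Finset.card_product, ← smul_eq_mul, Finset.mul_sum]
    refine Finset.card_nsmul_le_sum _ _ _ ?_
    rintro ⟨b, c⟩ _
    have k1 := key U hU hUi S1 b
    have k2 := key V hV hVi S2 c
    have : Finset.range (n - 1) ⊆ ((Finset.range (n - 1)).filter fun i => G1 b i ∧ G2 c i) ∪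
      (((Finset.range (n - 1)).filter fun i => ¬ G1 b i) ∪
        ((Finset.range (n - 1)).filter fun i => ¬ G2 c i)) := by
      intro i hi
      simp only [Finset.mem_union, Finset.mem_filter, hi, true_and]
      tauto
    have h3 := (Finset.card_le_card this).trans ((Finset.card_union_le _ _).trans
      (Nat.add_le_add_left (Finset.card_union_le _ _) _))
    rw [Finset.card_range] at h3
    have k1' : 4 * ((Finset.range (n - 1)).filter fun i => ¬ G1 b i).card ≤ n := k1
    have k2' : 4 * ((Finset.range (n - 1)).filter fun i => ¬ G2 c i).card ≤ n := k2
    show n ≤ 4 * ((Finset.range (n - 1)).filter fun i => G1 b i ∧ G2 c i).card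
    omega
  have hmap : good.card ≤ (closePairs S1 L1 ×ˢ closePairs S2 L2).card := by
    refine Finset.card_le_card_of_injOn
      (fun p => ((U (a p.2) + p.1.1, U (a (p.2 + 1)) + p.1.1),
        (V (a p.2) + p.1.2, V (a (p.2 + 1)) + p.1.2))) ?_ ?_
    · rintro ⟨⟨b, c⟩, i⟩ hp
      obtain ⟨h1, h2, h3⟩ := Finset.mem_filter.1 hp
      obtain ⟨h4, h5⟩ := Finset.mem_product.1 h1
      obtain ⟨h6, h7⟩ := Finset.mem_product.1 h4
      have hi := Finset.mem_range.1 h5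
      simp only at h6 h7 hi h2 h3
      have hi1 := haA i (by omega)
      have hi2 := haA (i + 1) (by omega)
      refine Finset.mem_product.2 ⟨Finset.mem_filter.2 ⟨Finset.mem_product.2 ⟨?_, ?_⟩, h2⟩,
        Finset.mem_filter.2 ⟨Finset.mem_product.2 ⟨?_, ?_⟩, h3⟩⟩
      · exact Finset.add_mem_add (Finset.mem_image_of_mem _ hi1) h6
      · exact Finset.add_mem_add (Finset.mem_image_of_mem _ hi2) h6
      · exact Finset.add_mem_add (Finset.mem_image_of_mem _ hi1) h7
      · exact Finset.add_mem_add (Finset.mem_image_of_mem _ hi2) h7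
    · rintro ⟨⟨b, c⟩, i⟩ hp ⟨⟨b', c'⟩, i'⟩ hp' heq
      obtain ⟨h1, -, -⟩ := Finset.mem_filter.1 (Finset.mem_coe.1 hp)
      obtain ⟨-, h5⟩ := Finset.mem_product.1 h1
      obtain ⟨h1', -, -⟩ := Finset.mem_filter.1 (Finset.mem_coe.1 hp')
      obtain ⟨-, h5'⟩ := Finset.mem_product.1 h1'
      have hi := Finset.mem_range.1 h5
      have hi' := Finset.mem_range.1 h5'
      simp only [Prod.mk.injEq] at heq hi hi'
      obtain ⟨⟨e1, e2⟩, e3, e4⟩ := heq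
      have hii : i = i' := by
        rcases lt_trichotomy i i' with h | h | h
        · exfalso
          refine hUV (a i) (haT _ (by omega)) (a (i+1)) (haT _ (by omega)) (a i') (haT _ (by omega))
            (a (i'+1)) (haT _ (by omega)) (ha _ _ (by omega) (by omega)) ?_
            (ha _ _ (by omega) (by omega)) (by linarith) (by linarith)
          rcases Nat.eq_or_lt_of_le (show i + 1 ≤ i' by omega) with h | h
          · rw [h]
          · exact (ha _ _ h (by omega)).le
        · exact h
        · exfalso
          refine hUV (a i') (haT _ (by omega)) (a (i'+1)) (haT _ (by omega)) (a i) (haT _ (by omega))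
            (a (i+1)) (haT _ (by omega)) (ha _ _ (by omega) (by omega)) ?_
            (ha _ _ (by omega) (by omega)) (by linarith) (by linarith)
          rcases Nat.eq_or_lt_of_le (show i' + 1 ≤ i by omega) with h | h
          · rw [h]
          · exact (ha _ _ h (by omega)).le
      subst hii
      simp only [Prod.mk.injEq, and_true]
      constructor <;> linarith
  rw [Finset.card_product] at hmap
  have c1 := card_closePairs S1 L1
  have c2 := card_closePairs S2 L2
  have hn0 : (0 : ℝ) < n := by exact_mod_cast (show 0 < n by omega)
  have l1 : (L1 : ℝ) ≤ 8 * S1.card / n := by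
    have := @Nat.cast_div_le ℝ _ _ _ (8 * S1.card) n
    push_cast at this; exact this
  have l2 : (L2 : ℝ) ≤ 8 * S2.card / n := by
    have := @Nat.cast_div_le ℝ _ _ _ (8 * S2.card) n
    push_cast at this; exact this
  have t1 : ((closePairs S1 L1).card : ℝ) ≤ 16 * S1.card ^ 2 / n := by
    calc ((closePairs S1 L1).card : ℝ) ≤ S1.card * (2 * L1) := by exact_mod_cast c1
      _ ≤ S1.card * (2 * (8 * S1.card / n)) := by gcongr
      _ = _ := by ring
  have t2 : ((closePairs S2 L2).card : ℝ) ≤ 16 * S2.card ^ 2 / n := by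
    calc ((closePairs S2 L2).card : ℝ) ≤ S2.card * (2 * L2) := by exact_mod_cast c2
      _ ≤ S2.card * (2 * (8 * S2.card / n)) := by gcongr
      _ = _ := by ring
  have t3 : (B.card * C.card * n : ℝ) ≤ 4 * ((16 * S1.card ^ 2 / n) * (16 * S2.card ^ 2 / n)) := by
    calc (B.card * C.card * n : ℝ) ≤ 4 * good.card := by exact_mod_cast hgood
      _ ≤ 4 * ((closePairs S1 L1).card * (closePairs S2 L2).card) := by
        gcongr; exact_mod_cast hmap
      _ ≤ _ := by gcongr
  have t4 : (16 * S1.card ^ 2 / n) * (16 * S2.card ^ 2 / n) = (256 * S1.card ^ 2 * S2.card ^ 2 : ℝ) / n ^ 2 := by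
    field_simp; ring
  rw [t4, ← mul_div_assoc, le_div_iff₀ (by positivity)] at t3
  nlinarith

end

section

lemma root_bound (k : ℕ) (hk : k ≠ 0) (x y n e s : ℝ) (hx : 0 < x) (hn : 0 < n) (hs : 0 ≤ s)
    (hy : y * k = e) (h : x * n ^ e ≤ s ^ k) : x ^ ((1 : ℝ) / k) * n ^ y ≤ s := by
  have hk' : (k : ℝ) ≠ 0 := by exact_mod_cast hk
  refine (pow_le_pow_iff_left₀ (by positivity) hs hk).1 ?_
  rw [mul_pow, ← Real.rpow_natCast (x ^ _), ← Real.rpow_mul hx.le, ← Real.rpow_natCast (n ^ y),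
    ← Real.rpow_mul hn.le, hy, one_div, inv_mul_cancel₀ hk', Real.rpow_one]
  exact h

lemma class_erase {ι : Type*} [DecidableEq ι] (r : ι → ι → Prop) [∀ i, DecidablePred (r i)]
    (hr : Equivalence r) (J : Finset ι) (a b : ι) (ha : a ∈ J) (hb : b ∈ J) (hab : ¬ r a b)
    (hmax : ∀ x ∈ J, (J.filter (r x)).card ≤ (J.filter (r a)).card) (m : ℕ)
    (hm : J.card ≤ 2 * m + 2)
    (hJ : ∀ x ∈ J, (J.filter (r x)).card ≤ m + 1) :
    ∀ x ∈ (J.erase a).erase b, (((J.erase a).erase b).filter (r x)).card ≤ m := by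
  intro x hx
  have hxJ : x ∈ J := Finset.mem_of_mem_erase (Finset.mem_of_mem_erase hx)
  have hmono : ((J.erase a).erase b).filter (r x) ⊆ J.filter (r x) :=
    Finset.filter_subset_filter _ ((Finset.erase_subset _ _).trans (Finset.erase_subset _ _))
  by_cases hxa : r x a
  · have : ((J.erase a).erase b).filter (r x) ⊂ J.filter (r x) := by
      refine ⟨hmono, fun h => ?_⟩
      have := h (Finset.mem_filter.2 ⟨ha, hxa⟩)
      simp at this
    have := Finset.card_lt_card this
    have := hJ x hxJ
    omega
  by_cases hxb : r x b
  · have : ((J.erase a).erase b).filter (r x) ⊂ J.filter (r x) := by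
      refine ⟨hmono, fun h => ?_⟩
      have := h (Finset.mem_filter.2 ⟨hb, hxb⟩)
      simp at this
    have := Finset.card_lt_card this
    have := hJ x hxJ
    omega
  · have hd : Disjoint (J.filter (r x)) (J.filter (r a)) := by
      rw [Finset.disjoint_left]
      intro y hy hy'
      exact hxa (hr.trans (Finset.mem_filter.1 hy).2 (hr.symm (Finset.mem_filter.1 hy').2))
    have hsub : insert b ((J.filter (r x)) ∪ (J.filter (r a))) ⊆ J := by
      intro y hy
      rcases Finset.mem_insert.1 hy with h | h
      · rwa [h]
      · rcases Finset.mem_union.1 h with h | h <;> exact (Finset.mem_filter.1 h).1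
    have h1 := Finset.card_le_card hsub
    rw [Finset.card_insert_of_notMem, Finset.card_union_of_disjoint hd] at h1
    · have := hmax x hxJ
      have := Finset.card_le_card hmono
      omega
    · simp [hxb, hab]

lemma recursion {ι : Type*} [DecidableEq ι] (C : ℝ) (hC : 0 < C) (t : ℕ) :
    ∃ c : ℝ, 0 < c ∧ ∀ (r : ι → ι → Prop) [∀ i, DecidablePred (r i)] (_ : Equivalence r)
      (n : ℝ) (_ : 1 ≤ n) (σ : Finset ι → ℝ) (_ : ∀ J, 0 < σ J) (_ : ∀ i, n ≤ σ {i})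
      (_ : ∀ i j J K, ¬ r i j → i ∈ J → j ∈ K →
        n ^ 3 * σ (J.erase i) * σ (K.erase j) ≤ C * σ J ^ 2 * σ K ^ 2)
      (J : Finset ι) (_ : J.card = t + 1) (_ : ∀ i ∈ J, (J.filter (r i)).card ≤ t / 2 + 1),
      c * n ^ ((3 : ℝ) / 2 - 1 / 2 ^ (t + 1)) ≤ σ J := by
  induction t using Nat.strong_induction_on with
  | _ t ih =>
  rcases t with _ | _ | t
  · refine ⟨1, one_pos, ?_⟩
    intro r _ hr n hn σ hpos h1 henr J hJ hcl
    obtain ⟨i, rfl⟩ := Finset.card_eq_one.1 hJ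
    have := h1 i
    norm_num
    exact this
  · refine ⟨(1 / C) ^ ((1 : ℝ) / (4 : ℕ)), by positivity, ?_⟩
    intro r _ hr n hn σ hpos h1 henr J hJ hcl
    have hn0 : 0 < n := by linarith
    obtain ⟨a, b, hab, rfl⟩ := Finset.card_eq_two.1 hJ
    have hrab : ¬ r a b := by
      intro h
      have := hcl a (by simp)
      have h2 : ({a, b} : Finset ι).filter (r a) = {a, b} := by
        rw [Finset.filter_eq_self]
        intro x hx
        rcases Finset.mem_insert.1 hx with h | h
        · rw [h]; exact hr.refl a
        · rw [Finset.mem_singleton.1 h]; assumption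
      rw [h2, hJ] at this
      omega
    have h := henr a b _ _ hrab (show a ∈ ({a, b} : Finset ι) by simp)
      (show b ∈ ({a, b} : Finset ι) by simp)
    have e1 : ({a, b} : Finset ι).erase a = {b} := by
      rw [Finset.erase_insert]; simpa using hab
    have e2 : ({a, b} : Finset ι).erase b = {a} := by
      rw [Finset.pair_comm, Finset.erase_insert]; simpa using hab.symm
    rw [e1, e2] at h
    have ha := h1 a
    have hb := h1 b
    refine root_bound 4 (by norm_num) _ _ _ 5 _ (by positivity) hn0 (hpos _).le (by norm_num) ?_
    rw [div_mul_eq_mul_div, div_le_iff₀ hC, one_mul]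
    have : n ^ (5 : ℝ) = n ^ 3 * n * n := by
      rw [show (5 : ℝ) = ((5 : ℕ) : ℝ) by norm_num, Real.rpow_natCast]; ring
    rw [this]
    have hb0 := hpos {b}
    calc n ^ 3 * n * n ≤ n ^ 3 * σ {b} * σ {a} := by gcongr
      _ ≤ _ := h
      _ = _ := by ring
  · obtain ⟨c, hc, H⟩ := ih t (by omega)
    refine ⟨(c ^ 2 / C ^ 3) ^ ((1 : ℝ) / (8 : ℕ)), by positivity, ?_⟩
    intro r _ hr n hn σ hpos h1 henr J hJ hcl
    have hn0 : 0 < n := by linarith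
    have hne : J.Nonempty := Finset.card_pos.1 (by omega)
    obtain ⟨a, haJ, hmax⟩ := J.exists_max_image (fun x => (J.filter (r x)).card) hne
    obtain ⟨b, hbJ, hab⟩ : ∃ b ∈ J, ¬ r a b := by
      by_contra hcon
      push Not at hcon
      have := hcl a haJ
      rw [Finset.filter_true_of_mem hcon] at this
      omega
    have hne : b ≠ a := by rintro rfl; exact hab (hr.refl _)
    have hclass := class_erase r hr J a b haJ hbJ hab hmax (t / 2 + 1) (by omega)
      (fun x hx => by have := hcl x hx; omega)
    have hba : ¬ r b a := fun h => hab (hr.symm h)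
    have hb' : b ∈ J.erase a := Finset.mem_erase.2 ⟨hne, hbJ⟩
    have ha' : a ∈ J.erase b := Finset.mem_erase.2 ⟨hne.symm, haJ⟩
    have hw := H r hr n hn σ hpos h1 henr ((J.erase a).erase b)
      (by rw [Finset.card_erase_of_mem hb', Finset.card_erase_of_mem haJ]; omega) hclass
    have i1 := henr a b J J hab haJ hbJ
    have i2 := henr b a _ _ hba hb' ha'
    rw [Finset.erase_right_comm (a := b) (b := a)] at i2
    set w := σ ((J.erase a).erase b)
    set p := σ (J.erase a) with hp
    set q := σ (J.erase b) with hq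
    have hp0 : 0 < p := hpos _
    have hq0 : 0 < q := hpos _
    have hs := hpos J
    set s := σ J
    set e : ℝ := (3 : ℝ) / 2 - 1 / 2 ^ (t + 1) with he
    refine root_bound 8 (by norm_num) _ _ _ (9 + 2 * e) _ (by positivity) hn0 hs.le ?_ ?_
    · rw [he]; push_cast; field_simp; ring
    · rw [div_mul_eq_mul_div, div_le_iff₀ (by positivity)]
      have e1 : n ^ (9 + 2 * e) = n ^ 9 * (n ^ e) ^ 2 := by
        rw [Real.rpow_add hn0, mul_comm 2 e, Real.rpow_mul hn0.le]
        norm_cast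
      rw [e1]
      calc c ^ 2 * (n ^ 9 * (n ^ e) ^ 2) = n ^ 9 * (c * n ^ e) ^ 2 := by ring
        _ ≤ n ^ 9 * w ^ 2 := by gcongr
        _ = n ^ 6 * (n ^ 3 * w * w) := by ring
        _ ≤ n ^ 6 * (C * p ^ 2 * q ^ 2) := by gcongr
        _ = C * (n ^ 3 * p * q) ^ 2 := by ring
        _ ≤ C * (C * s ^ 2 * s ^ 2) ^ 2 := by gcongr
        _ = _ := by ring

/-- choose a subset of size `t + 1` with balanced classes -/
lemma choose_sub {ι : Type*} [DecidableEq ι] (r : ι → ι → Prop) [∀ i, DecidablePred (r i)]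
    (hr : Equivalence r) (t k : ℕ) (ht : 1 ≤ t) :
    ∀ (J : Finset ι), J.card = t + 1 + k →
    (∀ x ∈ J, (J.filter (r x)).card + (t + 1) / 2 ≤ J.card) →
    ∃ J' ⊆ J, J'.card = t + 1 ∧ ∀ x ∈ J', (J'.filter (r x)).card ≤ t / 2 + 1 := by
  induction k with
  | zero =>
    intro J hJ hcl
    refine ⟨J, subset_rfl, hJ, fun x hx => ?_⟩
    have := hcl x hx
    omega
  | succ k ih =>
    intro J hJ hcl
    have hne : J.Nonempty := Finset.card_pos.1 (by omega)
    obtain ⟨a, haJ, hmax⟩ := J.exists_max_image (fun x => (J.filter (r x)).card) hne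
    have hc := Finset.card_erase_of_mem haJ
    suffices hh : ∀ x ∈ J.erase a, ((J.erase a).filter (r x)).card + (t + 1) / 2 ≤
        (J.erase a).card by
      obtain ⟨K, h1, h2, h3⟩ := ih (J.erase a) (by omega) hh
      exact ⟨K, h1.trans (Finset.erase_subset _ _), h2, h3⟩
    intro x hx
    have hxJ : x ∈ J := Finset.mem_of_mem_erase hx
    have hmono : (J.erase a).filter (r x) ⊆ J.filter (r x) :=
      Finset.filter_subset_filter _ (Finset.erase_subset _ _)
    by_cases hxa : r x a
    · have : (J.erase a).filter (r x) ⊂ J.filter (r x) := by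
        refine ⟨hmono, fun h => ?_⟩
        have := h (Finset.mem_filter.2 ⟨haJ, hxa⟩)
        simp at this
      have := Finset.card_lt_card this
      have := hcl x hxJ
      omega
    · have hd : Disjoint (J.filter (r x)) (J.filter (r a)) := by
        rw [Finset.disjoint_left]
        intro y hy hy'
        exact hxa (hr.trans (Finset.mem_filter.1 hy).2 (hr.symm (Finset.mem_filter.1 hy').2))
      have hsub : ((J.filter (r x)) ∪ (J.filter (r a))) ⊆ J := by
        intro y hy
        rcases Finset.mem_union.1 hy with h | h <;> exact (Finset.mem_filter.1 h).1
      have h1 := Finset.card_le_card hsub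
      rw [Finset.card_union_of_disjoint hd] at h1
      have := hmax x hxJ
      have := Finset.card_le_card hmono
      omega

end

section

lemma exists_T (R : Polynomial ℝ) (hR : R ≠ 0) (D : ℕ) (hD : R.natDegree ≤ D) (A : Finset ℝ) :
    ∃ T : Set ℝ, T.OrdConnected ∧ (∀ x ∈ T, R.eval x ≠ 0) ∧ ∃ A' ⊆ A, (∀ x ∈ A', x ∈ T) ∧
      A.card ≤ D + (D + 1) * A'.card := by
  classical
  set Z := R.roots.toFinset with hZ
  have hZc : Z.card ≤ D := (Multiset.toFinset_card_le _).trans ((card_roots' R).trans hD)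
  have hZm : ∀ x, x ∈ Z ↔ R.eval x = 0 := by
    intro x; rw [hZ, Multiset.mem_toFinset, mem_roots hR, IsRoot.def]
  set φ : ℝ → ℕ := fun x => (Z.filter (· < x)).card with hφ
  have hmono : Monotone φ := by
    intro x y hxy
    apply Finset.card_le_card
    intro z hz
    rw [Finset.mem_filter] at hz ⊢
    exact ⟨hz.1, hz.2.trans_le hxy⟩
  have hφD : ∀ x, φ x < D + 1 := fun x =>
    Nat.lt_succ_of_le ((Finset.card_filter_le _ _).trans hZc)
  set B := A \ Z with hB
  have hBc : A.card ≤ D + B.card := by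
    have : A.card - Z.card ≤ B.card := Finset.le_card_sdiff Z A
    omega
  obtain ⟨k, hk⟩ : ∃ k, B.card ≤ (D + 1) * (B.filter (fun x => φ x = k)).card := by
    by_contra hcon
    push Not at hcon
    have h1 := Finset.card_eq_sum_card_fiberwise (f := φ) (s := B) (t := Finset.range (D + 1))
      (fun x _ => Finset.mem_coe.2 (Finset.mem_range.2 (hφD x)))
    have h2 : (D + 1) * B.card < (D + 1) * B.card := by
      calc (D + 1) * B.card = ∑ k ∈ Finset.range (D + 1),
            (D + 1) * (B.filter (fun x => φ x = k)).card := by rw [← Finset.mul_sum, ← h1]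
        _ < ∑ k ∈ Finset.range (D + 1), B.card :=
          Finset.sum_lt_sum_of_nonempty (by simp) (fun k _ => hcon k)
        _ = _ := by simp
    exact lt_irrefl _ h2
  refine ⟨{x | φ x = k ∧ R.eval x ≠ 0}, ?_, fun x hx => hx.2, B.filter (fun x => φ x = k), ?_, ?_, ?_⟩
  · constructor
    rintro x ⟨hx, hx0⟩ y ⟨hy, hy0⟩ z ⟨hxz, hzy⟩
    have h1 := hmono hxz
    have h2 := hmono hzy
    have hz : φ z = k := by omega
    refine ⟨hz, fun hz0 => ?_⟩
    have hlt : z < y := lt_of_le_of_ne hzy (by rintro rfl; exact hy0 hz0)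
    have : φ z < φ y := by
      apply Finset.card_lt_card
      refine ⟨?_, fun h => ?_⟩
      · intro w hw
        rw [Finset.mem_filter] at hw ⊢
        exact ⟨hw.1, hw.2.trans hlt⟩
      · have := h (Finset.mem_filter.2 ⟨(hZm z).2 hz0, hlt⟩)
        simp at this
    omega
  · exact (Finset.filter_subset _ _).trans Finset.sdiff_subset
  · intro x hx
    rw [Finset.mem_filter, hB, Finset.mem_sdiff, hZm] at hx
    exact ⟨hx.2, hx.1.2⟩
  · omega

/-- set of partial sums -/
def psum {d : ℕ} (U : Fin d → ℝ → ℝ) (A : Finset ℝ) (J : Finset (Fin d)) : Finset ℝ :=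
  (Fintype.piFinset fun _ : Fin d => A).image (fun a => ∑ i ∈ J, U i (a i))

lemma psum_add {d : ℕ} (U : Fin d → ℝ → ℝ) (A : Finset ℝ) (J : Finset (Fin d)) (i : Fin d)
    (hi : i ∈ J) : A.image (U i) + psum U A (J.erase i) ⊆ psum U A J := by
  classical
  intro s hs
  obtain ⟨y, hy, z, hz, rfl⟩ := Finset.mem_add.1 hs
  obtain ⟨x, hx, rfl⟩ := Finset.mem_image.1 hy
  obtain ⟨a, ha, rfl⟩ := Finset.mem_image.1 hz
  refine Finset.mem_image.2 ⟨Function.update a i x, ?_, ?_⟩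
  · rw [Fintype.mem_piFinset] at ha ⊢
    intro j
    by_cases h : j = i
    · subst h; simpa using hx
    · simpa [h] using ha j
  · rw [← Finset.add_sum_erase _ _ hi]
    congr 1
    · simp
    · apply Finset.sum_congr rfl
      intro j hj
      rw [Function.update_of_ne (Finset.ne_of_mem_erase hj)]

lemma psum_mono {d : ℕ} (U : Fin d → ℝ → ℝ) (A : Finset ℝ) (J : Finset (Fin d)) (x0 : ℝ)
    (hx0 : x0 ∈ A) : (psum U A J).card ≤ (psum U A Finset.univ).card := by
  classical
  refine Finset.card_le_card_of_injOn (fun s => s + ∑ i ∈ Jᶜ, U i x0) ?_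
    (fun x _ y _ h => by simpa using h)
  intro s hs
  obtain ⟨a, ha, rfl⟩ := Finset.mem_image.1 (Finset.mem_coe.1 hs)
  refine Finset.mem_coe.2 (Finset.mem_image.2 ⟨fun i => if i ∈ J then a i else x0, ?_, ?_⟩)
  · rw [Fintype.mem_piFinset] at ha ⊢
    intro j
    by_cases h : j ∈ J
    · simpa [h] using ha j
    · simpa [h] using hx0
  · dsimp only
    rw [← Finset.sum_add_sum_compl J]
    congr 1
    · exact Finset.sum_congr rfl (fun i hi => by simp [hi])
    · exact Finset.sum_congr rfl (fun i hi => by rw [if_neg (Finset.mem_compl.1 hi)])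

lemma sep_core (d t D : ℕ) (ht : 1 ≤ t) (htd : t + 1 ≤ d) : ∃ c : ℝ, 0 < c ∧
    ∀ (r : Fin d → Fin d → Prop) (_ : Equivalence r)
      (_ : ∀ I : Finset (Fin d), (∀ i ∈ I, ∀ j ∈ I, r i j) → I.card ≠ d - (t - 1) / 2)
      (U : Fin d → ℝ → ℝ) (R : Polynomial ℝ) (_ : R ≠ 0) (_ : R.natDegree ≤ D)
      (_ : ∀ T : Set ℝ, T.OrdConnected → (∀ x ∈ T, R.eval x ≠ 0) →
        (∀ i, ContinuousOn (U i) T) ∧ (∀ i, Set.InjOn (U i) T) ∧ ∀ i j, ¬ r i j →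
        ∀ x ∈ T, ∀ x' ∈ T, ∀ y ∈ T, ∀ y' ∈ T, x < x' → x' ≤ y → y < y' →
        U i x' - U i x = U i y' - U i y → U j x' - U j x = U j y' - U j y → False)
      (A : Finset ℝ) (_ : 8 * (D + 1) ≤ A.card), ∃ A' ⊆ A, (∀ x ∈ A', R.eval x ≠ 0) ∧
      c * (A.card : ℝ) ^ ((3 : ℝ) / 2 - 1 / 2 ^ (t + 1)) ≤ (psum U A' Finset.univ).card := by
  classical
  obtain ⟨c, hc, H⟩ := recursion (ι := Fin d) 1024 (by norm_num) t
  set e : ℝ := (3 : ℝ) / 2 - 1 / 2 ^ (t + 1) with he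
  have he0 : 0 ≤ e := by
    have : (1 : ℝ) / 2 ^ (t + 1) ≤ 1 := by
      rw [div_le_one (by positivity)]; exact one_le_pow₀ (by norm_num)
    linarith
  refine ⟨c * (1 / (2 * (D + 1))) ^ e, by positivity, ?_⟩
  intro r hr hI U R hR hRD hT A hA
  obtain ⟨T, hTo, hTR, A', hA'A, hA'T, hcard⟩ := exists_T R hR D hRD A
  obtain ⟨hcont, hinj, hUV⟩ := hT T hTo hTR
  refine ⟨A', hA'A, fun x hx => hTR x (hA'T x hx), ?_⟩
  have h2 : A.card ≤ 2 * (D + 1) * A'.card := by nlinarith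
  have h4 : 4 ≤ A'.card := by
    by_contra h
    push Not at h
    have : 2 * (D + 1) * A'.card ≤ 2 * (D + 1) * 3 := Nat.mul_le_mul_left _ (by omega)
    omega
  obtain ⟨x0, hx0⟩ : A'.Nonempty := Finset.card_pos.1 (by omega)
  have hpos : ∀ J, 0 < (psum U A' J).card := by
    intro J
    refine Finset.card_pos.2 (Finset.Nonempty.image ⟨fun _ => x0, ?_⟩ _)
    simp [hx0]
  have hcl : ∀ x ∈ (Finset.univ : Finset (Fin d)), (Finset.univ.filter (r x)).card + (t + 1) / 2 ≤
      (Finset.univ : Finset (Fin d)).card := by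
    intro x _
    by_contra hcon
    push Not at hcon
    rw [Finset.card_univ, Fintype.card_fin] at hcon
    obtain ⟨I, hIs, hIc⟩ := Finset.exists_subset_card_eq
      (s := Finset.univ.filter (r x)) (n := d - (t - 1) / 2) (by omega)
    refine hI I (fun i hi j hj => ?_) hIc
    exact hr.trans (hr.symm (Finset.mem_filter.1 (hIs hi)).2) (Finset.mem_filter.1 (hIs hj)).2
  obtain ⟨J, -, hJ1, hJ2⟩ := choose_sub r hr t (d - (t + 1)) ht Finset.univ
    (by rw [Finset.card_univ, Fintype.card_fin]; omega) hcl
  have key := H r hr (A'.card : ℝ) (by norm_cast; omega) (fun J => ((psum U A' J).card : ℝ))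
    (fun J => by exact_mod_cast hpos J) ?_ ?_ J hJ1 hJ2
  · have h3 : (psum U A' J).card ≤ (psum U A' Finset.univ).card := psum_mono U A' J x0 hx0
    calc c * (1 / (2 * (D + 1))) ^ e * (A.card : ℝ) ^ e
        = c * ((1 / (2 * (D + 1))) * (A.card : ℝ)) ^ e := by
          rw [Real.mul_rpow (by positivity) (by positivity), mul_assoc]
      _ ≤ c * (A'.card : ℝ) ^ e := by
          gcongr
          rw [div_mul_eq_mul_div, div_le_iff₀ (by positivity), one_mul]
          have : (A.card : ℝ) ≤ 2 * (D + 1) * A'.card := by exact_mod_cast h2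
          linarith
      _ ≤ _ := key
      _ ≤ _ := by exact_mod_cast h3
  · intro i
    norm_cast
    have : A'.image (U i) ⊆ psum U A' {i} := by
      intro s hs
      obtain ⟨x, hx, rfl⟩ := Finset.mem_image.1 hs
      exact Finset.mem_image.2 ⟨fun _ => x, by simp [hx], by simp⟩
    calc A'.card = (A'.image (U i)).card :=
          (Finset.card_image_of_injOn ((hinj i).mono fun x hx => hA'T x hx)).symm
      _ ≤ _ := Finset.card_le_card this
  · intro i j J K hij hi hj
    have := enr A' (psum U A' (J.erase i)) (psum U A' (K.erase j)) h4 T hTo hA'T (U i) (U j)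
      (hcont i) (hcont j) (hinj i) (hinj j) (hUV i j hij)
    refine this.trans ?_
    have h5 := Finset.card_le_card (psum_add U A' J i hi)
    have h6 := Finset.card_le_card (psum_add U A' K j hj)
    gcongr

end

section

lemma small_n (e : ℝ) (he : 0 < e) (N0 : ℕ) (c : ℝ) (hc : 0 < c) : ∃ c' : ℝ, 0 < c' ∧
    ∀ n s : ℕ, (0 < n → 0 < s) → (N0 ≤ n → c * (n : ℝ) ^ e ≤ s) → c' * (n : ℝ) ^ e ≤ s := by
  refine ⟨min c (1 / ((N0 : ℝ) + 1) ^ e), by positivity, ?_⟩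
  intro n s h1 h2
  rcases Nat.eq_zero_or_pos n with hn | hn
  · subst hn
    simp [Real.zero_rpow he.ne']
  by_cases h : N0 ≤ n
  · refine le_trans ?_ (h2 h)
    gcongr
    exact min_le_left _ _
  · have hs : (1 : ℝ) ≤ s := by exact_mod_cast h1 hn
    refine le_trans ?_ hs
    calc min c (1 / ((N0 : ℝ) + 1) ^ e) * (n : ℝ) ^ e
        ≤ (1 / ((N0 : ℝ) + 1) ^ e) * ((N0 : ℝ) + 1) ^ e := by
          gcongr
          · exact min_le_right _ _
          · have : (n : ℝ) ≤ N0 := by exact_mod_cast (by omega : n ≤ N0)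
            linarith
      _ = 1 := by rw [one_div, inv_mul_cancel₀ (by positivity)]

lemma exp_pos (t : ℕ) : 0 < (3 : ℝ) / 2 - 1 / 2 ^ (t + 1) := by
  have : (1 : ℝ) / 2 ^ (t + 1) ≤ 1 := by
    rw [div_le_one (by positivity)]; exact one_le_pow₀ (by norm_num)
  linarith

lemma sep_final (d t D δ : ℕ) (ht : 1 ≤ t) (htd : t + 1 ≤ d) : ∃ c : ℝ, 0 < c ∧
    ∀ (r : Fin d → Fin d → Prop) (_ : Equivalence r)
      (_ : ∀ I : Finset (Fin d), (∀ i ∈ I, ∀ j ∈ I, r i j) → I.card ≠ d - (t - 1) / 2)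
      (U : Fin d → ℝ → ℝ) (R : Polynomial ℝ) (_ : R ≠ 0) (_ : R.natDegree ≤ D)
      (_ : ∀ T : Set ℝ, T.OrdConnected → (∀ x ∈ T, R.eval x ≠ 0) →
        (∀ i, ContinuousOn (U i) T) ∧ (∀ i, Set.InjOn (U i) T) ∧ ∀ i j, ¬ r i j →
        ∀ x ∈ T, ∀ x' ∈ T, ∀ y ∈ T, ∀ y' ∈ T, x < x' → x' ≤ y → y < y' →
        U i x' - U i x = U i y' - U i y → U j x' - U j x = U j y' - U j y → False)
      (w : (Fin d → ℝ) → ℝ) (ℓ : ℝ → ℝ)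
      (_ : ∀ a : Fin d → ℝ, (∀ i, R.eval (a i) ≠ 0) → ∑ i, U i (a i) = ℓ (w a))
      (f : Polynomial ℝ) (_ : 0 < f.natDegree) (_ : f.natDegree ≤ δ)
      (P : MvPolynomial (Fin d) ℝ) (_ : ∀ a, MvPolynomial.eval a P = f.eval (w a))
      (A : Finset ℝ), c * (A.card : ℝ) ^ ((3 : ℝ) / 2 - 1 / 2 ^ (t + 1)) ≤
        (((Fintype.piFinset fun _ : Fin d => A).image
                (fun a => MvPolynomial.eval a P)).card : ℝ) := by
  classical
  obtain ⟨c, hc, H⟩ := sep_core d t D ht htd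
  obtain ⟨c', hc', H'⟩ := small_n ((3 : ℝ) / 2 - 1 / 2 ^ (t + 1)) (exp_pos t) (8 * (D + 1))
    (c / (δ + 1)) (by positivity)
  refine ⟨c', hc', ?_⟩
  intro r hr hI U R hR hRD hT w ℓ hw f hf0 hfδ P hP A
  apply H'
  · intro hA
    obtain ⟨x, hx⟩ := Finset.card_pos.1 hA
    exact Finset.card_pos.2 (Finset.Nonempty.image ⟨fun _ => x, by simp [hx]⟩ _)
  · intro hA
    obtain ⟨A', hA'A, hA'R, hb⟩ := H r hr hI U R hR hRD hT A hA
    set V := (Fintype.piFinset fun _ : Fin d => A').image w with hV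
    have h1 : psum U A' Finset.univ ⊆ V.image ℓ := by
      intro s hs
      obtain ⟨a, ha, rfl⟩ := Finset.mem_image.1 hs
      have ha' := Fintype.mem_piFinset.1 ha
      rw [hw a (fun i => hA'R _ (ha' i))]
      exact Finset.mem_image_of_mem _ (Finset.mem_image_of_mem _ ha)
    have h2 : V.card ≤ δ * (V.image fun x => f.eval x).card := by
      refine Finset.card_le_mul_card_image _ _ (fun b _ => ?_)
      have hne : f - C b ≠ 0 := by
        intro h
        have : f.natDegree = 0 := by rw [sub_eq_zero.1 h, natDegree_C]
        omega
      calc (V.filter (fun x => f.eval x = b)).card ≤ (f - C b).roots.toFinset.card := by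
            apply Finset.card_le_card
            intro x hx
            rw [Finset.mem_filter] at hx
            rw [Multiset.mem_toFinset, mem_roots hne]
            simp [hx.2]
        _ ≤ (f - C b).natDegree := (Multiset.toFinset_card_le _).trans (card_roots' _)
        _ ≤ δ := by rw [natDegree_sub_C]; exact hfδ
    have h3 : (V.image fun x => f.eval x) ⊆ (Fintype.piFinset fun _ : Fin d => A).image
                (fun a => MvPolynomial.eval a P) := by
      intro s hs
      obtain ⟨x, hx, rfl⟩ := Finset.mem_image.1 hs
      obtain ⟨a, ha, rfl⟩ := Finset.mem_image.1 hx
      refine Finset.mem_image.2 ⟨a, ?_, hP a⟩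
      rw [Fintype.mem_piFinset] at ha ⊢
      exact fun i => hA'A (ha i)
    have h4 := Finset.card_le_card h1
    have h5 := Finset.card_le_card h3
    have h6 : (V.image ℓ).card ≤ V.card := Finset.card_image_le
    have h7 : (psum U A' Finset.univ).card ≤ (δ + 1) *
       ((Fintype.piFinset fun _ : Fin d => A).image (fun a => MvPolynomial.eval a P)).card := by
      nlinarith
    have h8 : ((psum U A' Finset.univ).card : ℝ) ≤ (δ + 1) *
       ((Fintype.piFinset fun _ : Fin d => A).image (fun a => MvPolynomial.eval a P)).card := by
      exact_mod_cast h7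
    rw [div_mul_eq_mul_div, div_le_iff₀ (by positivity)]
    linarith

lemma inj_of_deriv (T : Set ℝ) (hT : T.OrdConnected) (U U' : ℝ → ℝ)
    (hU : ∀ x ∈ T, HasDerivAt U (U' x) x) (h0 : ∀ x ∈ T, U' x ≠ 0) : Set.InjOn U T := by
  have key : ∀ x ∈ T, ∀ y ∈ T, x < y → U x ≠ U y := by
    intro x hx y hy hxy h
    have hsub : Set.Icc x y ⊆ T := hT.out hx hy
    obtain ⟨c, hc, hc0⟩ := exists_hasDerivAt_eq_zero (f := U) (f' := U') hxy
      (fun z hz => (hU z (hsub hz)).continuousAt.continuousWithinAt) h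
      (fun z hz => hU z (hsub (Set.Ioo_subset_Icc_self hz)))
    exact h0 c (hsub (Set.Ioo_subset_Icc_self hc)) hc0
  intro x hx y hy h
  rcases lt_trichotomy x y with h1 | h1 | h1
  · exact absurd h (key x hx y hy h1)
  · exact h1
  · exact absurd h.symm (key y hy x hx h1)

lemma UV_of_wronskian (T : Set ℝ) (hT : T.OrdConnected) (U V : ℝ → ℝ) (a b a' b' : Polynomial ℝ)
    (hU : ∀ x ∈ T, HasDerivAt U (a.eval x / b.eval x) x)
    (hV : ∀ x ∈ T, HasDerivAt V (a'.eval x / b'.eval x) x)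
    (hb : ∀ x ∈ T, b.eval x ≠ 0) (ha' : ∀ x ∈ T, a'.eval x ≠ 0)
    (hb' : ∀ x ∈ T, b'.eval x ≠ 0)
    (hW : ∀ x ∈ T, (wronskian (a * b') (b * a')).eval x ≠ 0) :
    ∀ x ∈ T, ∀ x' ∈ T, ∀ y ∈ T, ∀ y' ∈ T, x < x' → x' ≤ y → y < y' →
        U x' - U x = U y' - U y → V x' - V x = V y' - V y → False := by
  intro x hx x' hx' y hy y' hy' h1 h2 h3 hUe hVe
  have hVi : Set.InjOn V T := inj_of_deriv T hT V _ hV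
    (fun x hx => div_ne_zero (ha' x hx) (hb' x hx))
  set p := a * b' with hp
  set q := b * a' with hq
  have hq0 : ∀ x ∈ T, q.eval x ≠ 0 := fun x hx => by
    rw [hq, eval_mul]; exact mul_ne_zero (hb x hx) (ha' x hx)
  have hρ : Set.InjOn (fun x => p.eval x / q.eval x) T := by
    refine inj_of_deriv T hT _
      (fun x => (p.derivative.eval x * q.eval x - p.eval x * q.derivative.eval x) / q.eval x ^ 2)
      (fun x hx => (p.hasDerivAt x).div (q.hasDerivAt x) (hq0 x hx)) (fun x hx => ?_)
    refine div_ne_zero ?_ (pow_ne_zero _ (hq0 x hx))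
    have := hW x hx
    rw [wronskian] at this
    simp only [eval_sub, eval_mul] at this
    intro h
    apply this
    linarith
  have aux : ∀ x ∈ T, ∀ x' ∈ T, x < x' → ∃ c ∈ Set.Ioo x x', c ∈ T ∧
      p.eval c / q.eval c = (U x' - U x) / (V x' - V x) := by
    intro x hx x' hx' h1
    have hsub : Set.Icc x x' ⊆ T := hT.out hx hx'
    obtain ⟨c, hc, hce⟩ := exists_ratio_hasDerivAt_eq_ratio_slope U (fun x => a.eval x / b.eval x) h1
      (fun z hz => (hU z (hsub hz)).continuousAt.continuousWithinAt)
      (fun z hz => (hU z (hsub (Set.Ioo_subset_Icc_self hz))))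
      V (fun x => a'.eval x / b'.eval x)
      (fun z hz => (hV z (hsub hz)).continuousAt.continuousWithinAt)
      (fun z hz => (hV z (hsub (Set.Ioo_subset_Icc_self hz))))
    have hcT : c ∈ T := hsub (Set.Ioo_subset_Icc_self hc)
    refine ⟨c, hc, hcT, ?_⟩
    have hne : V x' - V x ≠ 0 := fun h => h1.ne' (hVi hx' hx (sub_eq_zero.1 h))
    have e1 := hb c hcT
    have e2 := ha' c hcT
    have e3 := hb' c hcT
    rw [hp, hq, eval_mul, eval_mul]
    field_simp at hce ⊢
    linarith
  obtain ⟨c1, hc1, hc1T, e1⟩ := aux x hx x' hx' h1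
  obtain ⟨c2, hc2, hc2T, e2⟩ := aux y hy y' hy' h3
  have : c1 = c2 := hρ hc1T hc2T (by dsimp only; rw [e1, e2, hUe, hVe])
  have := hc1.2
  have := hc2.1
  linarith

lemma wronskian_dep (p q : Polynomial ℝ) (hp : p ≠ 0) (hq : q ≠ 0) (h : wronskian p q = 0) :
    ∃ l : ℝ, l ≠ 0 ∧ p = C l * q := by
  classical
  obtain ⟨p0, q0, hcop, hp0, hq0⟩ : ∃ p0 q0, IsCoprime p0 q0 ∧ p = EuclideanDomain.gcd p q * p0 ∧
      q = EuclideanDomain.gcd p q * q0 := by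
    obtain ⟨p0, h1⟩ := EuclideanDomain.gcd_dvd_left p q
    obtain ⟨q0, h2⟩ := EuclideanDomain.gcd_dvd_right p q
    refine ⟨p0, q0, ?_, h1, h2⟩
    have hg : EuclideanDomain.gcd p q ≠ 0 := fun h0 => hp (by rw [h1, h0, zero_mul])
    have hb := EuclideanDomain.gcd_eq_gcd_ab p q
    refine ⟨EuclideanDomain.gcdA p q, EuclideanDomain.gcdB p q, mul_left_cancel₀ hg ?_⟩
    generalize EuclideanDomain.gcd p q = g at *
    generalize EuclideanDomain.gcdA p q = A at *
    generalize EuclideanDomain.gcdB p q = B at *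
    rw [mul_one]
    conv_rhs => rw [hb, h1, h2]
    ring
  generalize EuclideanDomain.gcd p q = g at *
  subst hp0 hq0
  have hg : g ≠ 0 := left_ne_zero_of_mul hp
  have hw : wronskian p0 q0 = 0 := by
    have : wronskian (g * p0) (g * q0) = g ^ 2 * wronskian p0 q0 := by
      simp only [wronskian, derivative_mul]; ring
    rw [this] at h
    exact (mul_eq_zero.1 h).resolve_left (pow_ne_zero _ hg)
  obtain ⟨d1, d2⟩ := hcop.wronskian_eq_zero_iff.1 hw
  have e1 := eq_C_of_derivative_eq_zero d1
  have e2 := eq_C_of_derivative_eq_zero d2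
  generalize p0.coeff 0 = α at *
  generalize q0.coeff 0 = β at *
  subst e1 e2
  have hα : α ≠ 0 := by rintro rfl; simp at hp
  have hβ : β ≠ 0 := by rintro rfl; simp at hq
  refine ⟨α / β, div_ne_zero hα hβ, ?_⟩
  rw [mul_left_comm, ← C_mul, div_mul_cancel₀ _ hβ]

end

section

lemma sep_poly (d t δ : ℕ) (ht : 1 ≤ t) (htd : t + 1 ≤ d) : ∃ c : ℝ, 0 < c ∧
    ∀ (r : Fin d → Fin d → Prop) (_ : Equivalence r)
      (_ : ∀ I : Finset (Fin d), (∀ i ∈ I, ∀ j ∈ I, r i j) → I.card ≠ d - (t - 1) / 2)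
      (U : Fin d → ℝ → ℝ) (a b : Fin d → Polynomial ℝ) (_ : ∀ i, a i ≠ 0) (_ : ∀ i, b i ≠ 0)
      (_ : ∀ i, (a i).natDegree ≤ δ) (_ : ∀ i, (b i).natDegree ≤ δ)
      (_ : ∀ i x, (b i).eval x ≠ 0 → HasDerivAt (U i) ((a i).eval x / (b i).eval x) x)
      (_ : ∀ i j, ¬ r i j → wronskian (a i * b j) (b i * a j) ≠ 0)
      (w : (Fin d → ℝ) → ℝ) (ℓ : ℝ → ℝ)
      (_ : ∀ z : Fin d → ℝ, (∀ i, (b i).eval (z i) ≠ 0) → ∑ i, U i (z i) = ℓ (w z))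
      (f : Polynomial ℝ) (_ : 0 < f.natDegree) (_ : f.natDegree ≤ δ)
      (P : MvPolynomial (Fin d) ℝ) (_ : ∀ a, MvPolynomial.eval a P = f.eval (w a))
      (A : Finset ℝ), c * (A.card : ℝ) ^ ((3 : ℝ) / 2 - 1 / 2 ^ (t + 1)) ≤
        (((Fintype.piFinset fun _ : Fin d => A).image
                (fun a => MvPolynomial.eval a P)).card : ℝ) := by
  classical
  obtain ⟨c, hc, H⟩ := sep_final d t (d * δ + d * δ + d * (d * (4 * δ))) δ ht htd
  refine ⟨c, hc, ?_⟩
  intro r hr hI U a b ha hb had hbd hU hW w ℓ hw f hf0 hfδ P hP A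
  set W : Fin d → Fin d → Polynomial ℝ := fun i j =>
    if r i j then 1 else wronskian (a i * b j) (b i * a j) with hWdef
  have hW0 : ∀ i j, W i j ≠ 0 := by
    intro i j
    by_cases h : r i j
    · simp [hWdef, h]
    · simpa [hWdef, h] using hW i j h
  have hWd : ∀ i j, (W i j).natDegree ≤ 4 * δ := by
    intro i j
    by_cases h : r i j
    · simp [hWdef, h]
    · simp only [hWdef, h, if_false]
      have h1 := natDegree_wronskian_lt_add (hW i j h)
      have h2 := natDegree_mul_le (p := a i) (q := b j)
      have h3 := natDegree_mul_le (p := b i) (q := a j)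
      have := had i
      have := had j
      have := hbd i
      have := hbd j
      omega
  set R := (∏ i, a i) * (∏ i, b i) * ∏ i, ∏ j, W i j with hR
  have hRe : ∀ x, R.eval x ≠ 0 → (∀ i, (a i).eval x ≠ 0) ∧ (∀ i, (b i).eval x ≠ 0) ∧
      ∀ i j, (W i j).eval x ≠ 0 := by
    intro x hx
    simp only [hR, eval_mul, eval_prod, mul_ne_zero_iff, Finset.prod_ne_zero_iff] at hx
    exact ⟨fun i => hx.1.1 i (Finset.mem_univ _), fun i => hx.1.2 i (Finset.mem_univ _),
      fun i j => hx.2 i (Finset.mem_univ _) j (Finset.mem_univ _)⟩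
  refine H r hr hI U R ?_ ?_ ?_ w ℓ ?_ f hf0 hfδ P hP A
  · simp only [hR, mul_ne_zero_iff, Finset.prod_ne_zero_iff]
    exact ⟨⟨fun i _ => ha i, fun i _ => hb i⟩, fun i _ j _ => hW0 i j⟩
  · have bd : ∀ (g : Fin d → Polynomial ℝ) (k : ℕ), (∀ i, (g i).natDegree ≤ k) →
        (∏ i, g i).natDegree ≤ d * k := by
      intro g k hg
      refine (natDegree_prod_le _ _).trans ((Finset.sum_le_sum fun i _ => hg i).trans ?_)
      simp
    refine natDegree_mul_le.trans (add_le_add (natDegree_mul_le.trans ?_) ?_)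
    · exact add_le_add (bd _ _ had) (bd _ _ hbd)
    · exact bd _ _ (fun i => bd _ _ (hWd i))
  · intro T hT hTR
    refine ⟨fun i x hx => (hU i x ((hRe x (hTR x hx)).2.1 i)).continuousAt.continuousWithinAt,
      fun i => inj_of_deriv T hT _ _ (fun x hx => hU i x ((hRe x (hTR x hx)).2.1 i))
        (fun x hx => div_ne_zero ((hRe x (hTR x hx)).1 i) ((hRe x (hTR x hx)).2.1 i)), ?_⟩
    intro i j hij
    refine UV_of_wronskian T hT (U i) (U j) (a i) (b i) (a j) (b j)
      (fun x hx => hU i x ((hRe x (hTR x hx)).2.1 i))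
      (fun x hx => hU j x ((hRe x (hTR x hx)).2.1 j))
      (fun x hx => (hRe x (hTR x hx)).2.1 i) (fun x hx => (hRe x (hTR x hx)).1 j)
      (fun x hx => (hRe x (hTR x hx)).2.1 j) (fun x hx => ?_)
    have := (hRe x (hTR x hx)).2.2 i j
    simpa [hWdef, hij] using this
  · intro z hz
    exact hw z (fun i => (hRe _ (hz i)).2.1 i)

/-- the restriction of `P` to a line in direction `i` -/
def slice {d : ℕ} (P : MvPolynomial (Fin d) ℝ) (i : Fin d) (z : Fin d → ℝ) : Polynomial ℝ :=
  MvPolynomial.aeval (fun j => if j = i then (X : Polynomial ℝ) else C (z j)) P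

lemma slice_eval {d : ℕ} (P : MvPolynomial (Fin d) ℝ) (i : Fin d) (z : Fin d → ℝ) (x : ℝ) :
    (slice P i z).eval x = MvPolynomial.eval (Function.update z i x) P := by
  rw [slice, ← coe_evalRingHom, MvPolynomial.aeval_def, MvPolynomial.hom_eval₂, MvPolynomial.eval,
    MvPolynomial.coe_eval₂Hom]
  congr 1
  · ext y; simp
  · ext j
    by_cases h : j = i
    · subst h; simp
    · simp [h]

lemma slice_natDegree {d : ℕ} (P : MvPolynomial (Fin d) ℝ) (i : Fin d) (z : Fin d → ℝ) :
    (slice P i z).natDegree ≤ P.totalDegree := by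
  have := MvPolynomial.aeval_natDegree_le (F := P) (m := P.totalDegree) le_rfl
    (fun j => if j = i then (X : Polynomial ℝ) else C (z j)) (n := 1) ?_
  · rw [mul_one] at this
    exact this
  · intro j
    by_cases h : j = i
    · simp [h]
    · simp [h]

lemma EquivA_refl (p : Polynomial ℝ) : EquivA p p := ⟨1, one_ne_zero, fun x => by simp⟩
lemma EquivA_symm {p q : Polynomial ℝ} (h : EquivA p q) : EquivA q p := by
  obtain ⟨l, hl, h⟩ := h
  exact ⟨l⁻¹, inv_ne_zero hl, fun x => by rw [h]; field_simp⟩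
lemma EquivA_trans {p q s : Polynomial ℝ} (h : EquivA p q) (h' : EquivA q s) : EquivA p s := by
  obtain ⟨l, hl, h⟩ := h
  obtain ⟨l', hl', h'⟩ := h'
  exact ⟨l * l', mul_ne_zero hl hl', fun x => by rw [h, h', mul_assoc]⟩

lemma EquivM_refl (p : Polynomial ℝ) : EquivM p p := ⟨1, one_pos, fun x => by simp⟩
lemma EquivM_symm {p q : Polynomial ℝ} (h : EquivM p q) : EquivM q p := by
  obtain ⟨l, hl, h⟩ := h
  refine ⟨l⁻¹, inv_pos.2 hl, fun x => ?_⟩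
  have hl' : (l : ℝ) ≠ 0 := by exact_mod_cast hl.ne'
  rw [h, ← Real.rpow_mul (abs_nonneg _)]
  push_cast
  rw [mul_inv_cancel₀ hl', Real.rpow_one]
lemma EquivM_trans {p q s : Polynomial ℝ} (h : EquivM p q) (h' : EquivM q s) : EquivM p s := by
  obtain ⟨l, hl, h⟩ := h
  obtain ⟨l', hl', h'⟩ := h'
  refine ⟨l' * l, mul_pos hl' hl, fun x => ?_⟩
  rw [h, h', ← Real.rpow_mul (abs_nonneg _)]
  push_cast
  rfl

lemma sep_add (d t δ : ℕ) (ht : 1 ≤ t) (htd : t + 1 ≤ d) : ∃ c : ℝ, 0 < c ∧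
    ∀ (P : MvPolynomial (Fin d) ℝ) (_ : P.totalDegree = δ)
      (_ : ¬ (∃ (f : Polynomial ℝ) (u : Fin d → Polynomial ℝ),
              0 < f.natDegree ∧ (∀ i, 0 < (u i).natDegree) ∧
              (∀ a : Fin d → ℝ,
                MvPolynomial.eval a P = f.eval (∑ i, (u i).eval (a i))) ∧
              ∃ I : Finset (Fin d), I.card = d - (t - 1) / 2 ∧
                ∀ i ∈ I, ∀ j ∈ I, EquivA (u i) (u j)))
      (f : Polynomial ℝ) (u : Fin d → Polynomial ℝ)
      (_ : 0 < f.natDegree) (_ : ∀ i, 0 < (u i).natDegree)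
      (_ : ∀ a : Fin d → ℝ, MvPolynomial.eval a P = f.eval (∑ i, (u i).eval (a i)))
      (A : Finset ℝ), c * (A.card : ℝ) ^ ((3 : ℝ) / 2 - 1 / 2 ^ (t + 1)) ≤
        (((Fintype.piFinset fun _ : Fin d => A).image
                (fun a => MvPolynomial.eval a P)).card : ℝ) := by
  classical
  obtain ⟨c, hc, H⟩ := sep_poly d t δ ht htd
  refine ⟨c, hc, ?_⟩
  intro P hPδ hno f0 u0 hf0 hu0 hP0 A
  -- normalise
  obtain ⟨f, u, hf, hu, hP, hnorm⟩ : ∃ (f : Polynomial ℝ) (u : Fin d → Polynomial ℝ),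
      0 < f.natDegree ∧ (∀ i, 0 < (u i).natDegree) ∧
      (∀ a : Fin d → ℝ, MvPolynomial.eval a P = f.eval (∑ i, (u i).eval (a i))) ∧
      ∀ i, (u i).eval 0 = 0 := by
    refine ⟨f0.comp (X + C (∑ i, (u0 i).eval 0)), fun i => u0 i - C ((u0 i).eval 0), ?_, ?_, ?_, ?_⟩
    · rw [natDegree_comp, natDegree_X_add_C, mul_one]; exact hf0
    · intro i; rw [natDegree_sub_C]; exact hu0 i
    · intro a
      rw [hP0]
      simp only [eval_comp, eval_add, eval_X, eval_C, eval_sub, Finset.sum_sub_distrib,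
        sub_add_cancel]
    · intro i; simp
  have hdeg : ∀ i, f.natDegree * (u i).natDegree ≤ δ := by
    intro i
    have h1 : slice P i 0 = f.comp (u i) := by
      apply Polynomial.funext
      intro x
      rw [slice_eval, hP, eval_comp, Finset.sum_eq_single i]
      · simp
      · intro j _ hj
        simp [hj, hnorm]
      · simp
    rw [← natDegree_comp, ← h1, ← hPδ]
    exact slice_natDegree _ _ _
  have hfδ : f.natDegree ≤ δ :=
    (Nat.le_mul_of_pos_right _ (hu ⟨0, by omega⟩)).trans (hdeg ⟨0, by omega⟩)
  have huδ : ∀ i, (u i).natDegree ≤ δ := fun i => (Nat.le_mul_of_pos_left _ hf).trans (hdeg i)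
  have hd0 : ∀ i, derivative (u i) ≠ 0 := by
    intro i h
    have := derivative_eq_zero.1 h
    have := hu i
    omega
  refine H (fun i j => EquivA (u i) (u j))
    ⟨fun i => EquivA_refl _, fun h => EquivA_symm h, fun h h' => EquivA_trans h h'⟩ ?_
    (fun i x => (u i).eval x) (fun i => derivative (u i)) (fun _ => 1) hd0 (fun _ => one_ne_zero)
    (fun i => (natDegree_derivative_le _).trans ((Nat.sub_le _ _).trans (huδ i))) (by simp)
    (fun i x _ => by simpa using (u i).hasDerivAt x) ?_ (fun z => ∑ i, (u i).eval (z i)) id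
    (fun z _ => rfl) f hf hfδ P hP A
  · intro I hI hIc
    exact hno ⟨f, u, hf, hu, hP, I, hIc, hI⟩
  · intro i j hij hw
    apply hij
    rw [mul_one, one_mul] at hw
    obtain ⟨l, hl, h⟩ := wronskian_dep _ _ (hd0 i) (hd0 j) hw
    refine ⟨l, hl, fun x => ?_⟩
    have h2 : derivative (u i - C l * u j) = 0 := by
      rw [derivative_sub, derivative_C_mul, h, sub_self]
    have h3 := eq_C_of_derivative_eq_zero h2
    have h4 : (u i - C l * u j).eval 0 = 0 := by simp [hnorm]
    have h5 : (u i - C l * u j).eval x = 0 := by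
      rw [h3] at h4 ⊢
      simpa using h4
    simp at h5
    linarith

lemma sep_mul (d t δ : ℕ) (ht : 1 ≤ t) (htd : t + 1 ≤ d) : ∃ c : ℝ, 0 < c ∧
    ∀ (P : MvPolynomial (Fin d) ℝ) (_ : P.totalDegree = δ)
      (_ : ¬ (∃ (f : Polynomial ℝ) (u : Fin d → Polynomial ℝ),
              0 < f.natDegree ∧ (∀ i, 0 < (u i).natDegree) ∧
              (∀ a : Fin d → ℝ,
                MvPolynomial.eval a P = f.eval (∏ i, (u i).eval (a i))) ∧
              ∃ I : Finset (Fin d), I.card = d - (t - 1) / 2 ∧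
                ∀ i ∈ I, ∀ j ∈ I, EquivM (u i) (u j)))
      (f : Polynomial ℝ) (u : Fin d → Polynomial ℝ)
      (_ : 0 < f.natDegree) (_ : ∀ i, 0 < (u i).natDegree)
      (_ : ∀ a : Fin d → ℝ, MvPolynomial.eval a P = f.eval (∏ i, (u i).eval (a i)))
      (A : Finset ℝ), c * (A.card : ℝ) ^ ((3 : ℝ) / 2 - 1 / 2 ^ (t + 1)) ≤
        (((Fintype.piFinset fun _ : Fin d => A).image
                (fun a => MvPolynomial.eval a P)).card : ℝ) := by
  classical
  obtain ⟨c, hc, H⟩ := sep_poly d t δ ht htd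
  refine ⟨c, hc, ?_⟩
  intro P hPδ hno f0 u0 hf0 hu0 hP0 A
  -- normalise
  obtain ⟨f, u, hf, hu, hP, hmon⟩ : ∃ (f : Polynomial ℝ) (u : Fin d → Polynomial ℝ),
      0 < f.natDegree ∧ (∀ i, 0 < (u i).natDegree) ∧
      (∀ a : Fin d → ℝ, MvPolynomial.eval a P = f.eval (∏ i, (u i).eval (a i))) ∧
      ∀ i, (u i).Monic := by
    have hu00 : ∀ i, u0 i ≠ 0 := fun i h => by have := hu0 i; simp [h] at this
    have hl : ∀ i, (u0 i).leadingCoeff ≠ 0 := fun i => leadingCoeff_ne_zero.2 (hu00 i)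
    refine ⟨f0.comp (C (∏ i, (u0 i).leadingCoeff) * X),
      fun i => u0 i * C (u0 i).leadingCoeff⁻¹, ?_, ?_, ?_, ?_⟩
    · rw [natDegree_comp, natDegree_C_mul_X _ (Finset.prod_ne_zero_iff.2 fun i _ => hl i), mul_one]
      exact hf0
    · intro i
      rw [natDegree_mul_C (inv_ne_zero (hl i))]; exact hu0 i
    · intro a
      rw [hP0]
      simp only [eval_comp, eval_mul, eval_C, eval_X]
      rw [← Finset.prod_mul_distrib]
      congr 1
      refine Finset.prod_congr rfl (fun i _ => ?_)
      have := hl i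
      field_simp
    · intro i; exact monic_mul_leadingCoeff_inv (hu00 i)
  have hun : ∀ i, u i ≠ 0 := fun i => (hmon i).ne_zero
  obtain ⟨z0, hz0⟩ : ∃ z0 : Fin d → ℝ, ∀ i, (u i).eval (z0 i) ≠ 0 := by
    have : ∀ i, ∃ x, (u i).eval x ≠ 0 := by
      intro i
      by_contra hcon
      push Not at hcon
      exact hun i (Polynomial.funext fun x => by simpa using hcon x)
    choose z0 hz0 using this
    exact ⟨z0, hz0⟩
  have hdeg : ∀ i, f.natDegree * (u i).natDegree ≤ δ := by
    intro i
    set s := ∏ j ∈ Finset.univ.erase i, (u j).eval (z0 j) with hs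
    have hs0 : s ≠ 0 := Finset.prod_ne_zero_iff.2 fun j _ => hz0 j
    have h1 : slice P i z0 = f.comp (u i * C s) := by
      apply Polynomial.funext
      intro x
      rw [slice_eval, hP, eval_comp, ← Finset.mul_prod_erase _ _ (Finset.mem_univ i)]
      simp only [Function.update_self, eval_mul, eval_C, hs]
      congr 2
      refine Finset.prod_congr rfl (fun j hj => ?_)
      rw [Function.update_of_ne (Finset.ne_of_mem_erase hj)]
    rw [← natDegree_mul_C (p := u i) hs0, ← natDegree_comp, ← h1, ← hPδ]
    exact slice_natDegree _ _ _
  have hfδ : f.natDegree ≤ δ :=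
    (Nat.le_mul_of_pos_right _ (hu ⟨0, by omega⟩)).trans (hdeg ⟨0, by omega⟩)
  have huδ : ∀ i, (u i).natDegree ≤ δ := fun i => (Nat.le_mul_of_pos_left _ hf).trans (hdeg i)
  have hd0 : ∀ i, derivative (u i) ≠ 0 := by
    intro i h
    have := derivative_eq_zero.1 h
    have := hu i
    omega
  have hdl : ∀ i, (derivative (u i)).leadingCoeff = (u i).natDegree := by
    intro i
    rw [leadingCoeff_derivative, (hmon i).leadingCoeff]
    simp
  refine H (fun i j => EquivM (u i) (u j))
    ⟨fun i => EquivM_refl _, fun h => EquivM_symm h, fun h h' => EquivM_trans h h'⟩ ?_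
    (fun i x => Real.log ((u i).eval x)) (fun i => derivative (u i)) u hd0 hun
    (fun i => (natDegree_derivative_le _).trans ((Nat.sub_le _ _).trans (huδ i))) huδ
    (fun i x hx => ((u i).hasDerivAt x).log hx) ?_ (fun z => ∏ i, (u i).eval (z i)) Real.log
    (fun z hz => (Real.log_prod (fun i _ => hz i)).symm) f hf hfδ P hP A
  · intro I hI hIc
    exact hno ⟨f, u, hf, hu, hP, I, hIc, hI⟩
  · intro i j hij hw
    apply hij
    obtain ⟨l, hl, h⟩ := wronskian_dep _ _ (mul_ne_zero (hd0 i) (hun j))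
      (mul_ne_zero (hun i) (hd0 j)) hw
    have hlc := congrArg leadingCoeff h
    simp only [leadingCoeff_mul, hdl, (hmon i).leadingCoeff, (hmon j).leadingCoeff,
      leadingCoeff_C, mul_one, one_mul] at hlc
    set mi := (u i).natDegree with hmi
    set mj := (u j).natDegree with hmj
    have hmi0 : 0 < mi := hu i
    have hmj0 : 0 < mj := hu j
    have hmi' : (mi : ℝ) ≠ 0 := by exact_mod_cast hmi0.ne'
    have hmj' : (mj : ℝ) ≠ 0 := by exact_mod_cast hmj0.ne'
    have h' : C (mj : ℝ) * (derivative (u i) * u j) = C (mi : ℝ) * (u i * derivative (u j)) := by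
      rw [h, hlc, C_mul]; ring
    have hW2 : wronskian (u i ^ mj) (u j ^ mi) = 0 := by
      obtain ⟨ki, hki⟩ : ∃ ki, mi = ki + 1 := ⟨mi - 1, by omega⟩
      obtain ⟨kj, hkj⟩ : ∃ kj, mj = kj + 1 := ⟨mj - 1, by omega⟩
      rw [wronskian, derivative_pow, derivative_pow]
      clear_value mi mj
      subst hki hkj
      simp only [Nat.add_sub_cancel]
      linear_combination (-(u i ^ kj * u j ^ ki)) * h'
    obtain ⟨l2, hl2, h2⟩ := wronskian_dep _ _ (pow_ne_zero _ (hun i)) (pow_ne_zero _ (hun j)) hW2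
    have hlc2 := congrArg leadingCoeff h2
    simp only [leadingCoeff_mul, leadingCoeff_pow, (hmon i).leadingCoeff, (hmon j).leadingCoeff,
      leadingCoeff_C, one_pow, mul_one] at hlc2
    rw [← hlc2, C_1, one_mul] at h2
    refine ⟨(mi : ℚ) / mj, by positivity, fun x => ?_⟩
    have h3 : |(u i).eval x| ^ mj = |(u j).eval x| ^ mi := by
      rw [← abs_pow, ← abs_pow, ← eval_pow, ← eval_pow, h2]
    push_cast
    rw [div_eq_mul_inv, Real.rpow_mul (abs_nonneg _), Real.rpow_natCast, ← h3,
      Real.pow_rpow_inv_natCast (abs_nonneg _) hmj0.ne']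

end

section

lemma chain_rule {σ B : Type*} [Fintype σ] [CommRing B] [Algebra ℝ B] (D : Derivation ℝ B B)
    (g : σ → B) (p : MvPolynomial σ ℝ) :
    D (MvPolynomial.aeval g p) =
      ∑ j, MvPolynomial.aeval g (MvPolynomial.pderiv j p) * D (g j) := by
  classical
  induction p using MvPolynomial.induction_on with
  | C a => simp [MvPolynomial.algHom_C]
  | add p q hp hq =>
    simp only [map_add, hp, hq, add_mul, Finset.sum_add_distrib]
  | mul_X p i hp =>
    simp only [map_mul, MvPolynomial.aeval_X, Derivation.leibniz, hp, smul_eq_mul, map_add, add_mul,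
      Finset.sum_add_distrib, MvPolynomial.pderiv_X]
    congr 1
    · rw [Finset.sum_eq_single i]
      · simp
      · intro j _ hj
        simp [Pi.single_apply, Ne.symm hj]
      · simp
    · rw [Finset.mul_sum]
      exact Finset.sum_congr rfl (fun j _ => by ring)

section
variable {σ : Type*}

lemma degreeOf_of_pderiv (Q : MvPolynomial σ ℝ) (k : σ) (h : MvPolynomial.pderiv k Q = 0) :
    Q.degreeOf k = 0 := by
  classical
  rw [← Nat.le_zero, MvPolynomial.degreeOf_le_iff]
  intro m hm
  by_contra hcon
  have h1 := MvPolynomial.coeff_pderiv (i := k) Q (m - Finsupp.single k 1)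
  rw [h, MvPolynomial.coeff_zero, tsub_add_cancel_of_le] at h1
  · have h2 := MvPolynomial.mem_support_iff.1 hm
    have h3 : (((m - Finsupp.single k 1 : σ →₀ ℕ) k : ℕ) : ℝ) + 1 ≠ 0 := by positivity
    exact (mul_ne_zero h2 h3) h1.symm
  · rw [Finsupp.single_le_iff]
    omega

lemma const_of_degreeOf (Q : MvPolynomial σ ℝ) (h : ∀ k, Q.degreeOf k = 0) :
    ∃ c : ℝ, Q = MvPolynomial.C c := by
  refine ⟨_, MvPolynomial.totalDegree_eq_zero_iff_eq_C.1 ?_⟩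
  rw [MvPolynomial.totalDegree_eq_zero_iff]
  intro m hm x
  have := MvPolynomial.monomial_le_degreeOf x hm
  rw [h x] at this
  omega

lemma const_of_pderiv (Q : MvPolynomial σ ℝ) (h : ∀ k, MvPolynomial.pderiv k Q = 0) :
    ∃ c : ℝ, Q = MvPolynomial.C c :=
  const_of_degreeOf Q (fun k => degreeOf_of_pderiv Q k (h k))

lemma degreeOf_pderiv_le (Q : MvPolynomial σ ℝ) (j k : σ) :
    (MvPolynomial.pderiv j Q).degreeOf k ≤ Q.degreeOf k := by
  classical
  rw [MvPolynomial.degreeOf_le_iff]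
  intro m hm
  have h1 := MvPolynomial.mem_support_iff.1 hm
  rw [MvPolynomial.coeff_pderiv] at h1
  have h2 := MvPolynomial.monomial_le_degreeOf k
    (MvPolynomial.mem_support_iff.2 (left_ne_zero_of_mul h1))
  refine le_trans ?_ h2
  simp

lemma pderiv_swap (Q : MvPolynomial σ ℝ) (j k : σ) :
    MvPolynomial.pderiv j (MvPolynomial.pderiv k Q) =
      MvPolynomial.pderiv k (MvPolynomial.pderiv j Q) := by
  classical
  ext m
  simp only [MvPolynomial.coeff_pderiv]
  by_cases h : j = k
  · subst h; rfl
  · rw [add_right_comm]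
    simp [Finsupp.single_apply, h, Ne.symm h]
    ring

lemma ueq_line [Fintype σ] (A B : MvPolynomial σ ℝ) (hB : B ≠ 0)
    (h : ∀ i, MvPolynomial.pderiv i A * B = A * MvPolynomial.pderiv i B) :
    ∃ l : ℝ, A = MvPolynomial.C l * B := by
  classical
  obtain ⟨c, hc⟩ : ∃ c, MvPolynomial.eval c B ≠ 0 := by
    by_contra hcon
    push Not at hcon
    exact hB (MvPolynomial.funext fun x => by simpa using hcon x)
  refine ⟨MvPolynomial.eval c A / MvPolynomial.eval c B, ?_⟩
  set l := MvPolynomial.eval c A / MvPolynomial.eval c B with hl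
  suffices hh : A - MvPolynomial.C l * B = 0 by exact sub_eq_zero.1 hh
  set A' := A - MvPolynomial.C l * B with hA'
  have h' : ∀ i, MvPolynomial.pderiv i A' * B = A' * MvPolynomial.pderiv i B := by
    intro i
    simp only [hA', map_sub, Derivation.leibniz, MvPolynomial.pderiv_C, smul_eq_mul, mul_zero,
      add_zero]
    linear_combination h i
  have hA'c : MvPolynomial.eval c A' = 0 := by
    simp only [hA', hl, map_sub, map_mul, MvPolynomial.eval_C]
    field_simp
    ring
  apply MvPolynomial.funext
  intro z
  rw [map_zero]
  set g : σ → Polynomial ℝ := fun i => C (c i) + C (z i - c i) * X with hg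
  have hev : ∀ (p : MvPolynomial σ ℝ) (s : ℝ), (MvPolynomial.aeval g p).eval s =
      MvPolynomial.eval (fun i => c i + (z i - c i) * s) p := by
    intro p s
    rw [← coe_evalRingHom, MvPolynomial.aeval_def, MvPolynomial.hom_eval₂, MvPolynomial.eval,
      MvPolynomial.coe_eval₂Hom]
    congr 1
    · ext y; simp
    · ext j; simp [hg]
  have hder : ∀ p : MvPolynomial σ ℝ, derivative (MvPolynomial.aeval g p) =
      ∑ j, MvPolynomial.aeval g (MvPolynomial.pderiv j p) * C (z j - c j) := by
    intro p
    have := chain_rule (Polynomial.derivative' (R := ℝ)) g p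
    simp only [Polynomial.derivative'_apply] at this
    rw [this]
    refine Finset.sum_congr rfl (fun j _ => ?_)
    simp [hg]
  have e0 : (fun i => c i + (z i - c i) * 0) = c := by ext; ring
  have e1 : (fun i => c i + (z i - c i) * 1) = z := by ext; ring
  have hB0 : MvPolynomial.aeval g B ≠ 0 := by
    intro h0
    apply hc
    rw [← e0, ← hev, h0, eval_zero]
  have hA0 : MvPolynomial.aeval g A' = 0 := by
    by_contra hne
    obtain ⟨l, hl, hll⟩ := wronskian_dep _ _ hne hB0 (by
      rw [wronskian, hder, hder, Finset.mul_sum, Finset.sum_mul, ← Finset.sum_sub_distrib]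
      refine Finset.sum_eq_zero (fun j _ => ?_)
      have := congrArg (MvPolynomial.aeval g) (h' j)
      simp only [map_mul] at this
      linear_combination (-C (z j - c j)) * this)
    have := congrArg (fun p => p.eval 0) hll
    simp only [eval_mul, eval_C, hev, e0, hA'c] at this
    exact (mul_ne_zero hl hc) this.symm
  rw [← e1, ← hev, hA0, eval_zero]

lemma exists_antideriv (v : Polynomial ℝ) : ∃ u : Polynomial ℝ, derivative u = v := by
  induction v using Polynomial.induction_on' with
  | add p q hp hq =>
    obtain ⟨u, hu⟩ := hp
    obtain ⟨w, hw⟩ := hq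
    exact ⟨u + w, by rw [derivative_add, hu, hw]⟩
  | monomial n a =>
    refine ⟨monomial (n + 1) (a / (n + 1)), ?_⟩
    rw [derivative_monomial, Nat.add_sub_cancel]
    congr 1
    push_cast
    field_simp

/-- a univariate polynomial in the variable `x_i` -/
def uni (i : σ) (a : Polynomial ℝ) : MvPolynomial σ ℝ := Polynomial.aeval (MvPolynomial.X i) a

lemma uni_mul (i : σ) (a b : Polynomial ℝ) : uni i (a * b) = uni i a * uni i b := map_mul _ _ _
lemma uni_C (i : σ) (a : ℝ) : uni i (C a) = MvPolynomial.C a := by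
  simp [uni, MvPolynomial.algebraMap_eq]

lemma uni_eval (i : σ) (a : Polynomial ℝ) (z : σ → ℝ) :
    MvPolynomial.eval z (uni i a) = a.eval (z i) := by
  rw [uni, ← MvPolynomial.aeval_eq_eval, ← Polynomial.aeval_algHom_apply,
    MvPolynomial.aeval_X, Polynomial.coe_aeval_eq_eval]

lemma uni_ne_zero (i : σ) (a : Polynomial ℝ) (ha : a ≠ 0) : uni i a ≠ 0 := by
  intro h
  apply ha
  apply Polynomial.funext
  intro x
  have := uni_eval i a (fun _ => x)
  rw [h] at this
  simpa using this.symm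

lemma pderiv_uni_self (i : σ) (a : Polynomial ℝ) :
    MvPolynomial.pderiv i (uni i a) = uni i (derivative a) := by
  classical
  rw [uni, Derivation.map_aeval, MvPolynomial.pderiv_X_self, smul_eq_mul, mul_one, uni]

lemma pderiv_uni_ne (i j : σ) (h : j ≠ i) (a : Polynomial ℝ) :
    MvPolynomial.pderiv j (uni i a) = 0 := by
  classical
  rw [uni, Derivation.map_aeval, MvPolynomial.pderiv_X_of_ne h.symm, smul_zero]

lemma degreeOf_uni (i j : σ) (h : j ≠ i) (a : Polynomial ℝ) : (uni i a).degreeOf j = 0 :=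
  degreeOf_of_pderiv _ _ (pderiv_uni_ne i j h a)

lemma uni_relPrime (i j : σ) (h : i ≠ j) (a b : Polynomial ℝ) (ha : a ≠ 0) (hb : b ≠ 0) :
    IsRelPrime (uni i a) (uni j b) := by
  intro g h1 h2
  have key : ∀ (i : σ) (a : Polynomial ℝ), a ≠ 0 → g ∣ uni i a → ∀ k, k ≠ i →
      g.degreeOf k = 0 := by
    intro i a ha ⟨g', hg'⟩ k hk
    have hne := uni_ne_zero i a ha
    rw [hg'] at hne
    have := MvPolynomial.degreeOf_mul_eq (n := k) (left_ne_zero_of_mul hne)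
      (right_ne_zero_of_mul hne)
    rw [← hg', degreeOf_uni i k hk] at this
    omega
  obtain ⟨c, hc⟩ := const_of_degreeOf g (fun k => by
    by_cases hk : k = i
    · exact key j b hb h2 k (by rw [hk]; exact h)
    · exact key i a ha h1 k hk)
  have hc0 : c ≠ 0 := by
    rintro rfl
    rw [hc, map_zero, zero_dvd_iff] at h1
    exact uni_ne_zero i a ha h1
  rw [hc]
  exact (isUnit_iff_ne_zero.2 hc0).map MvPolynomial.C

lemma uni_coprime (i : σ) (a b : Polynomial ℝ) (h : IsCoprime a b) :
    IsCoprime (uni i a) (uni i b) := by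
  obtain ⟨x, y, hxy⟩ := h
  refine ⟨uni i x, uni i y, ?_⟩
  rw [← uni_mul, ← uni_mul]
  unfold uni
  rw [← map_add, hxy, map_one]
end

end

section

section
variable {σ : Type*}

/-- `Q1` is the derivative of `Q` along the common vector field -/
def VRel (a b : σ → Polynomial ℝ) (Q Q1 : MvPolynomial σ ℝ) : Prop :=
  ∀ i, uni i (a i) * Q1 = uni i (b i) * MvPolynomial.pderiv i Q

lemma VRel.add {a b : σ → Polynomial ℝ} {Q Q1 S S1 : MvPolynomial σ ℝ} (h : VRel a b Q Q1)
    (h' : VRel a b S S1) : VRel a b (Q + S) (Q1 + S1) := by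
  intro i
  rw [map_add, mul_add, mul_add, h i, h' i]

lemma VRel.sub {a b : σ → Polynomial ℝ} {Q Q1 S S1 : MvPolynomial σ ℝ} (h : VRel a b Q Q1)
    (h' : VRel a b S S1) : VRel a b (Q - S) (Q1 - S1) := by
  intro i
  rw [map_sub, mul_sub, mul_sub, h i, h' i]

lemma VRel.const {a b : σ → Polynomial ℝ} (c : ℝ) : VRel a b (MvPolynomial.C c) 0 := by
  intro i; simp

lemma VRel.mul {a b : σ → Polynomial ℝ} {Q Q1 S S1 : MvPolynomial σ ℝ} (h : VRel a b Q Q1)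
    (h' : VRel a b S S1) : VRel a b (Q * S) (Q1 * S + Q * S1) := by
  intro i
  simp only [Derivation.leibniz, smul_eq_mul]
  linear_combination S * h i + Q * h' i

lemma VRel.smul {a b : σ → Polynomial ℝ} {Q Q1 : MvPolynomial σ ℝ} (h : VRel a b Q Q1) (c : ℝ) :
    VRel a b (MvPolynomial.C c * Q) (MvPolynomial.C c * Q1) := by
  have := (VRel.const (a := a) (b := b) c).mul h
  simpa using this

lemma VRel.pow {a b : σ → Polynomial ℝ} {Q : MvPolynomial σ ℝ} {l : ℝ}
    (h : VRel a b Q (MvPolynomial.C l * Q)) (k : ℕ) :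
    VRel a b (Q ^ k) (MvPolynomial.C (k * l) * Q ^ k) := by
  induction k with
  | zero => simpa using VRel.const (a := a) (b := b) 1
  | succ k ih =>
    have := ih.mul h
    rw [← pow_succ] at this
    convert this using 1
    push_cast
    simp only [map_mul, map_add, map_one]
    ring

lemma VRel.aeval {a b : σ → Polynomial ℝ} {Q Q1 : MvPolynomial σ ℝ} (h : VRel a b Q Q1)
    (F : Polynomial ℝ) :
    VRel a b (Polynomial.aeval Q F) (Polynomial.aeval Q (derivative F) * Q1) := by
  intro i
  rw [Derivation.map_aeval, smul_eq_mul]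
  linear_combination (Polynomial.aeval Q (derivative F)) * h i

lemma VRel.unique [Nonempty σ] {a b : σ → Polynomial ℝ} (ha : ∀ i, a i ≠ 0)
    {Q Q1 Q2 : MvPolynomial σ ℝ} (h : VRel a b Q Q1)
    (h' : VRel a b Q Q2) : Q1 = Q2 := by
  obtain ⟨i⟩ := ‹Nonempty σ›
  exact mul_left_cancel₀ (uni_ne_zero i _ (ha i)) ((h i).trans (h' i).symm)

lemma VRel.eq_const {a b : σ → Polynomial ℝ} (hb : ∀ i, b i ≠ 0)
    {Q : MvPolynomial σ ℝ} (h : VRel a b Q 0) : ∃ c : ℝ, Q = MvPolynomial.C c := by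
  apply const_of_pderiv
  intro k
  have := h k
  rw [mul_zero] at this
  exact (mul_eq_zero.1 this.symm).resolve_left (uni_ne_zero k _ (hb k))

lemma VRel.prop [Fintype σ] {a b : σ → Polynomial ℝ} (hb : ∀ i, b i ≠ 0)
    {E F : MvPolynomial σ ℝ} {l : ℝ} (h : VRel a b E (MvPolynomial.C l * E))
    (h' : VRel a b F (MvPolynomial.C l * F)) (hF : F ≠ 0) : ∃ c : ℝ, E = MvPolynomial.C c * F := by
  apply ueq_line E F hF
  intro i
  apply mul_left_cancel₀ (uni_ne_zero i _ (hb i))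
  linear_combination E * h' i - F * h i

lemma VRel.exists_of_cross [Nontrivial σ] {a b : σ → Polynomial ℝ} (ha : ∀ i, a i ≠ 0)
    (hab : ∀ i, IsCoprime (a i) (b i)) {Q : MvPolynomial σ ℝ}
    (h : ∀ i j, MvPolynomial.pderiv i Q * uni i (b i) * uni j (a j) =
      MvPolynomial.pderiv j Q * uni j (b j) * uni i (a i)) : ∃ Q1, VRel a b Q Q1 := by
  have hdiv : ∀ i, ∃ S, MvPolynomial.pderiv i Q = uni i (a i) * S := by
    intro i
    obtain ⟨j, hj⟩ := exists_ne i
    have h1 : uni i (a i) ∣ MvPolynomial.pderiv i Q * uni i (b i) * uni j (a j) :=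
      ⟨MvPolynomial.pderiv j Q * uni j (b j), by rw [h]; ring⟩
    have h2 := (uni_relPrime i j hj.symm _ _ (ha i) (ha j)).dvd_of_dvd_mul_right h1
    exact (uni_coprime i _ _ (hab i)).isRelPrime.dvd_of_dvd_mul_right h2
  choose S hS using hdiv
  obtain ⟨i0⟩ : Nonempty σ := inferInstance
  refine ⟨S i0 * uni i0 (b i0), fun i => ?_⟩
  have := h i i0
  rw [hS i, hS i0] at this
  apply mul_left_cancel₀ (uni_ne_zero i0 _ (ha i0))
  rw [hS i]
  linear_combination -this

lemma VRel.next [Nontrivial σ] {a b : σ → Polynomial ℝ} (ha : ∀ i, a i ≠ 0)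
    (hab : ∀ i, IsCoprime (a i) (b i)) {Q Q1 : MvPolynomial σ ℝ} (h : VRel a b Q Q1) :
    ∃ Q2, VRel a b Q1 Q2 := by
  apply VRel.exists_of_cross ha hab
  have key : ∀ i j, j ≠ i → uni i (a i) * MvPolynomial.pderiv j Q1 =
      uni i (b i) * MvPolynomial.pderiv j (MvPolynomial.pderiv i Q) := by
    intro i j hj
    have := congrArg (MvPolynomial.pderiv j) (h i)
    simpa [Derivation.leibniz, pderiv_uni_ne i j hj] using this
  intro i j
  by_cases hij : i = j
  · subst hij; ring
  · have h1 := key i j (Ne.symm hij)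
    have h2 := key j i hij
    rw [pderiv_swap] at h2
    linear_combination (uni i (b i)) * h2 - (uni j (b j)) * h1
end

section deg
variable {n : ℕ}

/-- degree in the first variable -/
def dg (Q : MvPolynomial (Fin (n + 1)) ℝ) : ℕ := (MvPolynomial.finSuccEquiv ℝ n Q).natDegree

/-- leading coefficient in the first variable -/
def lcf (Q : MvPolynomial (Fin (n + 1)) ℝ) : MvPolynomial (Fin n) ℝ :=
  (MvPolynomial.finSuccEquiv ℝ n Q).leadingCoeff

lemma dg_eq (Q : MvPolynomial (Fin (n + 1)) ℝ) : dg Q = Q.degreeOf 0 :=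
  MvPolynomial.natDegree_finSuccEquiv Q

lemma fse_pderiv (Q : MvPolynomial (Fin (n + 1)) ℝ) :
    MvPolynomial.finSuccEquiv ℝ n (MvPolynomial.pderiv 0 Q) =
      derivative (MvPolynomial.finSuccEquiv ℝ n Q) := by
  induction Q using MvPolynomial.induction_on with
  | C a => simp [MvPolynomial.finSuccEquiv_apply]
  | add p q hp hq => simp [hp, hq]
  | mul_X p i hp =>
    simp only [Derivation.leibniz, smul_eq_mul, map_add, map_mul, hp, derivative_mul]
    refine Fin.cases ?_ (fun j => ?_) i
    · simp [MvPolynomial.finSuccEquiv_X_zero]; ring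
    · simp [MvPolynomial.finSuccEquiv_X_succ, MvPolynomial.pderiv_X_of_ne]; ring

lemma fse_uni (a : Polynomial ℝ) :
    MvPolynomial.finSuccEquiv ℝ n (uni 0 a) = a.map MvPolynomial.C := by
  induction a using Polynomial.induction_on' with
  | add p q hp hq =>
    simp only [uni, map_add] at hp hq ⊢
    rw [hp, hq, Polynomial.map_add]
  | monomial k c =>
    simp [uni, MvPolynomial.finSuccEquiv_X_zero, Polynomial.aeval_monomial,
      MvPolynomial.algebraMap_eq, MvPolynomial.finSuccEquiv_apply, C_mul_X_pow_eq_monomial]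

lemma VRel.deg {a b : Fin (n + 1) → Polynomial ℝ} (ha : ∀ i, a i ≠ 0) (hb : ∀ i, b i ≠ 0)
    {Q Q1 : MvPolynomial (Fin (n + 1)) ℝ} (h : VRel a b Q Q1) (hQ : 0 < dg Q) :
    Q1 ≠ 0 ∧ dg Q1 + (a 0).natDegree + 1 = dg Q + (b 0).natDegree ∧
    MvPolynomial.C (a 0).leadingCoeff * lcf Q1 =
      MvPolynomial.C ((b 0).leadingCoeff * dg Q) * lcf Q := by
  have h0 := congrArg (MvPolynomial.finSuccEquiv ℝ n) (h 0)
  rw [map_mul, map_mul, fse_uni, fse_uni, fse_pderiv] at h0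
  unfold dg at hQ
  have hd : derivative (MvPolynomial.finSuccEquiv ℝ n Q) ≠ 0 := by
    rw [Ne, derivative_eq_zero]; omega
  have hinj : Function.Injective (MvPolynomial.C : ℝ →+* MvPolynomial (Fin n) ℝ) :=
    MvPolynomial.C_injective _ _
  have ha' : (a 0).map (MvPolynomial.C : ℝ →+* MvPolynomial (Fin n) ℝ) ≠ 0 :=
    (Polynomial.map_ne_zero_iff hinj).2 (ha 0)
  have hb' : (b 0).map (MvPolynomial.C : ℝ →+* MvPolynomial (Fin n) ℝ) ≠ 0 :=
    (Polynomial.map_ne_zero_iff hinj).2 (hb 0)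
  have hQ1 : MvPolynomial.finSuccEquiv ℝ n Q1 ≠ 0 := by
    intro h1
    rw [h1, mul_zero] at h0
    exact mul_ne_zero hb' hd h0.symm
  have e1 := congrArg natDegree h0
  rw [natDegree_mul ha' hQ1, natDegree_mul hb' hd, natDegree_map_eq_of_injective hinj,
    natDegree_map_eq_of_injective hinj, natDegree_derivative] at e1
  have e2 := congrArg leadingCoeff h0
  rw [leadingCoeff_mul, leadingCoeff_mul, leadingCoeff_map_of_injective hinj,
    leadingCoeff_map_of_injective hinj, leadingCoeff_derivative] at e2
  refine ⟨fun h1 => hQ1 (by rw [h1, map_zero]), ?_, ?_⟩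
  · unfold dg; omega
  · unfold lcf dg
    rw [e2]
    simp
    ring

lemma VRel.deg_le {a b : Fin (n + 1) → Polynomial ℝ} (hn : 1 ≤ n) (ha : ∀ i, a i ≠ 0)
    {Q Q1 : MvPolynomial (Fin (n + 1)) ℝ} (h : VRel a b Q Q1) : dg Q1 ≤ dg Q := by
  by_cases h1 : Q1 = 0
  · simp [h1, dg]
  set j : Fin (n + 1) := ⟨1, by omega⟩ with hj
  have hj0 : (0 : Fin (n + 1)) ≠ j := by rw [hj, Ne, Fin.ext_iff]; simp
  have h2 := congrArg (MvPolynomial.degreeOf 0) (h j)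
  rw [MvPolynomial.degreeOf_mul_eq (uni_ne_zero j _ (ha j)) h1, degreeOf_uni j 0 hj0,
    zero_add] at h2
  rw [dg_eq, dg_eq, h2]
  refine (MvPolynomial.degreeOf_mul_le _ _ _).trans ?_
  rw [degreeOf_uni j 0 hj0, zero_add]
  exact degreeOf_pderiv_le _ _ _

lemma VRel.const_of_deg {a b : Fin (n + 1) → Polynomial ℝ} (ha : ∀ i, a i ≠ 0) (hb : ∀ i, b i ≠ 0)
    {Q Q1 : MvPolynomial (Fin (n + 1)) ℝ} (h : VRel a b Q Q1) (hQ : dg Q = 0) :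
    Q1 = 0 ∧ ∃ c : ℝ, Q = MvPolynomial.C c := by
  have h1 : MvPolynomial.pderiv 0 Q = 0 := by
    apply (MvPolynomial.finSuccEquiv ℝ n).injective
    rw [fse_pderiv, map_zero, derivative_eq_zero]
    exact hQ
  have h2 : Q1 = 0 := by
    have := h 0
    rw [h1, mul_zero] at this
    exact (mul_eq_zero.1 this).resolve_left (uni_ne_zero 0 _ (ha 0))
  subst h2
  exact ⟨rfl, h.eq_const hb⟩
end deg

end

section

section
variable {n : ℕ} {a b : Fin (n + 1) → Polynomial ℝ}

lemma caseA_exists (ha : ∀ i, a i ≠ 0) (hb : ∀ i, b i ≠ 0) (hn : 1 ≤ n)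
    (hab : ∀ i, IsCoprime (a i) (b i)) (hdeg : (b 0).natDegree ≤ (a 0).natDegree) :
    ∀ (N : ℕ) (Q Q1 : MvPolynomial (Fin (n + 1)) ℝ), VRel a b Q Q1 → 0 < dg Q → dg Q ≤ N →
      ∃ q, VRel a b q 1 := by
  have : Nontrivial (Fin (n + 1)) := Fin.nontrivial_iff_two_le.2 (by omega)
  intro N
  induction N with
  | zero => intro Q Q1 _ h1 h2; omega
  | succ N ih =>
    intro Q Q1 h h1 h2
    obtain ⟨hne, hd, -⟩ := h.deg ha hb h1
    obtain ⟨Q2, h'⟩ := h.next ha hab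
    by_cases h3 : dg Q1 = 0
    · obtain ⟨-, c, hc⟩ := h'.const_of_deg ha hb h3
      have hc0 : c ≠ 0 := by rintro rfl; exact hne (by rw [hc, map_zero])
      refine ⟨MvPolynomial.C c⁻¹ * Q, ?_⟩
      have := h.smul c⁻¹
      rwa [hc, ← map_mul, inv_mul_cancel₀ hc0, map_one] at this
    · exact ih Q1 Q2 h' (by omega) (by omega)

lemma caseA_poly (ha : ∀ i, a i ≠ 0) (hb : ∀ i, b i ≠ 0) (hn : 1 ≤ n)
    (hab : ∀ i, IsCoprime (a i) (b i)) (hdeg : (b 0).natDegree ≤ (a 0).natDegree)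
    (q : MvPolynomial (Fin (n + 1)) ℝ) (hq : VRel a b q 1) :
    ∀ (N : ℕ) (Q Q1 : MvPolynomial (Fin (n + 1)) ℝ), VRel a b Q Q1 → dg Q ≤ N →
      ∃ F : Polynomial ℝ, Q = Polynomial.aeval q F := by
  have : Nontrivial (Fin (n + 1)) := Fin.nontrivial_iff_two_le.2 (by omega)
  have h0 : ∀ (Q Q1 : MvPolynomial (Fin (n + 1)) ℝ), VRel a b Q Q1 → dg Q = 0 →
      ∃ F : Polynomial ℝ, Q = Polynomial.aeval q F := by
    intro Q Q1 h hd
    obtain ⟨-, c, hc⟩ := h.const_of_deg ha hb hd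
    exact ⟨C c, by rw [hc, Polynomial.aeval_C, MvPolynomial.algebraMap_eq]⟩
  intro N
  induction N with
  | zero => intro Q Q1 h h2; exact h0 Q Q1 h (by omega)
  | succ N ih =>
    intro Q Q1 h h2
    by_cases hd0 : dg Q = 0
    · exact h0 Q Q1 h hd0
    obtain ⟨hne, hd, -⟩ := h.deg ha hb (by omega)
    obtain ⟨Q2, h'⟩ := h.next ha hab
    obtain ⟨F, hF⟩ := ih Q1 Q2 h' (by omega)
    obtain ⟨H, hH⟩ := exists_antideriv F
    have h3 := h.sub (hq.aeval H)
    rw [hH, mul_one, hF, sub_self] at h3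
    obtain ⟨c, hc⟩ := h3.eq_const hb
    refine ⟨H + C c, ?_⟩
    rw [map_add, Polynomial.aeval_C, MvPolynomial.algebraMap_eq, ← hc]
    ring

lemma dg_C_mul (c : ℝ) (hc : c ≠ 0) (Q : MvPolynomial (Fin (n + 1)) ℝ) :
    MvPolynomial.finSuccEquiv ℝ n (MvPolynomial.C c * Q) =
      C (MvPolynomial.C c) * MvPolynomial.finSuccEquiv ℝ n Q := by
  rw [map_mul]
  congr 1
  simp [MvPolynomial.finSuccEquiv_apply]

lemma lcf_C_mul (c : ℝ) (Q : MvPolynomial (Fin (n + 1)) ℝ) :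
    lcf (MvPolynomial.C c * Q) = MvPolynomial.C c * lcf Q := by
  by_cases hc : c = 0
  · simp [hc, lcf]
  · unfold lcf
    rw [dg_C_mul c hc, leadingCoeff_mul, leadingCoeff_C]

lemma lcf_ne_zero {Q : MvPolynomial (Fin (n + 1)) ℝ} (hQ : Q ≠ 0) : lcf Q ≠ 0 := by
  unfold lcf
  rw [Ne, leadingCoeff_eq_zero]
  intro h
  exact hQ ((MvPolynomial.finSuccEquiv ℝ n).injective (by rw [h, map_zero]))

/-- the eigenvalue scale -/
def kap (a b : Fin (n + 1) → Polynomial ℝ) : ℝ := (b 0).leadingCoeff / (a 0).leadingCoeff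

lemma kap_ne (ha : ∀ i, a i ≠ 0) (hb : ∀ i, b i ≠ 0) : kap a b ≠ 0 :=
  div_ne_zero (leadingCoeff_ne_zero.2 (hb 0)) (leadingCoeff_ne_zero.2 (ha 0))

lemma VRel.lcf_eq (ha : ∀ i, a i ≠ 0) (hb : ∀ i, b i ≠ 0)
    {Q Q1 : MvPolynomial (Fin (n + 1)) ℝ} (h : VRel a b Q Q1) (hQ : 0 < dg Q) :
    lcf Q1 = MvPolynomial.C (kap a b * dg Q) * lcf Q := by
  obtain ⟨-, -, h3⟩ := h.deg ha hb hQ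
  have hl : (a 0).leadingCoeff ≠ 0 := leadingCoeff_ne_zero.2 (ha 0)
  apply mul_left_cancel₀ (a := MvPolynomial.C (σ := Fin n) (a 0).leadingCoeff)
    (by simpa using ha 0)
  rw [h3, ← mul_assoc, ← map_mul]
  congr 2
  unfold kap
  field_simp

lemma VRel.eig (ha : ∀ i, a i ≠ 0) (hb : ∀ i, b i ≠ 0) {l : ℝ}
    {E : MvPolynomial (Fin (n + 1)) ℝ} (h : VRel a b E (MvPolynomial.C l * E)) (hE : 0 < dg E) :
    l = kap a b * dg E := by
  have h1 := h.lcf_eq ha hb hE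
  have hE0 : E ≠ 0 := by rintro rfl; simp [dg] at hE
  rw [lcf_C_mul] at h1
  exact MvPolynomial.C_injective _ _ (mul_right_cancel₀ (lcf_ne_zero hE0) h1)

lemma VRel.deg_lower (ha : ∀ i, a i ≠ 0) (hb : ∀ i, b i ≠ 0)
    (hdeg : (b 0).natDegree = (a 0).natDegree + 1)
    {Q Q1 : MvPolynomial (Fin (n + 1)) ℝ} (h : VRel a b Q Q1) (hQ : 0 < dg Q) :
    dg (Q1 - MvPolynomial.C (kap a b * dg Q) * Q) < dg Q := by
  obtain ⟨hne, hd, -⟩ := h.deg ha hb hQ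
  have h1 := h.lcf_eq ha hb hQ
  rw [← lcf_C_mul] at h1
  have hc : kap a b * dg Q ≠ 0 := mul_ne_zero (kap_ne ha hb) (by exact_mod_cast hQ.ne')
  have hne' : MvPolynomial.finSuccEquiv ℝ n Q1 ≠ 0 := fun h0 =>
    hne ((MvPolynomial.finSuccEquiv ℝ n).injective (by rw [h0, map_zero]))
  have hQ0 : Q ≠ 0 := by rintro rfl; simp [dg] at hQ
  have hQ' : MvPolynomial.finSuccEquiv ℝ n Q ≠ 0 := fun h0 =>
    hQ0 ((MvPolynomial.finSuccEquiv ℝ n).injective (by rw [h0, map_zero]))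
  have hc' : (MvPolynomial.C (kap a b * dg Q) : MvPolynomial (Fin n) ℝ) ≠ 0 := by
    rw [Ne, MvPolynomial.C_eq_zero]; exact hc
  have hdeg2 : (MvPolynomial.finSuccEquiv ℝ n Q1).natDegree =
      (MvPolynomial.finSuccEquiv ℝ n (MvPolynomial.C (kap a b * dg Q) * Q)).natDegree := by
    rw [dg_C_mul _ hc, natDegree_C_mul hc']
    unfold dg at hd
    omega
  have hne2 : MvPolynomial.finSuccEquiv ℝ n (MvPolynomial.C (kap a b * dg Q) * Q) ≠ 0 := by
    rw [dg_C_mul _ hc]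
    exact mul_ne_zero (by rwa [Ne, C_eq_zero]) hQ'
  have h2 := degree_sub_lt (by rw [degree_eq_natDegree hne', degree_eq_natDegree hne2, hdeg2])
    hne' h1
  rw [← map_sub] at h2
  by_cases h0 : MvPolynomial.finSuccEquiv ℝ n (Q1 - MvPolynomial.C (kap a b * dg Q) * Q) = 0
  · have e : dg (Q1 - MvPolynomial.C (kap a b * dg Q) * Q) =
      (MvPolynomial.finSuccEquiv ℝ n (Q1 - MvPolynomial.C (kap a b * dg Q) * Q)).natDegree := rfl
    rw [e, h0, natDegree_zero]
    exact hQ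
  · have h3 := natDegree_lt_natDegree h0 h2
    have e : dg (Q1 - MvPolynomial.C (kap a b * dg Q) * Q) =
      (MvPolynomial.finSuccEquiv ℝ n (Q1 - MvPolynomial.C (kap a b * dg Q) * Q)).natDegree := rfl
    have e1 : dg Q1 = (MvPolynomial.finSuccEquiv ℝ n Q1).natDegree := rfl
    rw [← e, ← e1] at h3
    omega

lemma caseB_exists (ha : ∀ i, a i ≠ 0) (hb : ∀ i, b i ≠ 0) (hn : 1 ≤ n)
    (hab : ∀ i, IsCoprime (a i) (b i)) (hdeg : (b 0).natDegree = (a 0).natDegree + 1)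
    (P P1 : MvPolynomial (Fin (n + 1)) ℝ) (hP : VRel a b P P1) (hdP : 0 < dg P) :
    ∃ q, 0 < dg q ∧ VRel a b q (MvPolynomial.C (kap a b * dg q) * q) ∧
      ∀ Q Q1, VRel a b Q Q1 → 0 < dg Q → dg q ≤ dg Q := by
  classical
  have : Nontrivial (Fin (n + 1)) := Fin.nontrivial_iff_two_le.2 (by omega)
  have hex : ∃ j, 0 < j ∧ ∃ Q Q1, VRel a b Q Q1 ∧ dg Q = j := ⟨dg P, hdP, P, P1, hP, rfl⟩
  obtain ⟨hj, q0, q1, hq0, hdq⟩ := Nat.find_spec hex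
  have hmin : ∀ Q Q1, VRel a b Q Q1 → 0 < dg Q → Nat.find hex ≤ dg Q :=
    fun Q Q1 h h0 => Nat.find_min' hex ⟨h0, Q, Q1, h, rfl⟩
  set j := Nat.find hex
  have hκ : kap a b * j ≠ 0 := mul_ne_zero (kap_ne ha hb) (by exact_mod_cast hj.ne')
  have h1 := hq0.deg_lower ha hb hdeg (by omega)
  obtain ⟨q2, hq1⟩ := hq0.next ha hab
  have h2 := hq1.sub (hq0.smul (kap a b * dg q0))
  obtain ⟨-, c, hc⟩ := h2.const_of_deg ha hb (by
    by_contra h3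
    have := hmin _ _ h2 (by omega)
    omega)
  rw [hdq] at hc
  set q := q0 + MvPolynomial.C (c / (kap a b * j)) with hq
  have h3 : VRel a b q (MvPolynomial.C (kap a b * j) * q) := by
    have := hq0.add (VRel.const (a := a) (b := b) (c / (kap a b * j)))
    rw [add_zero] at this
    convert this using 1
    rw [hq, mul_add, ← map_mul, mul_div_cancel₀ _ hκ, ← hc]
    ring
  have h4 : 0 < dg q := by
    by_contra h5
    obtain ⟨-, e, he⟩ := h3.const_of_deg ha hb (by omega)
    have : q0 = MvPolynomial.C (e - c / (kap a b * j)) := by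
      rw [map_sub, ← he, hq]; ring
    rw [this] at hdq
    simp [dg, MvPolynomial.finSuccEquiv_apply] at hdq
    omega
  have h5 := h3.eig ha hb h4
  have h6 : dg q = j := by
    have := mul_left_cancel₀ (kap_ne ha hb) h5
    exact_mod_cast this.symm
  rw [← h6] at h3 hmin
  exact ⟨q, h4, h3, hmin⟩

lemma caseB_eig (ha : ∀ i, a i ≠ 0) (hb : ∀ i, b i ≠ 0)
    (q : MvPolynomial (Fin (n + 1)) ℝ) (hdq : 0 < dg q)
    (hq : VRel a b q (MvPolynomial.C (kap a b * dg q) * q))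
    (hmin : ∀ Q Q1, VRel a b Q Q1 → 0 < dg Q → dg q ≤ dg Q)
    (m : ℕ) (E : MvPolynomial (Fin (n + 1)) ℝ)
    (hE : VRel a b E (MvPolynomial.C (kap a b * m) * E)) :
    ∃ (k : ℕ) (c : ℝ), k * dg q = m ∧ E = MvPolynomial.C c * q ^ k ∨ E = 0 := by
  by_cases hE0 : E = 0
  · exact ⟨0, 0, Or.inr hE0⟩
  set j := dg q with hj
  have hq0 : q ≠ 0 := by rintro rfl; simp [dg] at hj; omega
  obtain ⟨c0, hc0⟩ : ∃ c0 : ℝ, E ^ j = MvPolynomial.C c0 * q ^ m := by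
    refine VRel.prop hb (hE.pow j) ?_ (pow_ne_zero _ hq0)
    convert hq.pow m using 3
    ring
  set k := m / j with hk
  set r := m % j with hr
  have hm : m = k * j + r := (Nat.div_add_mod' m j).symm
  have hdvd : q ^ k ∣ E := by
    rw [← IsIntegrallyClosed.pow_dvd_pow_iff hdq.ne', hc0, ← pow_mul]
    exact Dvd.dvd.mul_left (pow_dvd_pow _ (by omega)) _
  obtain ⟨E', hE'⟩ := hdvd
  have hE'0 : E' ≠ 0 := by rintro rfl; exact hE0 (by rw [hE', mul_zero])
  have hrel : VRel a b E' (MvPolynomial.C (kap a b * r) * E') := by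
    intro i
    have h1 := hE i
    have h2 := (hq.pow k) i
    apply mul_left_cancel₀ (pow_ne_zero k hq0)
    rw [hE', Derivation.leibniz, smul_eq_mul, smul_eq_mul] at h1
    rw [hm] at h1
    push_cast at h1
    simp only [map_mul, map_add] at h1 h2 ⊢
    linear_combination h1 - E' * h2
  by_cases hr0 : r = 0
  · rw [hr0] at hrel
    simp only [Nat.cast_zero, mul_zero, map_zero, zero_mul] at hrel
    obtain ⟨c, hc⟩ := hrel.eq_const hb
    refine ⟨k, c, Or.inl ⟨by omega, ?_⟩⟩
    rw [hE', hc, mul_comm]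
  · exfalso
    have hrlt : r < j := Nat.mod_lt _ hdq
    have hpos : 0 < dg E' := by
      by_contra h3
      obtain ⟨h4, -⟩ := hrel.const_of_deg ha hb (by omega)
      refine (mul_ne_zero ?_ hE'0) h4
      rw [Ne, MvPolynomial.C_eq_zero]
      exact mul_ne_zero (kap_ne ha hb) (by exact_mod_cast hr0)
    have h5 := hrel.eig ha hb hpos
    have h6 : (r : ℝ) = dg E' := mul_left_cancel₀ (kap_ne ha hb) h5
    have h7 : r = dg E' := by exact_mod_cast h6
    have := hmin _ _ hrel hpos
    omega

lemma caseB_poly (ha : ∀ i, a i ≠ 0) (hb : ∀ i, b i ≠ 0) (hn : 1 ≤ n)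
    (hab : ∀ i, IsCoprime (a i) (b i)) (hdeg : (b 0).natDegree = (a 0).natDegree + 1)
    (q : MvPolynomial (Fin (n + 1)) ℝ) (hdq : 0 < dg q)
    (hq : VRel a b q (MvPolynomial.C (kap a b * dg q) * q))
    (hmin : ∀ Q Q1, VRel a b Q Q1 → 0 < dg Q → dg q ≤ dg Q) :
    ∀ (N : ℕ) (Q Q1 : MvPolynomial (Fin (n + 1)) ℝ), VRel a b Q Q1 → dg Q ≤ N →
      Q ∈ Submodule.span ℝ {s | ∃ k : ℕ, k * dg q ≤ N ∧ s = q ^ k} := by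
  have : Nontrivial (Fin (n + 1)) := Fin.nontrivial_iff_two_le.2 (by omega)
  have h0 : ∀ (N : ℕ) (Q Q1 : MvPolynomial (Fin (n + 1)) ℝ), VRel a b Q Q1 → dg Q = 0 →
      Q ∈ Submodule.span ℝ {s | ∃ k : ℕ, k * dg q ≤ N ∧ s = q ^ k} := by
    intro N Q Q1 h hd
    obtain ⟨-, c, hc⟩ := h.const_of_deg ha hb hd
    rw [hc, ← mul_one (MvPolynomial.C c), ← MvPolynomial.smul_eq_C_mul]
    exact Submodule.smul_mem _ _ (Submodule.subset_span ⟨0, by simp⟩)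
  intro N
  induction N with
  | zero => intro Q Q1 h h2; exact h0 0 Q Q1 h (by omega)
  | succ N ih =>
    intro Q Q1 h h2
    have hmono : Submodule.span ℝ {s | ∃ k : ℕ, k * dg q ≤ N ∧ s = q ^ k} ≤
        Submodule.span ℝ {s | ∃ k : ℕ, k * dg q ≤ N + 1 ∧ s = q ^ k} := by
      apply Submodule.span_mono
      rintro s ⟨k, hk, rfl⟩
      exact ⟨k, by omega, rfl⟩
    by_cases h3 : dg Q ≤ N
    · exact hmono (ih Q Q1 h h3)
    have hdQ : dg Q = N + 1 := by omega
    have hlow := h.deg_lower ha hb hdeg (by omega)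
    obtain ⟨Q2, h'⟩ := h.next ha hab
    have hR := ih _ _ (h'.sub (h.smul (kap a b * dg Q))) (by omega)
    rw [hdQ] at hR
    have solve : ∀ R ∈ Submodule.span ℝ {s | ∃ k : ℕ, k * dg q ≤ N ∧ s = q ^ k},
        ∃ G ∈ Submodule.span ℝ {s | ∃ k : ℕ, k * dg q ≤ N ∧ s = q ^ k}, ∃ G1, VRel a b G G1 ∧
          G1 - MvPolynomial.C (kap a b * ((N + 1 : ℕ) : ℝ)) * G = R := by
      intro R hR
      induction hR using Submodule.span_induction with
      | mem s hs =>
        obtain ⟨k, hk, rfl⟩ := hs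
        have hne : kap a b * (k * dg q : ℕ) - kap a b * ((N + 1 : ℕ) : ℝ) ≠ 0 := by
          rw [← mul_sub]
          refine mul_ne_zero (kap_ne ha hb) (sub_ne_zero.2 ?_)
          exact_mod_cast (by omega : k * dg q ≠ N + 1)
        set e := kap a b * (k * dg q : ℕ) - kap a b * ((N + 1 : ℕ) : ℝ) with he
        refine ⟨MvPolynomial.C e⁻¹ * q ^ k, ?_, _, (hq.pow k).smul e⁻¹, ?_⟩
        · rw [← MvPolynomial.smul_eq_C_mul]
          exact Submodule.smul_mem _ _ (Submodule.subset_span ⟨k, hk, rfl⟩)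
        · have h4 : MvPolynomial.C (σ := Fin (n + 1)) e⁻¹ * MvPolynomial.C e = 1 := by
            rw [← map_mul, inv_mul_cancel₀ hne, map_one]
          have h5 : MvPolynomial.C (σ := Fin (n + 1)) e =
              MvPolynomial.C (k * (kap a b * dg q)) -
                MvPolynomial.C (kap a b * ((N + 1 : ℕ) : ℝ)) := by
            rw [← map_sub, he]
            congr 1
            push_cast
            ring
          rw [h5] at h4
          linear_combination (q ^ k) * h4
      | zero => exact ⟨0, Submodule.zero_mem _, 0, by simpa using VRel.const (a := a) (b := b) 0,
          by simp⟩
      | add x y _ _ hx hy =>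
        obtain ⟨G, hG, G1, r1, e1⟩ := hx
        obtain ⟨G', hG', G1', r1', e1'⟩ := hy
        exact ⟨G + G', Submodule.add_mem _ hG hG', G1 + G1', r1.add r1', by
          rw [← e1, ← e1']; ring⟩
      | smul c x _ hx =>
        obtain ⟨G, hG, G1, r1, e1⟩ := hx
        refine ⟨MvPolynomial.C c * G, ?_, _, r1.smul c, ?_⟩
        · rw [← MvPolynomial.smul_eq_C_mul]
          exact Submodule.smul_mem _ _ hG
        · rw [← e1, MvPolynomial.smul_eq_C_mul]; ring
    obtain ⟨G, hG, G1, r1, e1⟩ := solve _ hR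
    have hE : VRel a b (Q - G) (MvPolynomial.C (kap a b * ((N + 1 : ℕ) : ℝ)) * (Q - G)) := by
      convert h.sub r1 using 1
      linear_combination e1
    obtain ⟨k, c, ⟨h6, h7⟩ | h7⟩ := caseB_eig ha hb q hdq hq hmin _ _ hE
    · have : Q = G + MvPolynomial.C c * q ^ k := by rw [← h7]; ring
      rw [this, ← MvPolynomial.smul_eq_C_mul]
      exact Submodule.add_mem _ (hmono hG)
        (Submodule.smul_mem _ _ (Submodule.subset_span ⟨k, by omega, rfl⟩))
    · rw [sub_eq_zero.1 h7]
      exact hmono hG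

lemma alg_core (ha : ∀ i, a i ≠ 0) (hb : ∀ i, b i ≠ 0) (hn : 1 ≤ n)
    (hab : ∀ i, IsCoprime (a i) (b i)) (P P1 : MvPolynomial (Fin (n + 1)) ℝ)
    (hP : VRel a b P P1) (hdP : 0 < dg P) :
    (∃ (q : MvPolynomial (Fin (n + 1)) ℝ) (F : Polynomial ℝ), VRel a b q 1 ∧
      P = Polynomial.aeval q F) ∨
    (∃ (q : MvPolynomial (Fin (n + 1)) ℝ) (F : Polynomial ℝ) (l : ℝ), q ≠ 0 ∧ l ≠ 0 ∧
      VRel a b q (MvPolynomial.C l * q) ∧ P = Polynomial.aeval q F) := by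
  obtain ⟨-, hd, -⟩ := hP.deg ha hb hdP
  have hle := hP.deg_le hn ha
  rcases Nat.lt_or_ge (a 0).natDegree (b 0).natDegree with hlt | hge
  · right
    have hdeg : (b 0).natDegree = (a 0).natDegree + 1 := by omega
    obtain ⟨q, hdq, hq, hmin⟩ := caseB_exists ha hb hn hab hdeg P P1 hP hdP
    have hspan := caseB_poly ha hb hn hab hdeg q hdq hq hmin _ P P1 hP le_rfl
    have hsp : ∀ R ∈ Submodule.span ℝ {s | ∃ k : ℕ, k * dg q ≤ dg P ∧ s = q ^ k},
        ∃ F : Polynomial ℝ, R = Polynomial.aeval q F := by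
      intro R hR
      induction hR using Submodule.span_induction with
      | mem s hs =>
        obtain ⟨k, hk, rfl⟩ := hs
        exact ⟨X ^ k, by simp⟩
      | zero => exact ⟨0, by simp⟩
      | add x y _ _ hx hy =>
        obtain ⟨F, rfl⟩ := hx
        obtain ⟨G, rfl⟩ := hy
        exact ⟨F + G, by simp⟩
      | smul c x _ hx =>
        obtain ⟨F, rfl⟩ := hx
        exact ⟨c • F, by simp⟩
    obtain ⟨F, hF⟩ := hsp P hspan
    refine ⟨q, F, _, ?_, ?_, hq, hF⟩
    · rintro rfl; simp [dg] at hdq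
    · exact mul_ne_zero (kap_ne ha hb) (by exact_mod_cast hdq.ne')
  · left
    obtain ⟨q, hq⟩ := caseA_exists ha hb hn hab hge _ P P1 hP hdP le_rfl
    obtain ⟨F, hF⟩ := caseA_poly ha hb hn hab hge q hq _ P P1 hP le_rfl
    exact ⟨q, F, hq, hF⟩
end

end

section

lemma coprime_extract (p q : Polynomial ℝ) (hp : p ≠ 0) :
    ∃ g a b, IsCoprime a b ∧ p = g * a ∧ q = g * b := by
  classical
  obtain ⟨p0, h1⟩ := EuclideanDomain.gcd_dvd_left p q
  obtain ⟨q0, h2⟩ := EuclideanDomain.gcd_dvd_right p q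
  refine ⟨EuclideanDomain.gcd p q, p0, q0, ?_, h1, h2⟩
  have hg : EuclideanDomain.gcd p q ≠ 0 := fun h0 => hp (by rw [h1, h0, zero_mul])
  have hb := EuclideanDomain.gcd_eq_gcd_ab p q
  refine ⟨EuclideanDomain.gcdA p q, EuclideanDomain.gcdB p q, mul_left_cancel₀ hg ?_⟩
  generalize EuclideanDomain.gcd p q = g at *
  generalize EuclideanDomain.gcdA p q = A at *
  generalize EuclideanDomain.gcdB p q = B at *
  rw [mul_one]
  conv_rhs => rw [hb, h1, h2]
  ring

lemma slice_mul {d : ℕ} (P Q : MvPolynomial (Fin d) ℝ) (i : Fin d) (z : Fin d → ℝ) :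
    slice (P * Q) i z = slice P i z * slice Q i z := map_mul _ _ _

lemma slice_uni_self {d : ℕ} (a : Polynomial ℝ) (i : Fin d) (z : Fin d → ℝ) :
    slice (uni i a) i z = a := by
  apply Polynomial.funext
  intro x
  rw [slice_eval, uni_eval, Function.update_self]

lemma slice_C {d : ℕ} (l : ℝ) (i : Fin d) (z : Fin d → ℝ) :
    slice (MvPolynomial.C l) i z = C l := by
  simp [slice, MvPolynomial.algHom_C]

lemma slice_derivative {d : ℕ} (P : MvPolynomial (Fin d) ℝ) (i : Fin d) (z : Fin d → ℝ) :
    derivative (slice P i z) = slice (MvPolynomial.pderiv i P) i z := by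
  have := chain_rule (Polynomial.derivative' (R := ℝ))
    (fun j => if j = i then (X : Polynomial ℝ) else C (z j)) P
  rw [slice, slice]
  change derivative _ = _ at this
  rw [this, Finset.sum_eq_single i]
  · have : Polynomial.derivative' (R := ℝ) (if i = i then (X : Polynomial ℝ) else C (z i)) = 1 := by
      rw [if_pos rfl]; exact derivative_X
    rw [this, mul_one]
  · intro j _ hj
    have : Polynomial.derivative' (R := ℝ) (if j = i then (X : Polynomial ℝ) else C (z j)) = 0 := by
      rw [if_neg hj]; exact derivative_C
    rw [this, mul_zero]
  · simp

lemma eval_aeval_poly {σ : Type*} (z : σ → ℝ) (q : MvPolynomial σ ℝ) (F : Polynomial ℝ) :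
    MvPolynomial.eval z (Polynomial.aeval q F) = F.eval (MvPolynomial.eval z q) := by
  rw [← MvPolynomial.aeval_eq_eval, ← Polynomial.aeval_algHom_apply,
    Polynomial.coe_aeval_eq_eval]

lemma nonconst_of {d : ℕ} (P : MvPolynomial (Fin d) ℝ) (i : Fin d) (h : 1 ≤ P.degreeOf i)
    (f : Polynomial ℝ) (g : (Fin d → ℝ) → ℝ) (hP : ∀ a, MvPolynomial.eval a P = f.eval (g a)) :
    0 < f.natDegree := by
  by_contra hcon
  rw [not_lt, Nat.le_zero] at hcon
  rw [eq_C_of_natDegree_eq_zero hcon] at hP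
  have : P = MvPolynomial.C (f.coeff 0) := by
    apply MvPolynomial.funext
    intro x
    rw [hP, eval_C, MvPolynomial.eval_C]
  rw [this, MvPolynomial.degreeOf_C] at h
  omega

lemma natDegree_pos_of_derivative {u : Polynomial ℝ} (h : derivative u ≠ 0) : 0 < u.natDegree := by
  by_contra hcon
  rw [not_lt, Nat.le_zero] at hcon
  exact h (derivative_of_natDegree_zero hcon)

lemma alg_final {d : ℕ} (hd : 2 ≤ d) (P : MvPolynomial (Fin d) ℝ) (p q : Fin d → Polynomial ℝ)
    (hp : ∀ i, p i ≠ 0) (hq : ∀ i, q i ≠ 0) (hP : ∀ i, 1 ≤ P.degreeOf i)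
    (hcross : ∀ i j, i ≠ j → MvPolynomial.pderiv i P * uni i (q i) * uni j (p j) =
      MvPolynomial.pderiv j P * uni j (q j) * uni i (p i)) :
    (∃ (f : Polynomial ℝ) (u : Fin d → Polynomial ℝ),
              0 < f.natDegree ∧ (∀ i, 0 < (u i).natDegree) ∧
              (∀ a : Fin d → ℝ,
                MvPolynomial.eval a P = f.eval (∑ i, (u i).eval (a i)))) ∨
    (∃ (f : Polynomial ℝ) (u : Fin d → Polynomial ℝ),
              0 < f.natDegree ∧ (∀ i, 0 < (u i).natDegree) ∧
              (∀ a : Fin d → ℝ,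
                MvPolynomial.eval a P = f.eval (∏ i, (u i).eval (a i)))) := by
  classical
  obtain ⟨n, rfl⟩ : ∃ n, d = n + 1 := ⟨d - 1, by omega⟩
  have hnt : Nontrivial (Fin (n + 1)) := Fin.nontrivial_iff_two_le.2 hd
  choose g a b hab hga hgb using fun i => coprime_extract (p i) (q i) (hp i)
  have hg : ∀ i, g i ≠ 0 := fun i h => hp i (by rw [hga, h, zero_mul])
  have ha : ∀ i, a i ≠ 0 := fun i h => hp i (by rw [hga, h, mul_zero])
  have hb : ∀ i, b i ≠ 0 := fun i h => hq i (by rw [hgb, h, mul_zero])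
  have hcross' : ∀ i j, MvPolynomial.pderiv i P * uni i (b i) * uni j (a j) =
      MvPolynomial.pderiv j P * uni j (b j) * uni i (a i) := by
    intro i j
    by_cases hij : i = j
    · subst hij; rfl
    have h := hcross i j hij
    rw [hga i, hga j, hgb i, hgb j, uni_mul, uni_mul, uni_mul, uni_mul] at h
    apply mul_left_cancel₀ (mul_ne_zero (uni_ne_zero i _ (hg i)) (uni_ne_zero j _ (hg j)))
    linear_combination h
  obtain ⟨P1, hP1⟩ := VRel.exists_of_cross ha hab hcross'
  rcases alg_core ha hb (by omega) hab P P1 hP1 (by rw [dg_eq]; exact hP 0) with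
    ⟨Q, F, hQ, hPQ⟩ | ⟨Q, F, l, hQ0, hl, hQ, hPQ⟩
  · left
    have h1 : ∀ i, a i = b i * slice (MvPolynomial.pderiv i Q) i 0 := by
      intro i
      have := congrArg (fun R => slice R i 0) (hQ i)
      simp only [mul_one] at this
      rwa [slice_uni_self, slice_mul, slice_uni_self] at this
    set v := fun i => slice (MvPolynomial.pderiv i Q) i 0 with hv
    have hv0 : ∀ i, v i ≠ 0 := fun i h => ha i (by rw [h1]; change b i * v i = 0; rw [h, mul_zero])
    have h2 : ∀ i, MvPolynomial.pderiv i Q = uni i (v i) := by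
      intro i
      apply mul_left_cancel₀ (uni_ne_zero i _ (hb i))
      rw [← hQ i, ← uni_mul, mul_one, h1 i]
    choose u hu using fun i => exists_antideriv (v i)
    have h3 : ∃ c : ℝ, Q - ∑ j, uni j (u j) = MvPolynomial.C c := by
      apply const_of_pderiv
      intro k
      rw [map_sub, map_sum, Finset.sum_eq_single k, pderiv_uni_self, hu, h2, sub_self]
      · intro j _ hj
        exact pderiv_uni_ne _ _ hj.symm _
      · simp
    obtain ⟨c, hc⟩ := h3
    have key : ∀ z : Fin (n + 1) → ℝ, MvPolynomial.eval z P =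
        (F.comp (X + C c)).eval (∑ i, (u i).eval (z i)) := by
      intro z
      rw [hPQ, eval_aeval_poly, sub_eq_iff_eq_add.1 hc, eval_comp]
      congr 1
      simp only [map_add, map_sum, uni_eval, MvPolynomial.eval_C, eval_add, eval_X, eval_C]
      ring
    exact ⟨_, u, nonconst_of P 0 (hP 0) _ _ key,
      fun i => natDegree_pos_of_derivative (by rw [hu]; exact hv0 i), key⟩
  · right
    obtain ⟨c, hc⟩ : ∃ c, MvPolynomial.eval c Q ≠ 0 := by
      by_contra hcon
      push Not at hcon
      exact hQ0 (MvPolynomial.funext (by simpa using hcon))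
    set u := fun i => slice Q i c with hu
    have hu0 : ∀ i, u i ≠ 0 := by
      intro i h
      apply hc
      have := slice_eval Q i c (c i)
      rw [Function.update_eq_self] at this
      rw [← this]
      change (u i).eval _ = 0
      rw [h, eval_zero]
    have h1 : ∀ i, a i * (C l * u i) = b i * derivative (u i) := by
      intro i
      have := congrArg (fun R => slice R i c) (hQ i)
      simpa only [slice_mul, slice_uni_self, slice_C, ← slice_derivative] using this
    have hud : ∀ i, derivative (u i) ≠ 0 := by
      intro i h
      have := h1 i
      rw [h, mul_zero] at this
      exact mul_ne_zero (ha i) (mul_ne_zero (by rwa [Ne, C_eq_zero]) (hu0 i)) this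
    have hW : VRel a b (∏ j, uni j (u j)) (MvPolynomial.C l * ∏ j, uni j (u j)) := by
      intro i
      rw [← Finset.mul_prod_erase _ _ (Finset.mem_univ i), Derivation.leibniz, smul_eq_mul,
        smul_eq_mul, pderiv_uni_self]
      have h0 : MvPolynomial.pderiv i (∏ j ∈ Finset.univ.erase i, uni j (u j)) = 0 := by
        have aux : ∀ s : Finset (Fin (n + 1)), i ∉ s →
            MvPolynomial.pderiv i (∏ j ∈ s, uni j (u j)) = 0 := by
          intro s
          induction s using Finset.induction_on with
          | empty => intro _; simp
          | insert x s hx ih =>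
            intro hi
            rw [Finset.mem_insert, not_or] at hi
            rw [Finset.prod_insert hx, Derivation.leibniz, ih hi.2, pderiv_uni_ne _ _ hi.1,
              smul_zero, smul_zero, add_zero]
        exact aux _ (Finset.notMem_erase i _)
      have h2 := congrArg (uni i) (h1 i)
      rw [uni_mul, uni_mul, uni_mul, uni_C] at h2
      rw [h0]
      linear_combination (∏ j ∈ Finset.univ.erase i, uni j (u j)) * h2
    obtain ⟨m, hm⟩ := VRel.prop hb hQ hW
      (Finset.prod_ne_zero_iff.2 (fun i _ => uni_ne_zero i _ (hu0 i)))
    have key : ∀ z : Fin (n + 1) → ℝ, MvPolynomial.eval z P =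
        (F.comp (C m * X)).eval (∏ i, (u i).eval (z i)) := by
      intro z
      rw [hPQ, eval_aeval_poly, hm, eval_comp]
      congr 1
      simp only [map_mul, map_prod, uni_eval, MvPolynomial.eval_C, eval_mul, eval_X, eval_C]
    exact ⟨_, u, nonconst_of P 0 (hP 0) _ _ key,
      fun i => natDegree_pos_of_derivative (hud i), key⟩

end

section

lemma totalDegree_pderiv_le {σ : Type*} (Q : MvPolynomial σ ℝ) (j : σ) :
    (MvPolynomial.pderiv j Q).totalDegree ≤ Q.totalDegree - 1 := by
  classical
  refine Finset.sup_le (fun m hm => ?_)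
  have h1 := MvPolynomial.mem_support_iff.1 hm
  rw [MvPolynomial.coeff_pderiv] at h1
  have h2 : m + Finsupp.single j 1 ∈ Q.support := by
    rw [MvPolynomial.mem_support_iff]
    intro h
    rw [h, zero_mul] at h1
    exact h1 rfl
  have h3 := MvPolynomial.le_totalDegree h2
  rw [Finsupp.sum_add_index' (by simp) (by simp)] at h3
  simp only [Finsupp.sum_single_index] at h3
  omega

lemma alg_indep {m : ℕ} (g : Fin m → MvPolynomial (Fin m) ℝ)
    (hdet : (Matrix.of fun i j => MvPolynomial.pderiv i (g j)).det ≠ 0) (N : ℕ) :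
    ∀ Q : MvPolynomial (Fin m) ℝ, Q.totalDegree ≤ N → MvPolynomial.aeval g Q = 0 → Q = 0 := by
  have hC : ∀ c : ℝ, MvPolynomial.aeval g (MvPolynomial.C c : MvPolynomial (Fin m) ℝ) = 0 →
      (MvPolynomial.C c : MvPolynomial (Fin m) ℝ) = 0 := by
    intro c h
    rw [MvPolynomial.aeval_C, MvPolynomial.algebraMap_eq] at h
    exact h
  induction N with
  | zero =>
    intro Q hQ h
    rw [MvPolynomial.totalDegree_eq_zero_iff_eq_C.1 (Nat.le_zero.1 hQ)] at h ⊢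
    exact hC _ h
  | succ N ih =>
    intro Q hQ h
    have h1 : (fun j => MvPolynomial.aeval g (MvPolynomial.pderiv j Q)) = 0 := by
      apply Matrix.eq_zero_of_mulVec_eq_zero hdet
      ext1 i
      have := chain_rule (MvPolynomial.pderiv i) g Q
      rw [h, map_zero] at this
      simp only [Matrix.mulVec, dotProduct, Matrix.of_apply, Pi.zero_apply]
      rw [this]
      exact Finset.sum_congr rfl (fun j _ => mul_comm _ _)
    obtain ⟨c, rfl⟩ := const_of_pderiv Q (fun k => ih _ (by
      have := totalDegree_pderiv_le Q k
      omega) (congrFun h1 k))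
    exact hC _ h

lemma exists_rel {m δ : ℕ} (g : Fin m → MvPolynomial (Fin m) ℝ)
    (hg : ∀ j, (g j).totalDegree ≤ δ) (k : Fin m) (N : ℕ) (hN : (1 + m * δ) ^ m < N) :
    ∃ c : Fin N × (Fin m → Fin N) → ℝ, (∃ e, c e ≠ 0) ∧
      ∑ e, c e • (MvPolynomial.X k ^ (e.1 : ℕ) * ∏ j, g j ^ (e.2 j : ℕ)) = 0 := by
  classical
  set mono : Fin N × (Fin m → Fin N) → MvPolynomial (Fin m) ℝ :=
    fun e => MvPolynomial.X k ^ (e.1 : ℕ) * ∏ j, g j ^ (e.2 j : ℕ) with hmono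
  have hdeg : ∀ e, (mono e).totalDegree < N * (1 + m * δ) := by
    intro e
    have h1 : (MvPolynomial.X k ^ (e.1 : ℕ) : MvPolynomial (Fin m) ℝ).totalDegree ≤ N - 1 := by
      rw [MvPolynomial.totalDegree_X_pow]; have := e.1.2; omega
    have h2 : (∏ j, g j ^ (e.2 j : ℕ)).totalDegree ≤ m * ((N - 1) * δ) := by
      refine (MvPolynomial.totalDegree_finsetProd _ _).trans ?_
      have : ∀ j ∈ (Finset.univ : Finset (Fin m)),
          (g j ^ (e.2 j : ℕ)).totalDegree ≤ (N - 1) * δ := by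
        intro j _
        refine (MvPolynomial.totalDegree_pow _ _).trans ?_
        exact Nat.mul_le_mul (by have := (e.2 j).2; omega) (hg j)
      simpa using Finset.sum_le_card_nsmul _ _ _ this
    have h3 : (mono e).totalDegree ≤ (N - 1) + m * ((N - 1) * δ) :=
      (MvPolynomial.totalDegree_mul _ _).trans (Nat.add_le_add h1 h2)
    have h4 : (N - 1) + m * ((N - 1) * δ) = (N - 1) * (1 + m * δ) := by ring
    rw [h4] at h3
    refine h3.trans_lt (Nat.mul_lt_mul_of_pos_right (by omega) (by positivity))
  set B := N * (1 + m * δ) with hB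
  have hnl : ¬ LinearIndependent ℝ (fun e => fun μ : Fin m → Fin B =>
      MvPolynomial.coeff (Finsupp.equivFunOnFinite.symm fun j => (μ j : ℕ)) (mono e)) := by
    intro h
    have h1 := h.fintype_card_le_finrank
    rw [Module.finrank_fintype_fun_eq_card, Fintype.card_prod, Fintype.card_fun,
      Fintype.card_fun, Fintype.card_fin, Fintype.card_fin, Fintype.card_fin, hB, mul_pow,
      mul_comm N] at h1
    have hpos : 0 < N ^ m := Nat.pow_pos (by omega)
    have := Nat.le_of_mul_le_mul_left h1 hpos
    omega
  obtain ⟨c, hc, e, he⟩ := Fintype.not_linearIndependent_iff.1 hnl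
  refine ⟨c, ⟨e, he⟩, ?_⟩
  ext μ
  rw [MvPolynomial.coeff_zero, MvPolynomial.coeff_sum]
  by_cases hμ : ∀ j, μ j < B
  · have := congrFun hc (fun j => ⟨μ j, hμ j⟩)
    rw [Finset.sum_apply, Pi.zero_apply] at this
    rw [← this]
    refine Finset.sum_congr rfl (fun e _ => ?_)
    rw [MvPolynomial.coeff_smul, Pi.smul_apply]
    congr 2
    ext j; simp
  · push Not at hμ
    obtain ⟨j, hj⟩ := hμ
    refine Finset.sum_eq_zero (fun e _ => ?_)
    rw [MvPolynomial.coeff_smul, MvPolynomial.coeff_eq_zero_of_totalDegree_lt, smul_zero]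
    refine (hdeg e).trans_le (hj.trans ?_)
    by_cases h0 : μ j = 0
    · rw [h0]; exact Nat.zero_le _
    · exact Finset.single_le_sum (f := fun j => μ j) (fun _ _ => Nat.zero_le _)
        (Finsupp.mem_support_iff.2 h0)

lemma fib_one {m δ : ℕ} (g : Fin m → MvPolynomial (Fin m) ℝ)
    (hg : ∀ j, (g j).totalDegree ≤ δ)
    (hdet : (Matrix.of fun i j => MvPolynomial.pderiv i (g j)).det ≠ 0)
    (k : Fin m) (N : ℕ) (hN : (1 + m * δ) ^ m < N) :
    ∃ H : MvPolynomial (Fin m) ℝ, H ≠ 0 ∧ H.totalDegree ≤ m * (N * δ) ∧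
      ∀ s : Fin m → ℝ, ∃ Z : Finset ℝ, Z.card ≤ N ∧
        ∀ z, MvPolynomial.eval z H ≠ 0 → (∀ j, MvPolynomial.eval z (g j) = s j) → z k ∈ Z := by
  classical
  obtain ⟨c, ⟨⟨l, e0⟩, he⟩, hc⟩ := exists_rel g hg k N hN
  set Cf : Fin N → MvPolynomial (Fin m) ℝ := fun l => ∑ e' : Fin m → Fin N,
    MvPolynomial.monomial (Finsupp.equivFunOnFinite.symm fun j => (e' j : ℕ)) (c (l, e')) with hCf
  have hCl : Cf l ≠ 0 := by
    intro h0
    have := congrArg (MvPolynomial.coeff (Finsupp.equivFunOnFinite.symm fun j => (e0 j : ℕ))) h0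
    rw [hCf] at this
    simp only [MvPolynomial.coeff_sum, MvPolynomial.coeff_monomial, MvPolynomial.coeff_zero] at this
    rw [Finset.sum_eq_single e0] at this
    · rw [if_pos rfl] at this; exact he this
    · intro b _ hb
      rw [if_neg]
      intro h
      apply hb
      have := Finsupp.equivFunOnFinite.symm.injective h
      ext j
      exact congrFun this j
    · simp
  have hae : ∀ l, MvPolynomial.aeval g (Cf l) =
      ∑ e' : Fin m → Fin N, c (l, e') • ∏ j, g j ^ (e' j : ℕ) := by
    intro l
    simp only [hCf, map_sum, MvPolynomial.aeval_monomial, MvPolynomial.algebraMap_eq,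
      MvPolynomial.smul_eq_C_mul]
    refine Finset.sum_congr rfl (fun e' _ => ?_)
    rw [Finsupp.prod_fintype _ _ (by simp)]
    rfl
  refine ⟨MvPolynomial.aeval g (Cf l), fun h => hCl (alg_indep g hdet _ _ le_rfl h), ?_, ?_⟩
  · rw [hae]
    refine MvPolynomial.totalDegree_finsetSum_le (fun e' _ => ?_)
    refine (MvPolynomial.totalDegree_smul_le _ _).trans ?_
    refine (MvPolynomial.totalDegree_finsetProd _ _).trans ?_
    have : ∀ j ∈ (Finset.univ : Finset (Fin m)),
        (g j ^ (e' j : ℕ)).totalDegree ≤ N * δ := by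
      intro j _
      refine (MvPolynomial.totalDegree_pow _ _).trans ?_
      exact Nat.mul_le_mul (by have := (e' j).2; omega) (hg j)
    simpa using Finset.sum_le_card_nsmul _ _ _ this
  · intro s
    set R : Polynomial ℝ := ∑ l : Fin N, C (MvPolynomial.eval s (Cf l)) * X ^ (l : ℕ) with hR
    refine ⟨R.roots.toFinset, ?_, ?_⟩
    · refine (Multiset.toFinset_card_le _).trans ((card_roots' _).trans ?_)
      refine natDegree_sum_le_of_forall_le _ _ (fun l _ => ?_)
      exact (natDegree_C_mul_X_pow_le _ _).trans l.2.le
    · intro z hz hs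
      have hev : ∀ l, MvPolynomial.eval z (MvPolynomial.aeval g (Cf l)) =
          MvPolynomial.eval s (Cf l) := by
        intro l
        have : MvPolynomial.eval z (MvPolynomial.aeval g (Cf l)) =
            MvPolynomial.eval (fun j => MvPolynomial.eval z (g j)) (Cf l) := by
          rw [MvPolynomial.aeval_def, MvPolynomial.hom_eval₂, MvPolynomial.eval,
            MvPolynomial.eval, MvPolynomial.coe_eval₂Hom, MvPolynomial.coe_eval₂Hom]
          congr 1
          ext x; simp
        rw [this]
        congr 2
        ext j; exact hs j
      rw [hev] at hz
      rw [Multiset.mem_toFinset, mem_roots']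
      constructor
      · intro h0
        apply hz
        have := congrArg (fun p => coeff p (l : ℕ)) h0
        simp only [hR, finset_sum_coeff, coeff_C_mul, coeff_X_pow, coeff_zero] at this
        rw [Finset.sum_eq_single l] at this
        · simpa using this
        · intro b _ hb
          rw [if_neg (fun h => hb (Fin.ext h.symm)), mul_zero]
        · simp
      · rw [IsRoot.def, hR, eval_finset_sum]
        have := congrArg (MvPolynomial.eval z) hc
        rw [Fintype.sum_prod_type, map_sum, map_zero] at this
        rw [← this]
        refine Finset.sum_congr rfl (fun l _ => ?_)
        rw [← hev, hae, eval_mul, eval_C, eval_pow, eval_X, map_sum, map_sum, Finset.sum_mul]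
        refine Finset.sum_congr rfl (fun e' _ => ?_)
        simp only [MvPolynomial.smul_eval, map_mul, map_pow, MvPolynomial.eval_X]
        ring

lemma fib (m δ : ℕ) : ∃ M D : ℕ, ∀ g : Fin m → MvPolynomial (Fin m) ℝ,
    (∀ j, (g j).totalDegree ≤ δ) →
    (Matrix.of fun i j => MvPolynomial.pderiv i (g j)).det ≠ 0 →
    ∃ H : MvPolynomial (Fin m) ℝ, H ≠ 0 ∧ H.totalDegree ≤ D ∧
      ∀ s : Fin m → ℝ, ∃ Z : Finset (Fin m → ℝ), Z.card ≤ M ∧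
        ∀ z, MvPolynomial.eval z H ≠ 0 → (∀ j, MvPolynomial.eval z (g j) = s j) → z ∈ Z := by
  classical
  set N := (1 + m * δ) ^ m + 1 with hN
  refine ⟨N ^ m, m * (m * (N * δ)), fun g hg hdet => ?_⟩
  choose H hH0 hHd hH using fun k => fib_one g hg hdet k N (Nat.lt_succ_self _)
  refine ⟨∏ k, H k, Finset.prod_ne_zero_iff.2 (fun k _ => hH0 k), ?_, ?_⟩
  · refine (MvPolynomial.totalDegree_finsetProd _ _).trans ?_
    simpa using Finset.sum_le_card_nsmul Finset.univ _ _ (fun k _ => hHd k)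
  · intro s
    choose Z hZc hZ using fun k => hH k s
    refine ⟨Fintype.piFinset Z, ?_, ?_⟩
    · rw [Fintype.card_piFinset]
      refine (Finset.prod_le_pow_card _ _ _ (fun k _ => hZc k)).trans ?_
      simp
    · intro z hz hs
      rw [map_prod, Finset.prod_ne_zero_iff] at hz
      rw [Fintype.mem_piFinset]
      exact fun k => hZ k z (hz k (Finset.mem_univ k)) hs

end

section

lemma sz_nat {m : ℕ} (p : MvPolynomial (Fin (m + 1)) ℝ) (hp : p ≠ 0) (A : Finset ℝ)
    (hA : 0 < A.card) :
    ((Fintype.piFinset fun _ => A).filter fun v => MvPolynomial.eval v p = 0).card ≤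
      p.totalDegree * A.card ^ m := by
  classical
  have h := MvPolynomial.schwartz_zippel_totalDegree hp A
  have hA' : (0 : ℚ≥0) < A.card := by exact_mod_cast hA
  rw [div_le_div_iff₀ (by positivity) hA', pow_succ, ← mul_assoc] at h
  have := le_of_mul_le_mul_right h hA'
  exact_mod_cast this

lemma poly_fib (g : Polynomial ℝ) (D : ℕ) (hg : 0 < g.natDegree) (hD : g.natDegree ≤ D) (s : ℝ) :
    ∃ Z : Finset ℝ, Z.card ≤ D ∧ ∀ x ∈ (Set.univ : Set ℝ), g.eval x = s → x ∈ Z := by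
  classical
  have hne : g - C s ≠ 0 := by
    intro h
    rw [sub_eq_zero.1 h, natDegree_C] at hg
    omega
  refine ⟨(g - C s).roots.toFinset, ?_, ?_⟩
  · refine (Multiset.toFinset_card_le _).trans ((card_roots' _).trans ?_)
    rwa [natDegree_sub_C]
  · intro x _ hx
    rw [Multiset.mem_toFinset, mem_roots']
    exact ⟨hne, by simp [hx]⟩

lemma gap_bad (D K n : ℕ) (hD : 1 ≤ D) (A : Finset ℝ) (hn : A.card = n)
    (a : ℕ → ℝ) (ha : ∀ i j, i < j → j < n → a i < a j) (G : ℝ → ℝ → Polynomial ℝ)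
    (hGd : ∀ y w, (G y w).natDegree ≤ D) (S : Finset ℝ) (hS : 0 < S.card) (L : ℕ)
    (hL : 16 * (D * (K + 1)) * S.card < (L + 1) * n) :
    16 * (((Finset.range (n - K) ×ˢ Finset.range K ×ˢ A ×ˢ A).filter
      fun ω : ℕ × ℕ × ℝ × ℝ => 0 < (G ω.2.2.1 ω.2.2.2).natDegree ∧
        ¬ gap S ((G ω.2.2.1 ω.2.2.2).eval (a ω.1))
          ((G ω.2.2.1 ω.2.2.2).eval (a (ω.1 + (ω.2.1 + 1)))) ≤ L).card) ≤ K * n ^ 3 := by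
  classical
  set B := (Finset.range (n - K) ×ˢ Finset.range K ×ˢ A ×ˢ A).filter
      fun ω : ℕ × ℕ × ℝ × ℝ => 0 < (G ω.2.2.1 ω.2.2.2).natDegree ∧
        ¬ gap S ((G ω.2.2.1 ω.2.2.2).eval (a ω.1))
          ((G ω.2.2.1 ω.2.2.2).eval (a (ω.1 + (ω.2.1 + 1)))) ≤ L with hB
  have h1 : B.card ≤ (n / 16) * (Finset.range K ×ˢ A ×ˢ A).card := by
    refine Finset.card_le_mul_card_image_of_maps_to (f := fun ω => ω.2) ?_ _ ?_
    · intro ω hω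
      exact (Finset.mem_product.1 (Finset.mem_filter.1 hω).1).2
    · rintro ⟨r, y, w⟩ hr
      have hrK : r < K := Finset.mem_range.1 (Finset.mem_product.1 hr).1
      by_cases hpos : 0 < (G y w).natDegree
      · have h2 := squeeze n (r + 1) D a ha Set.univ Set.ordConnected_univ (fun _ _ => trivial)
          (fun x => (G y w).eval x) ((G y w).continuous.continuousOn)
          (poly_fib _ D hpos (hGd y w)) S L
        set F := (Finset.range (n - (r + 1))).filter fun i =>
          ¬ gap S ((G y w).eval (a i)) ((G y w).eval (a (i + (r + 1)))) ≤ L with hF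
        have h3 : (B.filter fun ω => ω.2 = (r, y, w)).card ≤ F.card := by
          refine Finset.card_le_card_of_injOn (fun ω => ω.1) ?_ ?_
          · rintro ⟨i, ω⟩ hω
            obtain ⟨h4, h5⟩ := Finset.mem_filter.1 hω
            simp only at h5
            subst h5
            obtain ⟨h6, h7⟩ := Finset.mem_filter.1 h4
            have h8 := Finset.mem_range.1 (Finset.mem_product.1 h6).1
            simp only at h7 h8
            refine Finset.mem_filter.2 ⟨Finset.mem_range.2 (by simp only; omega), h7.2⟩
          · rintro ⟨i, ω⟩ hω ⟨i', ω'⟩ hω' hii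
            have e1 := (Finset.mem_filter.1 hω).2
            have e2 := (Finset.mem_filter.1 hω').2
            simp only at e1 e2 hii
            rw [e1, e2, hii]
        have h4 : F.card * (L + 1) ≤ S.card * (D * (K + 1)) :=
          h2.trans (Nat.mul_le_mul_left _ (Nat.mul_le_mul_left _ (by omega)))
        have h5 : 16 * F.card ≤ n := by
          by_contra hcon
          push Not at hcon
          have e1 : n * (F.card * (L + 1)) ≤ n * (S.card * (D * (K + 1))) :=
            Nat.mul_le_mul_left _ h4
          have e2 : F.card * (16 * (D * (K + 1)) * S.card) ≤ F.card * ((L + 1) * n) :=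
            Nat.mul_le_mul_left _ hL.le
          have e3 : n * (S.card * (D * (K + 1))) < 16 * F.card * (S.card * (D * (K + 1))) :=
            Nat.mul_lt_mul_of_pos_right hcon (by positivity)
          nlinarith
        omega
      · have : (B.filter fun ω => ω.2 = (r, y, w)) = ∅ := by
          refine Finset.filter_eq_empty_iff.2 ?_
          rintro ⟨i, ω⟩ hω h
          simp only at h
          subst h
          exact hpos (Finset.mem_filter.1 hω).2.1
        rw [this]; simp
  rw [Finset.card_product, Finset.card_product, Finset.card_range, hn] at h1
  have h2 : 16 * (n / 16) ≤ n := Nat.mul_div_le n 16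
  calc 16 * B.card ≤ 16 * (n / 16 * (K * (n * n))) := Nat.mul_le_mul_left _ h1
    _ = (16 * (n / 16)) * (K * (n * n)) := by ring
    _ ≤ n * (K * (n * n)) := Nat.mul_le_mul_right _ h2
    _ = K * n ^ 3 := by ring

lemma hbad (D K n : ℕ) (A : Finset ℝ) (hn : A.card = n) (hn0 : 0 < n)
    (a : ℕ → ℝ) (haA : ∀ i < n, a i ∈ A) (ha : ∀ i j, i < j → j < n → a i < a j)
    (H : MvPolynomial (Fin 4) ℝ) (hH : H ≠ 0) (hHd : H.totalDegree ≤ D) :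
    ((Finset.range (n - K) ×ˢ Finset.range K ×ˢ A ×ˢ A).filter
      fun ω : ℕ × ℕ × ℝ × ℝ => MvPolynomial.eval
        (Fin.cons (a (ω.1 + (ω.2.1 + 1))) ![a ω.1, ω.2.2.1, ω.2.2.2]) H = 0).card ≤
      D * n ^ 3 + K * (D * n ^ 2) := by
  classical
  set Hp := MvPolynomial.finSuccEquiv ℝ 3 H with hHp
  have hHp0 : Hp ≠ 0 := fun h0 =>
    hH ((MvPolynomial.finSuccEquiv ℝ 3).injective (by rw [← hHp, h0, map_zero]))
  set l := Hp.leadingCoeff with hl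
  have hl0 : l ≠ 0 := leadingCoeff_ne_zero.2 hHp0
  have hdeg := MvPolynomial.totalDegree_coeff_finSuccEquiv_add_le H Hp.natDegree hl0
  have hld : l.totalDegree ≤ D := by
    have : l.totalDegree + Hp.natDegree ≤ H.totalDegree := hdeg
    omega
  have hHpd : Hp.natDegree ≤ D := by
    have : l.totalDegree + Hp.natDegree ≤ H.totalDegree := hdeg
    omega
  have hinj : ∀ i j, i < n → j < n → a i = a j → i = j := by
    intro i j hi hj h
    rcases lt_trichotomy i j with h1 | h1 | h1
    · exact absurd h (ha i j h1 hj).ne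
    · exact h1
    · exact absurd h (ha j i h1 hi).ne'
  set Ω := Finset.range (n - K) ×ˢ Finset.range K ×ˢ A ×ˢ A with hΩ
  set v : ℕ × ℕ × ℝ × ℝ → Fin 3 → ℝ := fun ω => ![a ω.1, ω.2.2.1, ω.2.2.2] with hv
  have hvA : ∀ ω ∈ Ω, v ω ∈ Fintype.piFinset fun _ : Fin 3 => A := by
    rintro ⟨i, r, y, w⟩ hω
    simp only [hΩ, Finset.mem_product, Finset.mem_range] at hω
    rw [Fintype.mem_piFinset]
    intro j
    fin_cases j
    · exact haA i (by omega)
    · exact hω.2.2.1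
    · exact hω.2.2.2
  set B1 := Ω.filter fun ω => MvPolynomial.eval (v ω) l = 0 with hB1
  set B2 := Ω.filter fun ω => MvPolynomial.eval (v ω) l ≠ 0 ∧ MvPolynomial.eval
        (Fin.cons (a (ω.1 + (ω.2.1 + 1))) (v ω)) H = 0 with hB2
  have c1 : B1.card ≤ K * (D * n ^ 2) := by
    have h1 : B1.card ≤ K * ((Fintype.piFinset fun _ : Fin 3 => A).filter
        fun v => MvPolynomial.eval v l = 0).card := by
      refine Finset.card_le_mul_card_image_of_maps_to (f := v) ?_ _ ?_
      · intro ω hω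
        obtain ⟨h2, h3⟩ := Finset.mem_filter.1 hω
        exact Finset.mem_filter.2 ⟨hvA ω h2, h3⟩
      · intro b _
        rw [← Finset.card_range K]
        refine Finset.card_le_card_of_injOn (fun ω => ω.2.1) ?_ ?_
        · rintro ⟨i, r, y, w⟩ hω
          have := (Finset.mem_filter.1 (Finset.mem_filter.1 hω).1).1
          simp only [hΩ, Finset.mem_product] at this
          exact this.2.1
        · rintro ⟨i, r, y, w⟩ hω ⟨i', r', y', w'⟩ hω' hr
          have e1 := (Finset.mem_filter.1 (Finset.mem_filter.1 hω).1).1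
          have e2 := (Finset.mem_filter.1 (Finset.mem_filter.1 hω').1).1
          have e3 := (Finset.mem_filter.1 hω).2
          rw [← (Finset.mem_filter.1 hω').2] at e3
          simp only [hΩ, Finset.mem_product, Finset.mem_range] at e1 e2 hr
          have f0 := congrFun e3 0
          have f1 := congrFun e3 1
          have f2 := congrFun e3 2
          simp [hv] at f0 f1 f2
          have := hinj i i' (by omega) (by omega) f0
          rw [this, hr, f1, f2]
    refine h1.trans (Nat.mul_le_mul_left _ ?_)
    refine (sz_nat l hl0 A (by omega)).trans ?_
    rw [hn]
    exact Nat.mul_le_mul_right _ hld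
  have c2 : B2.card ≤ D * n ^ 3 := by
    have h1 : B2.card ≤ D * (Fintype.piFinset fun _ : Fin 3 => A).card := by
      refine Finset.card_le_mul_card_image_of_maps_to (f := v) ?_ _ ?_
      · intro ω hω
        exact hvA ω (Finset.mem_filter.1 hω).1
      · intro b _
        set q := Hp.map (MvPolynomial.eval b) with hq
        have hqc : q.roots.toFinset.card ≤ D :=
          (Multiset.toFinset_card_le _).trans ((card_roots' _).trans
            ((natDegree_map_le).trans hHpd))
        refine le_trans ?_ hqc
        refine Finset.card_le_card_of_injOn (fun ω => a (ω.1 + (ω.2.1 + 1))) ?_ ?_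
        · intro ω hω
          obtain ⟨h2, h3⟩ := Finset.mem_filter.1 hω
          obtain ⟨h4, h5, h6⟩ := Finset.mem_filter.1 h2
          rw [h3] at h5 h6
          rw [Finset.mem_coe, Multiset.mem_toFinset, mem_roots']
          constructor
          · intro h0
            apply h5
            have := congrArg (fun p => coeff p Hp.natDegree) h0
            simpa [hq, coeff_map] using this
          · rw [IsRoot.def, hq, hHp, ← MvPolynomial.eval_eq_eval_mv_eval']
            exact h6
        · rintro ⟨i, r, y, w⟩ hω ⟨i', r', y', w'⟩ hω' hr
          have e1 := (Finset.mem_filter.1 (Finset.mem_filter.1 hω).1).1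
          have e2 := (Finset.mem_filter.1 (Finset.mem_filter.1 hω').1).1
          have e3 := (Finset.mem_filter.1 hω).2
          rw [← (Finset.mem_filter.1 hω').2] at e3
          simp only [hΩ, Finset.mem_product, Finset.mem_range] at e1 e2 hr
          have f0 := congrFun e3 0
          have f1 := congrFun e3 1
          have f2 := congrFun e3 2
          simp [hv] at f0 f1 f2
          have := hinj i i' (by omega) (by omega) f0
          have := hinj _ _ (by omega) (by omega) hr
          have : r = r' := by omega
          subst this
          rw [hinj i i' (by omega) (by omega) f0, f1, f2]
    rw [Fintype.card_piFinset] at h1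
    simpa [hn] using h1
  have hsub : (Ω.filter fun ω : ℕ × ℕ × ℝ × ℝ => MvPolynomial.eval
        (Fin.cons (a (ω.1 + (ω.2.1 + 1))) ![a ω.1, ω.2.2.1, ω.2.2.2]) H = 0) ⊆ B2 ∪ B1 := by
    intro ω hω
    obtain ⟨h1, h2⟩ := Finset.mem_filter.1 hω
    by_cases h3 : MvPolynomial.eval (v ω) l = 0
    · exact Finset.mem_union_right _ (Finset.mem_filter.2 ⟨h1, h3⟩)
    · exact Finset.mem_union_left _ (Finset.mem_filter.2 ⟨h1, h3, h2⟩)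
  exact (Finset.card_le_card hsub).trans ((Finset.card_union_le _ _).trans (Nat.add_le_add c2 c1))

lemma counting (D : ℕ) (hD : 1 ≤ D) (A : Finset ℝ) (n : ℕ) (hn : A.card = n) (hA : 16 * D ≤ n)
    (H : MvPolynomial (Fin 4) ℝ) (hH : H ≠ 0) (hHd : H.totalDegree ≤ D)
    (G1 G2 : ℝ → ℝ → Polynomial ℝ)
    (hG1d : ∀ y w, (G1 y w).natDegree ≤ D) (hG2d : ∀ y w, (G2 y w).natDegree ≤ D)
    (hG1 : ∀ z, MvPolynomial.eval z H ≠ 0 → 0 < (G1 (z 2) (z 3)).natDegree)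
    (hG2 : ∀ z, MvPolynomial.eval z H ≠ 0 → 0 < (G2 (z 2) (z 3)).natDegree)
    (S : Finset ℝ) (hS : 0 < S.card) (L : ℕ)
    (hL : 16 * (D * (8 * D + 1)) * S.card < (L + 1) * n) :
    ∃ Good : Finset (Fin 4 → ℝ), n ^ 3 ≤ Good.card ∧
      (∀ z ∈ Good, (∀ j, z j ∈ A) ∧ MvPolynomial.eval z H ≠ 0 ∧
        gap S ((G1 (z 2) (z 3)).eval (z 1)) ((G1 (z 2) (z 3)).eval (z 0)) ≤ L ∧
        gap S ((G2 (z 2) (z 3)).eval (z 1)) ((G2 (z 2) (z 3)).eval (z 0)) ≤ L) ∧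
      (Good.image fun z => (z 0, z 1)).card ≤ n * (8 * D) := by
  classical
  obtain ⟨a, haA, ha⟩ := exists_enum A
  rw [hn] at haA ha
  set K := 8 * D with hK
  have b1 := gap_bad D K n hD A hn a ha G1 hG1d S hS L hL
  have b2 := gap_bad D K n hD A hn a ha G2 hG2d S hS L hL
  have b3 := hbad D K n A hn (by omega) a haA ha H hH hHd
  have hinj : ∀ i j, i < n → j < n → a i = a j → i = j := by
    intro i j hi hj h
    rcases lt_trichotomy i j with h1 | h1 | h1
    · exact absurd h (ha i j h1 hj).ne
    · exact h1
    · exact absurd h (ha j i h1 hi).ne'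
  set Ω := Finset.range (n - K) ×ˢ Finset.range K ×ˢ A ×ˢ A with hΩ
  have hΩc : Ω.card = (n - K) * (K * (n * n)) := by
    rw [hΩ, Finset.card_product, Finset.card_product, Finset.card_product, Finset.card_range,
      Finset.card_range, hn]
  set B1 := Ω.filter fun ω : ℕ × ℕ × ℝ × ℝ => 0 < (G1 ω.2.2.1 ω.2.2.2).natDegree ∧
        ¬ gap S ((G1 ω.2.2.1 ω.2.2.2).eval (a ω.1))
          ((G1 ω.2.2.1 ω.2.2.2).eval (a (ω.1 + (ω.2.1 + 1)))) ≤ L with hB1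
  set B2 := Ω.filter fun ω : ℕ × ℕ × ℝ × ℝ => 0 < (G2 ω.2.2.1 ω.2.2.2).natDegree ∧
        ¬ gap S ((G2 ω.2.2.1 ω.2.2.2).eval (a ω.1))
          ((G2 ω.2.2.1 ω.2.2.2).eval (a (ω.1 + (ω.2.1 + 1)))) ≤ L with hB2
  set B3 := Ω.filter fun ω : ℕ × ℕ × ℝ × ℝ => MvPolynomial.eval
        (Fin.cons (a (ω.1 + (ω.2.1 + 1))) ![a ω.1, ω.2.2.1, ω.2.2.2]) H = 0 with hB3
  set φ : ℕ × ℕ × ℝ × ℝ → Fin 4 → ℝ :=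
    fun ω => Fin.cons (a (ω.1 + (ω.2.1 + 1))) ![a ω.1, ω.2.2.1, ω.2.2.2] with hφ
  have hφinj : Set.InjOn φ Ω := by
    rintro ⟨i, r, y, w⟩ e1 ⟨i', r', y', w'⟩ e2 h
    simp only [hΩ, Finset.coe_product, Set.mem_prod, Finset.mem_coe, Finset.mem_range] at e1 e2
    have f0 : a (i + (r + 1)) = a (i' + (r' + 1)) := congrFun h 0
    have f1 : a i = a i' := congrFun h 1
    have f2 : y = y' := congrFun h 2
    have f3 : w = w' := congrFun h 3
    have g0 := hinj _ _ (by omega) (by omega) f0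
    have g1 := hinj _ _ (by omega) (by omega) f1
    subst f2 f3 g1
    have : r = r' := by omega
    subst this
    rfl
  refine ⟨(Ω \ (B1 ∪ (B2 ∪ B3))).image φ, ?_, ?_, ?_⟩
  · rw [Finset.card_image_of_injOn (hφinj.mono (by
      intro x hx; exact (Finset.mem_sdiff.1 hx).1))]
    have h1 := Finset.le_card_sdiff (B1 ∪ (B2 ∪ B3)) Ω
    have h2 := Finset.card_union_le B1 (B2 ∪ B3)
    have h3 := Finset.card_union_le B2 B3
    have h4 : K * n ^ 3 ≤ 2 * Ω.card := by
      rw [hΩc]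
      have : n ≤ 2 * (n - K) := by omega
      calc K * n ^ 3 = n * (K * (n * n)) := by ring
        _ ≤ 2 * (n - K) * (K * (n * n)) := Nat.mul_le_mul_right _ this
        _ = _ := by ring
    have h5 : 8 * (K * (D * n ^ 2)) ≤ K * n ^ 3 := by
      have : 8 * D ≤ n := by omega
      calc 8 * (K * (D * n ^ 2)) = (8 * D) * (K * n ^ 2) := by ring
        _ ≤ n * (K * n ^ 2) := Nat.mul_le_mul_right _ this
        _ = _ := by ring
    have h6 : 8 * (D * n ^ 3) = K * n ^ 3 := by rw [hK]; ring
    have h7 : 8 * n ^ 3 ≤ K * n ^ 3 := Nat.mul_le_mul_right _ (by omega)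
    omega
  · intro z hz
    obtain ⟨⟨i, r, y, w⟩, hω, rfl⟩ := Finset.mem_image.1 hz
    obtain ⟨h1, h2⟩ := Finset.mem_sdiff.1 hω
    rw [Finset.mem_union, Finset.mem_union, not_or, not_or] at h2
    obtain ⟨n1, n2, n3⟩ := h2
    have hH0 : MvPolynomial.eval (φ (i, r, y, w)) H ≠ 0 := fun h =>
      n3 (Finset.mem_filter.2 ⟨h1, h⟩)
    have p1 := hG1 _ hH0
    have p2 := hG2 _ hH0
    refine ⟨?_, hH0, ?_, ?_⟩
    · simp only [hΩ, Finset.mem_product, Finset.mem_range] at h1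
      intro j
      fin_cases j
      · exact haA (i + (r + 1)) (by omega)
      · exact haA i (by omega)
      · exact h1.2.2.1
      · exact h1.2.2.2
    · by_contra hcon
      exact n1 (Finset.mem_filter.2 ⟨h1, p1, hcon⟩)
    · by_contra hcon
      exact n2 (Finset.mem_filter.2 ⟨h1, p2, hcon⟩)
  · have : ((Finset.image φ (Ω \ (B1 ∪ (B2 ∪ B3)))).image fun z => (z 0, z 1)) ⊆
        (Finset.range n ×ˢ Finset.range K).image fun p => (a (p.1 + (p.2 + 1)), a p.1) := by
      intro p hp
      obtain ⟨z, hz, rfl⟩ := Finset.mem_image.1 hp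
      obtain ⟨⟨i, r, y, w⟩, hω, rfl⟩ := Finset.mem_image.1 hz
      have h1 := (Finset.mem_sdiff.1 hω).1
      simp only [hΩ, Finset.mem_product, Finset.mem_range] at h1
      exact Finset.mem_image.2 ⟨(i, r), Finset.mem_product.2
        ⟨Finset.mem_range.2 (by simp only; omega), Finset.mem_range.2 h1.2.1⟩, rfl⟩
    refine (Finset.card_le_card this).trans (Finset.card_image_le.trans ?_)
    rw [Finset.card_product, Finset.card_range, Finset.card_range]

end

section

lemma finish_pow (p q B : ℕ) (hB : 0 < B) (hq : 0 < q) : ∃ c : ℝ, 0 < c ∧ ∀ n s : ℕ,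
    n ^ p ≤ B * s ^ q → c * (n : ℝ) ^ ((p : ℝ) / q) ≤ s := by
  have hB' : (0 : ℝ) < B := by exact_mod_cast hB
  have hq' : (q : ℝ) ≠ 0 := by exact_mod_cast hq.ne'
  refine ⟨((B : ℝ) ^ ((1 : ℝ) / q))⁻¹, by positivity, fun n s h => ?_⟩
  have h1 : ((n : ℝ) ^ p) ≤ B * (s : ℝ) ^ q := by exact_mod_cast h
  have h2 := Real.rpow_le_rpow (by positivity) h1 (z := (1 : ℝ) / q) (by positivity)
  rw [Real.mul_rpow hB'.le (by positivity), ← Real.rpow_natCast, ← Real.rpow_natCast,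
    ← Real.rpow_mul (by positivity), ← Real.rpow_mul (by positivity), mul_one_div, mul_one_div,
    div_self hq', Real.rpow_one] at h2
  rw [inv_mul_le_iff₀ (by positivity)]
  exact h2

lemma pderiv_rename_gen {m k : ℕ} (f : Fin m → Fin k) (P : MvPolynomial (Fin m) ℝ) (i : Fin k) :
    MvPolynomial.pderiv i (MvPolynomial.rename f P) =
      ∑ j, MvPolynomial.rename f (MvPolynomial.pderiv j P) *
        MvPolynomial.pderiv i (MvPolynomial.X (f j)) := by
  have := chain_rule (MvPolynomial.pderiv i) (fun j => (MvPolynomial.X (f j) :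
    MvPolynomial (Fin k) ℝ)) P
  have e : (MvPolynomial.rename f : MvPolynomial (Fin m) ℝ →ₐ[ℝ] MvPolynomial (Fin k) ℝ) =
      MvPolynomial.aeval (fun j => MvPolynomial.X (f j)) := by
    apply MvPolynomial.algHom_ext
    intro j
    rw [MvPolynomial.rename_X, MvPolynomial.aeval_X]
  rw [e]
  simpa only using this

lemma vec2 (z : Fin 4 → ℝ) (i j : Fin 4) :
    (fun k : Fin 2 => z ((![i, j] : Fin 2 → Fin 4) k)) = ![z i, z j] := by
  ext k
  fin_cases k <;> rfl

lemma vec3 (z : Fin 4 → ℝ) (i j l : Fin 4) :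
    (fun k : Fin 3 => z ((![i, j, l] : Fin 3 → Fin 4) k)) = ![z i, z j, z l] := by
  ext k
  fin_cases k <;> rfl

lemma det_A {R : Type*} [CommRing R] (a b c d e f g h : R) :
    (!![0, c, 0, g; a, 0, e, 0; b, d, 0, 0; 0, 0, f, h]).det = c * e * b * h - a * d * f * g := by
  simp [Matrix.det_succ_row_zero, Fin.sum_univ_succ, Fin.succAbove]
  ring

lemma det_B {R : Type*} [CommRing R] (a b c d e f : R) :
    (!![1, 0, 0, a; 0, 1, b, 0; 0, 0, c, d; 0, 0, e, f]).det = c * f - d * e := by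
  simp [Matrix.det_succ_row_zero, Fin.sum_univ_succ, Fin.succAbove]
  ring

lemma eval_ren {m k : ℕ} (f : Fin m → Fin k) (P : MvPolynomial (Fin m) ℝ) (z : Fin k → ℝ) :
    MvPolynomial.eval z (MvPolynomial.rename f P) = MvPolynomial.eval (fun j => z (f j)) P := by
  rw [MvPolynomial.eval_rename]; rfl

lemma ren_ne {m k : ℕ} (f : Fin m → Fin k) (hf : Function.Injective f) (P : MvPolynomial (Fin m) ℝ)
    (hP : P ≠ 0) : MvPolynomial.rename f P ≠ 0 := by
  intro h
  exact hP (MvPolynomial.rename_injective f hf (by rw [h, map_zero]))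

lemma slice_pos {d : ℕ} (P : MvPolynomial (Fin d) ℝ) (i : Fin d) (z : Fin d → ℝ) (x : ℝ)
    (h : MvPolynomial.eval (Function.update z i x) (MvPolynomial.pderiv i P) ≠ 0) :
    0 < (slice P i z).natDegree := by
  apply natDegree_pos_of_derivative
  intro h0
  apply h
  rw [← slice_eval, ← slice_derivative, h0, eval_zero]

lemma caseA (δ : ℕ) : ∃ c : ℝ, 0 < c ∧ ∃ N0 : ℕ, ∀ P : MvPolynomial (Fin 2) ℝ,
    P.totalDegree ≤ δ → MvPolynomial.pderiv 0 P ≠ 0 →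
    (∃ x x' y w : ℝ,
      MvPolynomial.eval ![x', y] (MvPolynomial.pderiv 0 P) *
      MvPolynomial.eval ![x, w] (MvPolynomial.pderiv 0 P) *
      MvPolynomial.eval ![x, y] (MvPolynomial.pderiv 1 P) *
      MvPolynomial.eval ![x', w] (MvPolynomial.pderiv 1 P) ≠
      MvPolynomial.eval ![x, y] (MvPolynomial.pderiv 0 P) *
      MvPolynomial.eval ![x', y] (MvPolynomial.pderiv 1 P) *
      MvPolynomial.eval ![x, w] (MvPolynomial.pderiv 1 P) *
      MvPolynomial.eval ![x', w] (MvPolynomial.pderiv 0 P)) →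
    ∀ A S : Finset ℝ, N0 ≤ A.card → (∀ x ∈ A, ∀ y ∈ A, MvPolynomial.eval ![x, y] P ∈ S) →
      c * (A.card : ℝ) ^ ((5 : ℝ) / 4) ≤ S.card := by
  classical
  obtain ⟨M, D0, hfib⟩ := fib 4 δ
  set D := D0 + 2 * δ + 1 with hD
  set C1 := 16 * (D * (8 * D + 1)) with hC1
  obtain ⟨c, hc, hfin⟩ := finish_pow 5 4 (4 * M * C1 ^ 2 + 1) (by positivity) (by norm_num)
  refine ⟨c, hc, 16 * D, fun P hPd hP0 hne A S hA hAS => ?_⟩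
  set n := A.card with hn
  have hn0 : 0 < n := by omega
  set g : Fin 4 → MvPolynomial (Fin 4) ℝ := ![MvPolynomial.rename ![1, 2] P,
    MvPolynomial.rename ![0, 2] P, MvPolynomial.rename ![1, 3] P, MvPolynomial.rename ![0, 3] P]
    with hg
  have hgd : ∀ j, (g j).totalDegree ≤ δ := by
    intro j
    fin_cases j <;> exact (MvPolynomial.totalDegree_rename_le _ _).trans hPd
  have hmat : (Matrix.of fun i j => MvPolynomial.pderiv i (g j)) =
      !![0, MvPolynomial.rename ![0, 2] (MvPolynomial.pderiv 0 P), 0,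
          MvPolynomial.rename ![0, 3] (MvPolynomial.pderiv 0 P);
        MvPolynomial.rename ![1, 2] (MvPolynomial.pderiv 0 P), 0,
          MvPolynomial.rename ![1, 3] (MvPolynomial.pderiv 0 P), 0;
        MvPolynomial.rename ![1, 2] (MvPolynomial.pderiv 1 P),
          MvPolynomial.rename ![0, 2] (MvPolynomial.pderiv 1 P), 0, 0;
        0, 0, MvPolynomial.rename ![1, 3] (MvPolynomial.pderiv 1 P),
          MvPolynomial.rename ![0, 3] (MvPolynomial.pderiv 1 P)] := by
    ext1 i j
    fin_cases i <;> fin_cases j <;>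
      simp [hg, pderiv_rename_gen, Fin.sum_univ_two, MvPolynomial.pderiv_X, Pi.single_apply]
  have hdet : (Matrix.of fun i j => MvPolynomial.pderiv i (g j)).det ≠ 0 := by
    rw [hmat, det_A]
    intro h
    obtain ⟨x, x', y, w, hne⟩ := hne
    apply hne
    have := congrArg (MvPolynomial.eval ![x', x, y, w]) h
    simp only [map_sub, map_mul, eval_ren, map_zero] at this
    simp only [vec2] at this
    exact sub_eq_zero.1 this
  obtain ⟨H0, hH0, hH0d, hZ⟩ := hfib g hgd hdet
  have hi12 : Function.Injective (![1, 2] : Fin 2 → Fin 4) := by decide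
  have hi13 : Function.Injective (![1, 3] : Fin 2 → Fin 4) := by decide
  set H := H0 * (MvPolynomial.rename ![1, 2] (MvPolynomial.pderiv 0 P) *
    MvPolynomial.rename ![1, 3] (MvPolynomial.pderiv 0 P)) with hH
  have hHne : H ≠ 0 := mul_ne_zero hH0 (mul_ne_zero (ren_ne _ hi12 _ hP0) (ren_ne _ hi13 _ hP0))
  have hpd : (MvPolynomial.pderiv 0 P).totalDegree ≤ δ :=
    (totalDegree_pderiv_le _ _).trans (by omega)
  have hHd : H.totalDegree ≤ D := by
    have h1 := MvPolynomial.totalDegree_mul H0 (MvPolynomial.rename ![1, 2] (MvPolynomial.pderiv 0 P) *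
      MvPolynomial.rename ![1, 3] (MvPolynomial.pderiv 0 P))
    have h2 := MvPolynomial.totalDegree_mul (MvPolynomial.rename ![1, 2] (MvPolynomial.pderiv 0 P))
      (MvPolynomial.rename (![1, 3] : Fin 2 → Fin 4) (MvPolynomial.pderiv 0 P))
    have h3 := MvPolynomial.totalDegree_rename_le (![1, 2] : Fin 2 → Fin 4) (MvPolynomial.pderiv 0 P)
    have h4 := MvPolynomial.totalDegree_rename_le (![1, 3] : Fin 2 → Fin 4) (MvPolynomial.pderiv 0 P)
    rw [← hH] at h1
    omega
  have hupd : ∀ x u y : ℝ, Function.update ![u, y] 0 x = ![x, y] := by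
    intro x u y
    ext k; fin_cases k <;> simp
  have hS : 0 < S.card := by
    obtain ⟨x, hx⟩ := Finset.card_pos.1 (hn ▸ hn0)
    exact Finset.card_pos.2 ⟨_, hAS x hx x hx⟩
  set L := C1 * S.card / n with hL
  have hL1 : C1 * S.card < (L + 1) * n := by
    have := Nat.lt_div_mul_add (a := C1 * S.card) hn0
    rw [hL]; linarith
  have hL2 : L * n ≤ C1 * S.card := Nat.div_mul_le_self _ _
  obtain ⟨Good, hcard, hGood, -⟩ := counting D (by omega) A n hn.symm hA H hHne hHd
    (fun y _ => slice P 0 ![0, y]) (fun _ w => slice P 0 ![0, w])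
    (fun y w => (slice_natDegree _ _ _).trans (by omega))
    (fun y w => (slice_natDegree _ _ _).trans (by omega))
    (fun z hz => by
      refine slice_pos _ _ _ (z 1) ?_
      rw [hupd]
      rw [hH, map_mul, map_mul] at hz
      have := left_ne_zero_of_mul (right_ne_zero_of_mul hz)
      rwa [eval_ren, vec2] at this)
    (fun z hz => by
      refine slice_pos _ _ _ (z 1) ?_
      rw [hupd]
      rw [hH, map_mul, map_mul] at hz
      have := right_ne_zero_of_mul (right_ne_zero_of_mul hz)
      rwa [eval_ren, vec2] at this)
    S hS L hL1
  have hgood2 : Good.card ≤ M * (closePairs S L ×ˢ closePairs S L).card := by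
    refine Finset.card_le_mul_card_image_of_maps_to (f := fun z =>
      ((MvPolynomial.eval ![z 1, z 2] P, MvPolynomial.eval ![z 0, z 2] P),
       (MvPolynomial.eval ![z 1, z 3] P, MvPolynomial.eval ![z 0, z 3] P))) ?_ _ ?_
    · intro z hz
      obtain ⟨h1, -, h2, h3⟩ := hGood z hz
      simp only [slice_eval, hupd] at h2 h3
      refine Finset.mem_product.2 ⟨Finset.mem_filter.2 ⟨Finset.mem_product.2 ⟨?_, ?_⟩, h2⟩,
        Finset.mem_filter.2 ⟨Finset.mem_product.2 ⟨?_, ?_⟩, h3⟩⟩ <;>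
      exact hAS _ (h1 _) _ (h1 _)
    · rintro ⟨⟨s0, s1⟩, s2, s3⟩ -
      obtain ⟨Z, hZc, hZm⟩ := hZ ![s0, s1, s2, s3]
      refine le_trans (Finset.card_le_card ?_) hZc
      intro z hz
      obtain ⟨h1, h2⟩ := Finset.mem_filter.1 hz
      obtain ⟨-, hHz, -, -⟩ := hGood z h1
      rw [hH, map_mul] at hHz
      refine hZm z (left_ne_zero_of_mul hHz) ?_
      simp only [Prod.mk.injEq] at h2
      obtain ⟨⟨e0, e1⟩, e2, e3⟩ := h2
      intro j
      fin_cases j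
      · change MvPolynomial.eval z (MvPolynomial.rename ![1, 2] P) = s0
        rw [eval_ren, vec2, e0]
      · change MvPolynomial.eval z (MvPolynomial.rename ![0, 2] P) = s1
        rw [eval_ren, vec2, e1]
      · change MvPolynomial.eval z (MvPolynomial.rename ![1, 3] P) = s2
        rw [eval_ren, vec2, e2]
      · change MvPolynomial.eval z (MvPolynomial.rename ![0, 3] P) = s3
        rw [eval_ren, vec2, e3]
  rw [Finset.card_product] at hgood2
  have hcp := card_closePairs S L
  have hfinal : n ^ 5 ≤ (4 * M * C1 ^ 2 + 1) * S.card ^ 4 := by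
    calc n ^ 5 = n ^ 3 * n ^ 2 := by ring
      _ ≤ (M * ((S.card * (2 * L)) * (S.card * (2 * L)))) * n ^ 2 := by
        refine Nat.mul_le_mul_right _ (hcard.trans (hgood2.trans ?_))
        exact Nat.mul_le_mul_left _ (Nat.mul_le_mul hcp hcp)
      _ = 4 * M * S.card ^ 2 * (L * n) ^ 2 := by ring
      _ ≤ 4 * M * S.card ^ 2 * (C1 * S.card) ^ 2 := Nat.mul_le_mul_left _ (Nat.pow_le_pow_left hL2 2)
      _ = (4 * M * C1 ^ 2) * S.card ^ 4 := by ring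
      _ ≤ _ := Nat.mul_le_mul_right _ (by omega)
  have := hfin n S.card hfinal
  norm_num at this
  exact this

end

section

lemma caseB (δ : ℕ) : ∃ c : ℝ, 0 < c ∧ ∃ N0 : ℕ, ∀ P : MvPolynomial (Fin 3) ℝ,
    P.totalDegree ≤ δ → MvPolynomial.pderiv 0 P ≠ 0 →
    (∃ x x' y w : ℝ,
      MvPolynomial.eval ![x, y, w] (MvPolynomial.pderiv 1 P) *
      MvPolynomial.eval ![x', y, w] (MvPolynomial.pderiv 2 P) ≠
      MvPolynomial.eval ![x', y, w] (MvPolynomial.pderiv 1 P) *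
      MvPolynomial.eval ![x, y, w] (MvPolynomial.pderiv 2 P)) →
    ∀ A S : Finset ℝ, N0 ≤ A.card →
      (∀ x ∈ A, ∀ y ∈ A, ∀ w ∈ A, MvPolynomial.eval ![x, y, w] P ∈ S) →
      c * (A.card : ℝ) ^ ((3 : ℝ) / 2) ≤ S.card := by
  classical
  obtain ⟨M, D0, hfib⟩ := fib 4 (δ + 1)
  set D := D0 + δ + 1 with hD
  set C1 := 16 * (D * (8 * D + 1)) with hC1
  obtain ⟨c, hc, hfin⟩ := finish_pow 3 2 (2 * M * (8 * D) * C1 + 1) (by positivity) (by norm_num)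
  refine ⟨c, hc, 16 * D, fun P hPd hP0 hne A S hA hAS => ?_⟩
  set n := A.card with hn
  have hn0 : 0 < n := by omega
  set g : Fin 4 → MvPolynomial (Fin 4) ℝ := ![MvPolynomial.X 0, MvPolynomial.X 1,
    MvPolynomial.rename ![1, 2, 3] P, MvPolynomial.rename ![0, 2, 3] P]
    with hg
  have hgd : ∀ j, (g j).totalDegree ≤ δ + 1 := by
    intro j
    fin_cases j
    · exact (MvPolynomial.totalDegree_X (R := ℝ) (0 : Fin 4)).le.trans (by omega)
    · exact (MvPolynomial.totalDegree_X (R := ℝ) (1 : Fin 4)).le.trans (by omega)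
    · exact (MvPolynomial.totalDegree_rename_le _ _).trans (by omega)
    · exact (MvPolynomial.totalDegree_rename_le _ _).trans (by omega)
  have hmat : (Matrix.of fun i j => MvPolynomial.pderiv i (g j)) =
      !![1, 0, 0, MvPolynomial.rename ![0, 2, 3] (MvPolynomial.pderiv 0 P);
        0, 1, MvPolynomial.rename ![1, 2, 3] (MvPolynomial.pderiv 0 P), 0;
        0, 0, MvPolynomial.rename ![1, 2, 3] (MvPolynomial.pderiv 1 P),
          MvPolynomial.rename ![0, 2, 3] (MvPolynomial.pderiv 1 P);
        0, 0, MvPolynomial.rename ![1, 2, 3] (MvPolynomial.pderiv 2 P),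
          MvPolynomial.rename ![0, 2, 3] (MvPolynomial.pderiv 2 P)] := by
    ext1 i j
    fin_cases i <;> fin_cases j <;>
      simp [hg, pderiv_rename_gen, Fin.sum_univ_three, MvPolynomial.pderiv_X, Pi.single_apply]
  have hdet : (Matrix.of fun i j => MvPolynomial.pderiv i (g j)).det ≠ 0 := by
    rw [hmat, det_B]
    intro h
    obtain ⟨x, x', y, w, hne⟩ := hne
    apply hne
    have := congrArg (MvPolynomial.eval ![x', x, y, w]) h
    simp only [map_sub, map_mul, eval_ren, map_zero] at this
    simp only [vec3] at this
    exact sub_eq_zero.1 this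
  obtain ⟨H0, hH0, hH0d, hZ⟩ := hfib g hgd hdet
  have hi : Function.Injective (![1, 2, 3] : Fin 3 → Fin 4) := by decide
  set H := H0 * MvPolynomial.rename ![1, 2, 3] (MvPolynomial.pderiv 0 P) with hH
  have hHne : H ≠ 0 := mul_ne_zero hH0 (ren_ne _ hi _ hP0)
  have hpd : (MvPolynomial.pderiv 0 P).totalDegree ≤ δ :=
    (totalDegree_pderiv_le _ _).trans (by omega)
  have hHd : H.totalDegree ≤ D := by
    have h1 := MvPolynomial.totalDegree_mul H0
      (MvPolynomial.rename ![1, 2, 3] (MvPolynomial.pderiv 0 P))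
    have h3 := MvPolynomial.totalDegree_rename_le (![1, 2, 3] : Fin 3 → Fin 4)
      (MvPolynomial.pderiv 0 P)
    rw [← hH] at h1
    omega
  have hupd : ∀ x u y w : ℝ, Function.update ![u, y, w] 0 x = ![x, y, w] := by
    intro x u y w
    ext k; fin_cases k <;> simp
  have hS : 0 < S.card := by
    obtain ⟨x, hx⟩ := Finset.card_pos.1 (hn ▸ hn0)
    exact Finset.card_pos.2 ⟨_, hAS x hx x hx x hx⟩
  set L := C1 * S.card / n with hL
  have hL1 : C1 * S.card < (L + 1) * n := by
    have := Nat.lt_div_mul_add (a := C1 * S.card) hn0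
    rw [hL]; linarith
  have hL2 : L * n ≤ C1 * S.card := Nat.div_mul_le_self _ _
  have hpos : ∀ z : Fin 4 → ℝ, MvPolynomial.eval z H ≠ 0 →
      0 < (slice P 0 ![0, z 2, z 3]).natDegree := by
    intro z hz
    refine slice_pos _ _ _ (z 1) ?_
    rw [hupd]
    rw [hH, map_mul] at hz
    have := right_ne_zero_of_mul hz
    rwa [eval_ren, vec3] at this
  obtain ⟨Good, hcard, hGood, himg⟩ := counting D (by omega) A n hn.symm hA H hHne hHd
    (fun y w => slice P 0 ![0, y, w]) (fun y w => slice P 0 ![0, y, w])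
    (fun y w => (slice_natDegree _ _ _).trans (by omega))
    (fun y w => (slice_natDegree _ _ _).trans (by omega))
    hpos hpos S hS L hL1
  have hgood2 : Good.card ≤ M * ((Good.image fun z => (z 0, z 1)) ×ˢ closePairs S L).card := by
    refine Finset.card_le_mul_card_image_of_maps_to (f := fun z =>
      ((z 0, z 1),
       (MvPolynomial.eval ![z 1, z 2, z 3] P, MvPolynomial.eval ![z 0, z 2, z 3] P))) ?_ _ ?_
    · intro z hz
      obtain ⟨h1, -, h2, -⟩ := hGood z hz
      simp only [slice_eval, hupd] at h2
      refine Finset.mem_product.2 ⟨Finset.mem_image_of_mem _ hz,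
        Finset.mem_filter.2 ⟨Finset.mem_product.2 ⟨?_, ?_⟩, h2⟩⟩ <;>
      exact hAS _ (h1 _) _ (h1 _) _ (h1 _)
    · rintro ⟨⟨s0, s1⟩, s2, s3⟩ -
      obtain ⟨Z, hZc, hZm⟩ := hZ ![s0, s1, s2, s3]
      refine le_trans (Finset.card_le_card ?_) hZc
      intro z hz
      obtain ⟨h1, h2⟩ := Finset.mem_filter.1 hz
      obtain ⟨-, hHz, -, -⟩ := hGood z h1
      rw [hH, map_mul] at hHz
      refine hZm z (left_ne_zero_of_mul hHz) ?_
      simp only [Prod.mk.injEq] at h2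
      obtain ⟨⟨e0, e1⟩, e2, e3⟩ := h2
      intro j
      fin_cases j
      · change MvPolynomial.eval z (MvPolynomial.X 0) = s0
        rw [MvPolynomial.eval_X, e0]
      · change MvPolynomial.eval z (MvPolynomial.X 1) = s1
        rw [MvPolynomial.eval_X, e1]
      · change MvPolynomial.eval z (MvPolynomial.rename ![1, 2, 3] P) = s2
        rw [eval_ren, vec3, e2]
      · change MvPolynomial.eval z (MvPolynomial.rename ![0, 2, 3] P) = s3
        rw [eval_ren, vec3, e3]
  rw [Finset.card_product] at hgood2
  have hcp := card_closePairs S L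
  have hfinal : n ^ 3 ≤ (2 * M * (8 * D) * C1 + 1) * S.card ^ 2 := by
    calc n ^ 3 ≤ M * ((n * (8 * D)) * (S.card * (2 * L))) := by
          refine hcard.trans (hgood2.trans ?_)
          exact Nat.mul_le_mul_left _ (Nat.mul_le_mul himg hcp)
      _ = 2 * M * (8 * D) * S.card * (L * n) := by ring
      _ ≤ 2 * M * (8 * D) * S.card * (C1 * S.card) := Nat.mul_le_mul_left _ hL2
      _ = (2 * M * (8 * D) * C1) * S.card ^ 2 := by ring
      _ ≤ _ := Nat.mul_le_mul_right _ (by omega)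
  have := hfin n S.card hfinal
  norm_num at this
  exact this

end

section

lemma box_sep {d : ℕ} (D : Fin d → (Fin d → ℝ) → ℝ) (s : Fin d → Set ℝ)
    (hne : ∀ z, (∀ j, z j ∈ s j) → ∀ j, D j z ≠ 0) (c : Fin d → ℝ) (hc : ∀ j, c j ∈ s j)
    (hind : ∀ i k l, i ≠ k → i ≠ l → k ≠ l → ∀ z x', D k z * D l (Function.update z i x') =
      D l z * D k (Function.update z i x'))
    (w : Fin d → Fin d) (hw : ∀ i, i ≠ w i) (i j m : Fin d) (hij : i ≠ j) (hmi : i ≠ m)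
    (hmj : j ≠ m) (z : Fin d → ℝ) (hz : ∀ j, z j ∈ s j) :
    D i z * D (w i) (Function.update c i (z i)) * (D j (Function.update c j (z j)) * D (w j) c) =
    D j z * D (w j) (Function.update c j (z j)) *
      (D i (Function.update c i (z i)) * D (w i) c) := by
  classical
  have hupd : ∀ z : Fin d → ℝ, (∀ j, z j ∈ s j) → ∀ i x, x ∈ s i →
      ∀ j, Function.update z i x j ∈ s j := by
    intro z hz i x hx j
    by_cases h : j = i
    · subst h; simpa using hx
    · simpa [h] using hz j
  set r : Fin d → Fin d → (Fin d → ℝ) → ℝ := fun k l z => D k z / D l z with hr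
  have hr1 : ∀ i k l, i ≠ k → i ≠ l → ∀ z, (∀ j, z j ∈ s j) → ∀ x, x ∈ s i →
      r k l (Function.update z i x) = r k l z := by
    intro i k l hik hil z hz x hx
    by_cases hkl : k = l
    · subst hkl
      simp only [hr]
      rw [div_self (hne _ hz _), div_self (hne _ (hupd _ hz _ _ hx) _)]
    · simp only [hr]
      rw [div_eq_div_iff (hne _ (hupd _ hz _ _ hx) _) (hne _ hz _)]
      have := hind i k l hik hil hkl z x
      linarith
  have hr2 : ∀ k l o z, (∀ j, z j ∈ s j) → r k l z = r k o z * r o l z := by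
    intro k l o z hz
    simp only [hr]
    have h1 := hne z hz l
    have h2 := hne z hz o
    field_simp
  have hci := hupd c hc i (z i) (hz i)
  have hcj := hupd c hc j (z j) (hz j)
  have hcij := hupd _ hci j (z j) (hz j)
  have hA : ∀ T : Finset (Fin d), i ∉ T → j ∉ T → (∀ k, T.piecewise c z k ∈ s k) ∧
      r i j (T.piecewise c z) = r i j z := by
    intro T
    induction T using Finset.induction_on with
    | empty => intro _ _; simpa using hz
    | insert a T ha ih =>
      intro h1 h2
      simp only [Finset.mem_insert, not_or] at h1 h2
      obtain ⟨ih1, ih2⟩ := ih h1.2 h2.2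
      rw [Finset.piecewise_insert]
      refine ⟨hupd _ ih1 _ _ (hc a), ?_⟩
      rw [hr1 a i j (Ne.symm h1.1) (Ne.symm h2.1) _ ih1 _ (hc a), ih2]
  have hA' := (hA (Finset.univ.filter fun k => k ≠ i ∧ k ≠ j) (by simp) (by simp)).2
  have hpw : (Finset.univ.filter fun k => k ≠ i ∧ k ≠ j).piecewise c z =
      Function.update (Function.update c i (z i)) j (z j) := by
    ext k
    by_cases h1 : k = j
    · subst h1; simp [Finset.piecewise]
    · by_cases h2 : k = i
      · subst h2; simp [Finset.piecewise, h1]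
      · simp [Finset.piecewise, h1, h2]
  rw [hpw, hr2 i j m _ hcij, hr1 j i m hij.symm hmj _ hci _ (hz j),
    Function.update_comm hij, hr1 i m j hmi hij _ hcj _ (hz i),
    hr2 i m (w i) _ hci, hr1 i (w i) m (hw i) hmi _ hc _ (hz i),
    hr2 m j (w j) _ hcj, hr1 j m (w j) hmj (hw j) _ hc _ (hz j)] at hA'
  simp only [hr] at hA'
  have e1 := hne _ hci (w i)
  have e2 := hne _ hc m
  have e3 := hne _ hc (w j)
  have e4 := hne _ hcj j
  have e5 := hne _ hz j
  field_simp at hA'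
  linarith

lemma pd_ne {d : ℕ} (P : MvPolynomial (Fin d) ℝ) (i : Fin d) (h : 1 ≤ P.degreeOf i) :
    MvPolynomial.pderiv i P ≠ 0 := by
  intro h0
  have := degreeOf_of_pderiv P i h0
  omega

lemma exists_pt {d : ℕ} (Q : MvPolynomial (Fin d) ℝ) (h : Q ≠ 0) :
    ∃ c, MvPolynomial.eval c Q ≠ 0 := by
  by_contra hcon
  push Not at hcon
  exact h (MvPolynomial.funext (fun x => by rw [hcon, map_zero]))

lemma upd2_0 (c : Fin 2 → ℝ) (x : ℝ) : Function.update c 0 x = ![x, c 1] := by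
  ext k; fin_cases k <;> simp

lemma upd2_1 (c : Fin 2 → ℝ) (x : ℝ) : Function.update c 1 x = ![c 0, x] := by
  ext k; fin_cases k <;> simp

lemma slice_ne {d : ℕ} (Q : MvPolynomial (Fin d) ℝ) (i : Fin d) (c : Fin d → ℝ)
    (h : MvPolynomial.eval c Q ≠ 0) : slice Q i c ≠ 0 := by
  intro h0
  have := slice_eval Q i c (c i)
  rw [h0, Function.update_eq_self, Polynomial.eval_zero] at this
  exact h this.symm

lemma sep2 (P : MvPolynomial (Fin 2) ℝ) (hP : ∀ i, 1 ≤ P.degreeOf i)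
    (h : ¬ ∃ x x' y w : ℝ,
      MvPolynomial.eval ![x', y] (MvPolynomial.pderiv 0 P) *
      MvPolynomial.eval ![x, w] (MvPolynomial.pderiv 0 P) *
      MvPolynomial.eval ![x, y] (MvPolynomial.pderiv 1 P) *
      MvPolynomial.eval ![x', w] (MvPolynomial.pderiv 1 P) ≠
      MvPolynomial.eval ![x, y] (MvPolynomial.pderiv 0 P) *
      MvPolynomial.eval ![x', y] (MvPolynomial.pderiv 1 P) *
      MvPolynomial.eval ![x, w] (MvPolynomial.pderiv 1 P) *
      MvPolynomial.eval ![x', w] (MvPolynomial.pderiv 0 P)) :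
    ∃ p q : Fin 2 → Polynomial ℝ, (∀ i, p i ≠ 0) ∧ (∀ i, q i ≠ 0) ∧
      ∀ i j, i ≠ j → MvPolynomial.pderiv i P * uni i (q i) * uni j (p j) =
      MvPolynomial.pderiv j P * uni j (q j) * uni i (p i) := by
  push Not at h
  obtain ⟨c, hc⟩ := exists_pt _ (mul_ne_zero (pd_ne P 0 (hP 0)) (pd_ne P 1 (hP 1)))
  rw [map_mul] at hc
  have h0 := left_ne_zero_of_mul hc
  have h1 := right_ne_zero_of_mul hc
  set P0 := MvPolynomial.pderiv 0 P with hP0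
  set P1 := MvPolynomial.pderiv 1 P with hP1
  have key : P0 * uni 0 (slice P1 0 c) * uni 1 (C (MvPolynomial.eval c P0) * slice P1 1 c) =
      P1 * uni 1 (C (MvPolynomial.eval c P1) * slice P0 1 c) * uni 0 (slice P0 0 c) := by
    apply MvPolynomial.funext
    intro a
    have hh := h (a 0) (c 0) (a 1) (c 1)
    have ea : ![a 0, a 1] = a := by ext k; fin_cases k <;> rfl
    have ec : ![c 0, c 1] = c := by ext k; fin_cases k <;> rfl
    rw [ea, ec] at hh
    simp only [map_mul, uni_eval, slice_eval, upd2_0, upd2_1, Polynomial.eval_mul,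
      Polynomial.eval_C]
    linarith
  refine ⟨![slice P0 0 c, C (MvPolynomial.eval c P0) * slice P1 1 c],
    ![slice P1 0 c, C (MvPolynomial.eval c P1) * slice P0 1 c], ?_, ?_, ?_⟩
  · intro i
    fin_cases i
    · exact slice_ne _ _ _ h0
    · exact mul_ne_zero (by simpa using h0) (slice_ne _ _ _ h1)
  · intro i
    fin_cases i
    · exact slice_ne _ _ _ h1
    · exact mul_ne_zero (by simpa using h1) (slice_ne _ _ _ h0)
  · intro i j hij
    fin_cases i <;> fin_cases j
    · exact absurd rfl hij
    · exact key
    · exact key.symm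
    · exact absurd rfl hij

lemma sep3 {d : ℕ} (hd : 3 ≤ d) (P : MvPolynomial (Fin d) ℝ) (hP : ∀ i, 1 ≤ P.degreeOf i)
    (hind : ∀ i k l, i ≠ k → i ≠ l → k ≠ l → ∀ z x',
      MvPolynomial.eval z (MvPolynomial.pderiv k P) *
        MvPolynomial.eval (Function.update z i x') (MvPolynomial.pderiv l P) =
      MvPolynomial.eval z (MvPolynomial.pderiv l P) *
        MvPolynomial.eval (Function.update z i x') (MvPolynomial.pderiv k P)) :
    ∃ p q : Fin d → Polynomial ℝ, (∀ i, p i ≠ 0) ∧ (∀ i, q i ≠ 0) ∧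
      ∀ i j, i ≠ j → MvPolynomial.pderiv i P * uni i (q i) * uni j (p j) =
      MvPolynomial.pderiv j P * uni j (q j) * uni i (p i) := by
  classical
  obtain ⟨c, hc⟩ := exists_pt (∏ j, MvPolynomial.pderiv j P)
    (Finset.prod_ne_zero_iff.2 fun j _ => pd_ne P j (hP j))
  have hopen : IsOpen {z : Fin d → ℝ | MvPolynomial.eval z (∏ j, MvPolynomial.pderiv j P) ≠ 0} :=
    isOpen_ne_fun (MvPolynomial.continuous_eval _) continuous_const
  obtain ⟨ε, hε, hball⟩ := Metric.isOpen_iff.1 hopen c hc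
  set s : Fin d → Set ℝ := fun j => Metric.ball (c j) ε with hs
  have hne : ∀ z, (∀ j, z j ∈ s j) → ∀ j, MvPolynomial.eval z (MvPolynomial.pderiv j P) ≠ 0 := by
    intro z hz j
    have h1 : z ∈ Metric.ball c ε := by
      rw [ball_pi _ hε]
      exact fun j _ => hz j
    have h2 := hball h1
    rw [Set.mem_ofPred_eq, map_prod] at h2
    exact Finset.prod_ne_zero_iff.1 h2 j (Finset.mem_univ j)
  have hcs : ∀ j, c j ∈ s j := fun j => Metric.mem_ball_self hε
  have hex : ∀ i j : Fin d, ∃ m, i ≠ m ∧ j ≠ m := by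
    intro i j
    have : ({i, j} : Finset (Fin d)).card < Fintype.card (Fin d) := by
      rw [Fintype.card_fin]
      exact lt_of_le_of_lt Finset.card_le_two (by omega)
    obtain ⟨m, hm⟩ := Finset.exists_mem_notMem_of_card_lt_card
      (s := ({i, j} : Finset (Fin d))) (t := Finset.univ) (by simpa using this)
    refine ⟨m, ?_, ?_⟩ <;> rintro rfl <;> simp at hm
  choose w hw using fun i => hex i i
  refine ⟨fun i => slice (MvPolynomial.pderiv i P) i c *
      C (MvPolynomial.eval c (MvPolynomial.pderiv (w i) P)),
    fun i => slice (MvPolynomial.pderiv (w i) P) i c, ?_, ?_, ?_⟩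
  · intro i
    exact mul_ne_zero (slice_ne _ _ _ (hne c hcs i)) (by simpa using hne c hcs (w i))
  · intro i
    exact slice_ne _ _ _ (hne c hcs _)
  · intro i j hij
    apply MvPolynomial.funext_set s
    · intro j
      simp only [hs, Real.ball_eq_Ioo]
      exact Set.Ioo_infinite (by linarith)
    · intro z hz
      obtain ⟨m, h1, h2⟩ := hex i j
      have := box_sep (fun j z => MvPolynomial.eval z (MvPolynomial.pderiv j P)) s hne c hcs hind
        w (fun i => (hw i).1) i j m hij h1 h2 z (fun j => hz j (Set.mem_univ j))
      simp only [map_mul, uni_eval, slice_eval, Polynomial.eval_mul, Polynomial.eval_C]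
      exact this

end

section

lemma td_aeval {m k : ℕ} (g : Fin m → MvPolynomial (Fin k) ℝ) (hg : ∀ j, (g j).totalDegree ≤ 1)
    (P : MvPolynomial (Fin m) ℝ) : (MvPolynomial.aeval g P).totalDegree ≤ P.totalDegree := by
  rw [MvPolynomial.aeval_def, MvPolynomial.eval₂_eq']
  refine MvPolynomial.totalDegree_finsetSum_le (fun e he => ?_)
  refine (MvPolynomial.totalDegree_mul _ _).trans ?_
  rw [MvPolynomial.algebraMap_eq, MvPolynomial.totalDegree_C, zero_add]
  refine (MvPolynomial.totalDegree_finsetProd _ _).trans ?_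
  have h1 := MvPolynomial.le_totalDegree he
  rw [Finsupp.sum_fintype _ _ (fun _ => rfl)] at h1
  refine le_trans (Finset.sum_le_sum fun j _ => ?_) h1
  refine (MvPolynomial.totalDegree_pow _ _).trans ?_
  calc e j * (g j).totalDegree ≤ e j * 1 := Nat.mul_le_mul_left _ (hg j)
    _ = e j := mul_one _

lemma ev_aeval {m k : ℕ} (g : Fin m → MvPolynomial (Fin k) ℝ) (P : MvPolynomial (Fin m) ℝ)
    (z : Fin k → ℝ) : MvPolynomial.eval z (MvPolynomial.aeval g P) =
      MvPolynomial.eval (fun j => MvPolynomial.eval z (g j)) P := by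
  rw [MvPolynomial.aeval_def, MvPolynomial.hom_eval₂, MvPolynomial.eval, MvPolynomial.eval,
    MvPolynomial.coe_eval₂Hom, MvPolynomial.coe_eval₂Hom]
  congr 1
  ext x
  simp

lemma spec_pderiv {d : ℕ} (i k l : Fin d) (hik : i ≠ k) (hil : i ≠ l) (hkl : k ≠ l)
    (a : Fin d → ℝ) :
    let g : Fin d → MvPolynomial (Fin 3) ℝ := fun j => if j = i then MvPolynomial.X 0 else
      if j = k then MvPolynomial.X 1 else if j = l then MvPolynomial.X 2 else MvPolynomial.C (a j)
    (∀ j, MvPolynomial.pderiv 0 (g j) = if j = i then 1 else 0) ∧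
    (∀ j, MvPolynomial.pderiv 1 (g j) = if j = k then 1 else 0) ∧
    (∀ j, MvPolynomial.pderiv 2 (g j) = if j = l then 1 else 0) := by
  intro g
  have hgi : g i = MvPolynomial.X 0 := if_pos rfl
  have hgk : g k = MvPolynomial.X 1 := by
    simp only [g]; rw [if_neg hik.symm, if_pos trivial]
  have hgl : g l = MvPolynomial.X 2 := by
    simp only [g]; rw [if_neg hil.symm, if_neg hkl.symm, if_pos trivial]
  have hgo : ∀ j, j ≠ i → j ≠ k → j ≠ l → g j = MvPolynomial.C (a j) := by
    intro j h1 h2 h3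
    simp only [g]; rw [if_neg h1, if_neg h2, if_neg h3]
  refine ⟨fun j => ?_, fun j => ?_, fun j => ?_⟩
  all_goals
    by_cases h1 : j = i
    · rw [h1, hgi]; simp [MvPolynomial.pderiv_X, hik, hil]
    · by_cases h2 : j = k
      · rw [h2, hgk]; simp [MvPolynomial.pderiv_X, hik.symm, hkl]
      · by_cases h3 : j = l
        · rw [h3, hgl]; simp [MvPolynomial.pderiv_X, hil.symm, hkl.symm]
        · rw [hgo j h1 h2 h3]; simp [h1, h2, h3]

lemma caseD3 (d δ : ℕ) : ∃ c : ℝ, 0 < c ∧ ∃ N0 : ℕ, ∀ P : MvPolynomial (Fin d) ℝ,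
    P.totalDegree ≤ δ → ∀ i k l : Fin d, i ≠ k → i ≠ l → k ≠ l →
    MvPolynomial.pderiv i P ≠ 0 →
    (∃ z x', MvPolynomial.eval z (MvPolynomial.pderiv k P) *
        MvPolynomial.eval (Function.update z i x') (MvPolynomial.pderiv l P) ≠
      MvPolynomial.eval z (MvPolynomial.pderiv l P) *
        MvPolynomial.eval (Function.update z i x') (MvPolynomial.pderiv k P)) →
    ∀ A S : Finset ℝ, N0 ≤ A.card →
      (∀ a : Fin d → ℝ, (∀ j, a j ∈ A) → MvPolynomial.eval a P ∈ S) →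
      c * (A.card : ℝ) ^ ((3 : ℝ) / 2) ≤ S.card := by
  classical
  obtain ⟨c, hc, N0, H⟩ := caseB δ
  refine ⟨c, hc, N0 + 3 * δ + 1, ?_⟩
  intro P hPδ i k l hik hil hkl hPi hex A S hA hAS
  obtain ⟨z, x', hne⟩ := hex
  set g1 : Fin d → MvPolynomial (Fin d) ℝ := fun j =>
    if j = i then MvPolynomial.C x' else MvPolynomial.X j with hg1
  have hg1d : ∀ j, (g1 j).totalDegree ≤ 1 := by
    intro j
    simp only [hg1]
    split_ifs
    · simp
    · exact (MvPolynomial.totalDegree_X _).le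
  have hg1e : ∀ a : Fin d → ℝ, (fun j => MvPolynomial.eval a (g1 j)) = Function.update a i x' := by
    intro a
    ext j
    by_cases h : j = i
    · subst h; simp [hg1]
    · simp [hg1, h]
  set R : MvPolynomial (Fin d) ℝ :=
    MvPolynomial.pderiv k P * MvPolynomial.aeval g1 (MvPolynomial.pderiv l P) -
    MvPolynomial.pderiv l P * MvPolynomial.aeval g1 (MvPolynomial.pderiv k P) with hR
  have hRe : ∀ a, MvPolynomial.eval a R = MvPolynomial.eval a (MvPolynomial.pderiv k P) *
        MvPolynomial.eval (Function.update a i x') (MvPolynomial.pderiv l P) -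
      MvPolynomial.eval a (MvPolynomial.pderiv l P) *
        MvPolynomial.eval (Function.update a i x') (MvPolynomial.pderiv k P) := by
    intro a
    rw [hR, map_sub, map_mul, map_mul, ev_aeval, ev_aeval, hg1e]
  have hR0 : R ≠ 0 := by
    intro h0
    have := hRe z
    rw [h0, map_zero] at this
    exact hne (by linarith)
  have hpd : ∀ j, (MvPolynomial.pderiv j P).totalDegree ≤ δ := fun j =>
    (totalDegree_pderiv_le _ _).trans (by omega)
  have hRd : R.totalDegree ≤ 2 * δ := by
    have h1 := hpd k
    have h2 := hpd l
    have h3 := td_aeval g1 hg1d (MvPolynomial.pderiv k P)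
    have h4 := td_aeval g1 hg1d (MvPolynomial.pderiv l P)
    refine (MvPolynomial.totalDegree_sub _ _).trans (max_le ?_ ?_)
    · exact (MvPolynomial.totalDegree_mul _ _).trans (by omega)
    · exact (MvPolynomial.totalDegree_mul _ _).trans (by omega)
  have hQ0 : R * MvPolynomial.pderiv i P ≠ 0 := mul_ne_zero hR0 hPi
  have hQd : (R * MvPolynomial.pderiv i P).totalDegree ≤ 3 * δ := by
    have h1 := hpd i
    exact (MvPolynomial.totalDegree_mul _ _).trans (by omega)
  obtain ⟨a, haA, ha⟩ : ∃ a : Fin d → ℝ, (∀ j, a j ∈ A) ∧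
      MvPolynomial.eval a (R * MvPolynomial.pderiv i P) ≠ 0 := by
    by_contra hcon
    push Not at hcon
    refine hQ0 (MvPolynomial.eq_zero_of_eval_zero_at_prod_finset _ (fun _ => A) (fun j => ?_) hcon)
    have := MvPolynomial.degreeOf_le_totalDegree (R * MvPolynomial.pderiv i P) j
    omega
  rw [map_mul, hRe] at ha
  have ha1 := left_ne_zero_of_mul ha
  have ha2 := right_ne_zero_of_mul ha
  set g : Fin d → MvPolynomial (Fin 3) ℝ := fun j => if j = i then MvPolynomial.X 0 else
    if j = k then MvPolynomial.X 1 else if j = l then MvPolynomial.X 2 else MvPolynomial.C (a j)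
    with hg
  have hgd : ∀ j, (g j).totalDegree ≤ 1 := by
    intro j
    simp only [hg]
    split_ifs
    · exact (MvPolynomial.totalDegree_X _).le
    · exact (MvPolynomial.totalDegree_X _).le
    · exact (MvPolynomial.totalDegree_X _).le
    · simp
  have hge : ∀ x y w : ℝ, (fun j => MvPolynomial.eval ![x, y, w] (g j)) =
      fun j => if j = i then x else if j = k then y else if j = l then w else a j := by
    intro x y w
    ext j
    simp only [hg]
    split_ifs <;> simp
  have hge0 : (fun j => MvPolynomial.eval ![a i, a k, a l] (g j)) = a := by
    rw [hge]
    ext j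
    split_ifs with h1 h2 h3
    · rw [h1]
    · rw [h2]
    · rw [h3]
    · rfl
  have hge1 : (fun j => MvPolynomial.eval ![x', a k, a l] (g j)) = Function.update a i x' := by
    rw [hge]
    ext j
    split_ifs with h1 h2 h3
    · rw [h1]; simp
    · rw [h2]; simp [hik.symm]
    · rw [h3]; simp [hil.symm]
    · simp [h1]
  have hpg0 : ∀ j, MvPolynomial.pderiv 0 (g j) = if j = i then 1 else 0 :=
    (spec_pderiv i k l hik hil hkl a).1
  have hpg1 : ∀ j, MvPolynomial.pderiv 1 (g j) = if j = k then 1 else 0 :=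
    (spec_pderiv i k l hik hil hkl a).2.1
  have hpg2 : ∀ j, MvPolynomial.pderiv 2 (g j) = if j = l then 1 else 0 :=
    (spec_pderiv i k l hik hil hkl a).2.2
  have e0 : MvPolynomial.pderiv 0 (MvPolynomial.aeval g P) =
      MvPolynomial.aeval g (MvPolynomial.pderiv i P) := by
    rw [chain_rule]; simp [hpg0]
  have e1 : MvPolynomial.pderiv 1 (MvPolynomial.aeval g P) =
      MvPolynomial.aeval g (MvPolynomial.pderiv k P) := by
    rw [chain_rule]; simp [hpg1]
  have e2 : MvPolynomial.pderiv 2 (MvPolynomial.aeval g P) =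
      MvPolynomial.aeval g (MvPolynomial.pderiv l P) := by
    rw [chain_rule]; simp [hpg2]
  refine H (MvPolynomial.aeval g P) ((td_aeval g hgd P).trans hPδ) ?_ ?_ A S (by omega) ?_
  · intro h0
    rw [e0] at h0
    have := ev_aeval g (MvPolynomial.pderiv i P) ![a i, a k, a l]
    rw [h0, hge0, map_zero] at this
    exact ha2 this.symm
  · refine ⟨a i, x', a k, a l, ?_⟩
    rw [e1, e2, ev_aeval, ev_aeval, ev_aeval, ev_aeval, hge0, hge1]
    intro h
    apply ha1
    linarith
  · intro x hx y hy w hw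
    rw [ev_aeval, hge]
    apply hAS
    intro j
    split_ifs
    · exact hx
    · exact hy
    · exact hw
    · exact haA j

end

theorem stmt0 (d t δ : ℕ) (hd : 2 ≤ d) (ht1 : 1 ≤ t) (ht2 : t ≤ d - 1) :
    ∃ c : ℝ, 0 < c ∧
      ∀ P : MvPolynomial (Fin d) ℝ,
        P.totalDegree = δ →
        (∀ i : Fin d, 1 ≤ P.degreeOf i) →
        ¬ (∃ (f : Polynomial ℝ) (u : Fin d → Polynomial ℝ),
              0 < f.natDegree ∧ (∀ i, 0 < (u i).natDegree) ∧
              (∀ a : Fin d → ℝ,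
                MvPolynomial.eval a P = f.eval (∑ i, (u i).eval (a i))) ∧
              ∃ I : Finset (Fin d), I.card = d - (t - 1) / 2 ∧
                ∀ i ∈ I, ∀ j ∈ I, EquivA (u i) (u j)) →
        ¬ (∃ (f : Polynomial ℝ) (u : Fin d → Polynomial ℝ),
              0 < f.natDegree ∧ (∀ i, 0 < (u i).natDegree) ∧
              (∀ a : Fin d → ℝ,
                MvPolynomial.eval a P = f.eval (∏ i, (u i).eval (a i))) ∧
              ∃ I : Finset (Fin d), I.card = d - (t - 1) / 2 ∧
                ∀ i ∈ I, ∀ j ∈ I, EquivM (u i) (u j)) →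
        ∀ A : Finset ℝ,
          c * (A.card : ℝ) ^ ((3 : ℝ) / 2 - 1 / 2 ^ (t + 1)) ≤
            (((Fintype.piFinset fun _ : Fin d => A).image
                (fun a => MvPolynomial.eval a P)).card : ℝ) := by
  classical
  obtain ⟨c1, hc1, H1⟩ := sep_add d t δ ht1 (by omega)
  obtain ⟨c2, hc2, H2⟩ := sep_mul d t δ ht1 (by omega)
  -- the bound for polynomials that are not separable
  obtain ⟨c3, hc3, N0, H3⟩ : ∃ c : ℝ, 0 < c ∧ ∃ N0 : ℕ, ∀ P : MvPolynomial (Fin d) ℝ,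
      P.totalDegree = δ → (∀ i : Fin d, 1 ≤ P.degreeOf i) →
      (∃ p q : Fin d → Polynomial ℝ, (∀ i, p i ≠ 0) ∧ (∀ i, q i ≠ 0) ∧
        ∀ i j, i ≠ j → MvPolynomial.pderiv i P * uni i (q i) * uni j (p j) =
        MvPolynomial.pderiv j P * uni j (q j) * uni i (p i)) ∨
      ∀ A S : Finset ℝ, N0 ≤ A.card →
      (∀ a : Fin d → ℝ, (∀ j, a j ∈ A) → MvPolynomial.eval a P ∈ S) →
      c * (A.card : ℝ) ^ ((3 : ℝ) / 2 - 1 / 2 ^ (t + 1)) ≤ S.card := by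
    rcases Nat.lt_or_ge d 3 with h | h
    · obtain rfl : d = 2 := by omega
      obtain rfl : t = 1 := by omega
      obtain ⟨c, hc, N0, H⟩ := caseA δ
      refine ⟨c, hc, N0, fun P hPδ hP => ?_⟩
      refine or_iff_not_imp_left.2 fun hns => ?_
      intro A S hA hAS
      have hex := not_imp_comm.1 (sep2 P hP) hns
      have := H P hPδ.le (pd_ne P 0 (hP 0)) hex A S hA (fun x hx y hy => hAS _ (fun j => by
        fin_cases j
        · exact hx
        · exact hy))
      have he : (3 : ℝ) / 2 - 1 / 2 ^ (1 + 1) = 5 / 4 := by norm_num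
      rw [he]
      exact this
    · obtain ⟨c, hc, N0, H⟩ := caseD3 d δ
      refine ⟨c, hc, N0 + 1, fun P hPδ hP => ?_⟩
      refine or_iff_not_imp_left.2 fun hns => ?_
      intro A S hA hAS
      have hex := mt (sep3 h P hP) hns
      push Not at hex
      obtain ⟨i, k, l, hik, hil, hkl, z, x', hne⟩ := hex
      refine le_trans ?_ (H P hPδ.le i k l hik hil hkl (pd_ne P i (hP i)) ⟨z, x', hne⟩ A S
        (by omega) hAS)
      refine mul_le_mul_of_nonneg_left ?_ hc.le
      refine Real.rpow_le_rpow_of_exponent_le ?_ ?_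
      · have : 1 ≤ A.card := by omega
        exact_mod_cast this
      · have : (0 : ℝ) ≤ 1 / 2 ^ (t + 1) := by positivity
        linarith
  obtain ⟨c4, hc4, H4⟩ := small_n ((3 : ℝ) / 2 - 1 / 2 ^ (t + 1)) (exp_pos t) N0 c3 hc3
  refine ⟨min c1 (min c2 c4), by positivity, ?_⟩
  intro P hPδ hP hno1 hno2 A
  have hmono : ∀ c, min c1 (min c2 c4) ≤ c →
      min c1 (min c2 c4) * (A.card : ℝ) ^ ((3 : ℝ) / 2 - 1 / 2 ^ (t + 1)) ≤
      c * (A.card : ℝ) ^ ((3 : ℝ) / 2 - 1 / 2 ^ (t + 1)) := fun c h =>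
    mul_le_mul_of_nonneg_right h (by positivity)
  rcases H3 P hPδ hP with ⟨p, q, hp, hq, hcross⟩ | hbig
  · rcases alg_final hd P p q hp hq hP hcross with ⟨f, u, hf, hu, he⟩ | ⟨f, u, hf, hu, he⟩
    · exact (hmono c1 (min_le_left _ _)).trans (H1 P hPδ hno1 f u hf hu he A)
    · exact (hmono c2 ((min_le_right _ _).trans (min_le_left _ _))).trans
        (H2 P hPδ hno2 f u hf hu he A)
  · refine (hmono c4 ((min_le_right _ _).trans (min_le_right _ _))).trans ?_
    apply H4
    · intro hA
      obtain ⟨x, hx⟩ := Finset.card_pos.1 hA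
      exact Finset.card_pos.2 ⟨_, Finset.mem_image_of_mem _
        (Fintype.mem_piFinset.2 fun _ => hx)⟩
    · intro hA
      exact hbig A _ hA (fun a ha => Finset.mem_image_of_mem _ (Fintype.mem_piFinset.2 ha))
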